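/- As k → ∞: (∂v_k/∂x_i)(0) → 0 for i = 1, 2, and λ_k ∫_{B₁} e^{v_k(x)} ( (∂V/∂x₁)(x) x₁ − (∂V/∂x₂)(x) x₂ ) dx → 0. -/

import Mathlib

open MeasureTheory Filter Metric Set

noncomputable section

/-- Directional derivative of a function `f : ℂ → ℝ` in direction `v`. -/
def dderiv (v : ℂ) (f : ℂ → ℝ) : ℂ → ℝ := fun z => fderiv ℝ f z v

/-- Iterated partial derivative `∂ₓ^m ∂_y^n f` of `f : ℂ → ℝ`. -/
def pd (m n : ℕ) (f : ℂ → ℝ) : ℂ → ℝ := (dderiv 1)^[m] ((dderiv Complex.I)^[n] f)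

/-- Laplacian of `f : ℂ → ℝ`. -/
def lap (f : ℂ → ℝ) : ℂ → ℝ := fun z => pd 2 0 f z + pd 0 2 f z

/-- Gradient of `f : ℂ → ℝ` at `z`, viewed as a complex number. -/
def grad (f : ℂ → ℝ) (z : ℂ) : ℂ :=
  (dderiv 1 f z : ℂ) + (dderiv Complex.I f z : ℂ) * Complex.I

open scoped Real ComplexConjugate Topology

section PolarCoordinates

variable {E : Type*} [NormedAddCommGroup E] [NormedSpace ℝ E]

lemma polarCoord_symm_eq_circleMap (p : ℝ × ℝ) :
    Complex.polarCoord.symm p = circleMap 0 p.1 p.2 := by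
  simp [circleMap, Complex.exp_mul_I]

lemma integrable_comp_polarCoord_symm {f : ℂ → E} (hf : Integrable f) :
    IntegrableOn (fun p : ℝ × ℝ => p.1 • f (circleMap 0 p.1 p.2)) (Ioi 0 ×ˢ Ioo (-π) π) := by
  have h1 : Integrable (fun q : ℝ × ℝ => f (Complex.measurableEquivRealProd.symm q)) :=
    (Complex.volume_preserving_equiv_real_prod.symm).integrable_comp_of_integrable hf
  have h2 := (integrableOn_image_iff_integrableOn_abs_det_fderiv_smul volume
    (polarCoord.open_target.measurableSet)
    (fun p _ => (hasFDerivAt_polarCoord_symm p).hasFDerivWithinAt) polarCoord.symm.injOn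
    (fun q : ℝ × ℝ => f (Complex.measurableEquivRealProd.symm q))).1 h1.integrableOn
  rw [polarCoord_target] at h2
  refine h2.congr_fun ?_ (measurableSet_Ioi.prod measurableSet_Ioo)
  rintro p ⟨hp, -⟩
  simp only [det_fderivPolarCoordSymm]
  rw [abs_of_pos hp, Complex.measurableEquivRealProd_symm_polarCoord_symm_apply,
    polarCoord_symm_eq_circleMap]

/-- Polar coordinates on the disc `ball c R`: integrability and value of the integral. -/
lemma polar_ball {f : ℂ → E} {c : ℂ} {R : ℝ} (hf : IntegrableOn f (ball c R)) :
    IntegrableOn (fun p : ℝ × ℝ => p.1 • f (circleMap c p.1 p.2)) (Ioo 0 R ×ˢ Ioo (-π) π) ∧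
    ∫ z in ball c R, f z = ∫ p in Ioo 0 R ×ˢ Ioo (-π) π, p.1 • f (circleMap c p.1 p.2) := by
  set g : ℂ → E := fun z => (ball c R).indicator f (z + c) with hg
  have hgi : Integrable g := ((integrable_indicator_iff measurableSet_ball).2 hf).comp_add_right c
  have hsub : Ioo 0 R ×ˢ Ioo (-π) π ⊆ Ioi (0:ℝ) ×ˢ Ioo (-π) π :=
    prod_mono (fun x hx => hx.1) subset_rfl
  have hms : MeasurableSet (Ioo 0 R ×ˢ Ioo (-π) π) := measurableSet_Ioo.prod measurableSet_Ioo
  have key : ∀ p ∈ Ioo 0 R ×ˢ Ioo (-π) π,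
      p.1 • g (circleMap 0 p.1 p.2) = p.1 • f (circleMap c p.1 p.2) := by
    rintro p ⟨hp, -⟩
    have : circleMap 0 p.1 p.2 + c = circleMap c p.1 p.2 := by simp [circleMap, add_comm]
    rw [hg]; simp only [this]
    rw [indicator_of_mem]
    simp [mem_ball, dist_eq_norm, circleMap, abs_of_pos hp.1, hp.2]
  constructor
  · exact ((integrable_comp_polarCoord_symm hgi).mono_set hsub).congr_fun key hms
  · rw [← integral_indicator measurableSet_ball, ← integral_add_right_eq_self _ c]
    change ∫ z, g z = _
    rw [← Complex.integral_comp_polarCoord_symm]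
    simp_rw [polarCoord_symm_eq_circleMap]
    rw [polarCoord_target]
    rw [← setIntegral_congr_fun hms key]
    refine setIntegral_eq_of_subset_of_forall_sdiff_eq_zero
      (measurableSet_Ioi.prod measurableSet_Ioo) hsub ?_
    rintro p ⟨⟨hp0, hp1⟩, hp⟩
    have hR : R ≤ p.1 := by
      by_contra h
      exact hp ⟨⟨hp0, not_le.1 h⟩, hp1⟩
    rw [hg]; simp only
    rw [indicator_of_notMem, smul_zero]
    simp only [mem_ball, dist_eq_norm, circleMap]
    simp only [zero_add, add_sub_cancel_right, norm_mul, Complex.norm_real, Real.norm_eq_abs,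
      Complex.norm_exp_ofReal_mul_I, mul_one, not_lt]
    rw [abs_of_pos hp0]; exact hR

lemma polar_ball_angle_radius {f : ℂ → E} {c : ℂ} {R : ℝ} (hf : IntegrableOn f (ball c R)) :
    (∀ᵐ θ ∂(volume.restrict (Ioo (-π) π)),
      IntegrableOn (fun r : ℝ => r • f (circleMap c r θ)) (Ioo 0 R)) ∧
    ∫ z in ball c R, f z = ∫ θ in Ioo (-π) π, ∫ r in Ioo 0 R, r • f (circleMap c r θ) := by
  obtain ⟨h1, h2⟩ := polar_ball hf
  rw [IntegrableOn, Measure.volume_eq_prod, ← Measure.prod_restrict] at h1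
  refine ⟨h1.prod_left_ae, ?_⟩
  rw [h2, Measure.volume_eq_prod, ← Measure.prod_restrict, integral_prod_symm _ h1]

lemma polar_ball_radius_angle {f : ℂ → E} {c : ℂ} {R : ℝ} (hf : IntegrableOn f (ball c R)) :
    (∀ᵐ r ∂(volume.restrict (Ioo 0 R)),
      IntegrableOn (fun θ : ℝ => r • f (circleMap c r θ)) (Ioo (-π) π)) ∧
    ∫ z in ball c R, f z = ∫ r in Ioo 0 R, ∫ θ in Ioo (-π) π, r • f (circleMap c r θ) := by
  obtain ⟨h1, h2⟩ := polar_ball hf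
  rw [IntegrableOn, Measure.volume_eq_prod, ← Measure.prod_restrict] at h1
  refine ⟨h1.prod_right_ae, ?_⟩
  rw [h2, Measure.volume_eq_prod, ← Measure.prod_restrict, integral_prod _ h1]

variable [CompleteSpace E]

lemma integral_radial_deriv {H : ℂ → E} {H' : ℂ → ℂ →L[ℝ] E} {c : ℂ} {R : ℝ} (hR : 0 < R)
    (hc : ContinuousOn H (closedBall c R))
    (hd : ∀ z ∈ ball c R, z ≠ c → HasFDerivAt H (H' z) z)
    (hi : IntegrableOn (fun z => (‖z - c‖ ^ 2)⁻¹ • H' z (z - c)) (ball c R)) :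
    ∫ z in ball c R, (‖z - c‖ ^ 2)⁻¹ • H' z (z - c) =
      (∫ θ in (-π)..π, H (circleMap c R θ)) - (2 * π) • H c := by
  obtain ⟨h1, h2⟩ := polar_ball_angle_radius hi
  have hcirc : Continuous fun θ => H (circleMap c R θ) :=
    hc.comp_continuous (continuous_circleMap c R) (circleMap_mem_closedBall c hR.le)
  have h3 : ∀ᵐ θ ∂(volume.restrict (Ioo (-π) π)),
      ∫ r in Ioo 0 R, r • ((‖circleMap c r θ - c‖ ^ 2)⁻¹ •
        H' (circleMap c r θ) (circleMap c r θ - c)) = H (circleMap c R θ) - H c := by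
    filter_upwards [h1] with θ hθ
    have hc0 : H c = H (circleMap c 0 θ) := by simp
    have hcm : Continuous fun r : ℝ => circleMap c r θ := by unfold circleMap; fun_prop
    rw [← integral_Ioc_eq_integral_Ioo, ← intervalIntegral.integral_of_le hR.le, hc0]
    refine intervalIntegral.integral_eq_sub_of_hasDerivAt_of_le hR.le
      (f := fun r => H (circleMap c r θ)) ?_ ?_ ?_
    · refine hc.comp hcm.continuousOn fun r hr => ?_
      simp [mem_closedBall, dist_eq_norm, circleMap, abs_of_nonneg hr.1, hr.2]
    · intro r hr
      have hb : circleMap c r θ ∈ ball c R := by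
        simp [mem_ball, dist_eq_norm, circleMap, abs_of_pos hr.1, hr.2]
      have hd1 : HasDerivAt (fun r : ℝ => circleMap c r θ) (Complex.exp (θ * Complex.I)) r := by
        unfold circleMap
        simpa using ((Complex.ofRealCLM.hasDerivAt (x := r)).mul_const
          (Complex.exp (θ * Complex.I))).const_add c
      have hd2 := (hd _ hb (circleMap_ne_center hr.1.ne')).comp_hasDerivAt r hd1
      convert hd2 using 1
      · rfl
      have hz : circleMap c r θ - c = r • Complex.exp (θ * Complex.I) := by simp [circleMap]
      have hn : ‖circleMap c r θ - c‖ = r := by rw [hz]; simp [abs_of_pos hr.1]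
      rw [hn, hz, map_smul, smul_smul, smul_smul]
      have : r * ((r ^ 2)⁻¹ * r) = 1 := by field_simp [hr.1.ne']
      rw [← mul_assoc] at this
      rw [this, one_smul]
    · rw [intervalIntegrable_iff_integrableOn_Ioo_of_le hR.le]
      exact hθ
  rw [h2, integral_congr_ae h3, ← integral_Ioc_eq_integral_Ioo,
    ← intervalIntegral.integral_of_le (by linarith [Real.pi_pos]),
    intervalIntegral.integral_sub (hcirc.intervalIntegrable _ _) (by simp)]
  simp; ring_nf

lemma integral_angular_deriv {H : ℂ → E} {H' : ℂ → ℂ →L[ℝ] E} {c : ℂ} {R : ℝ}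
    (hd : ∀ z ∈ ball c R, z ≠ c → HasFDerivAt H (H' z) z)
    (hi : IntegrableOn (fun z => (‖z - c‖ ^ 2)⁻¹ • H' z (Complex.I * (z - c))) (ball c R)) :
    ∫ z in ball c R, (‖z - c‖ ^ 2)⁻¹ • H' z (Complex.I * (z - c)) = 0 := by
  obtain ⟨h1, h2⟩ := polar_ball_radius_angle hi
  have hpi : -π ≤ π := by linarith [Real.pi_pos]
  have h3 : ∀ᵐ r ∂(volume.restrict (Ioo 0 R)),
      ∫ θ in Ioo (-π) π, r • ((‖circleMap c r θ - c‖ ^ 2)⁻¹ •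
        H' (circleMap c r θ) (Complex.I * (circleMap c r θ - c))) = 0 := by
    filter_upwards [h1, ae_restrict_mem measurableSet_Ioo] with r hr hr0
    have hder : ∀ θ : ℝ, HasDerivAt (fun θ => r⁻¹ • H (circleMap c r θ))
        (r • ((‖circleMap c r θ - c‖ ^ 2)⁻¹ •
        H' (circleMap c r θ) (Complex.I * (circleMap c r θ - c)))) θ := by
      intro θ
      have hb : circleMap c r θ ∈ ball c R := by
        simp [mem_ball, dist_eq_norm, circleMap, abs_of_pos hr0.1, hr0.2]
      have hd2 := ((hd _ hb (circleMap_ne_center hr0.1.ne')).comp_hasDerivAt θ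
        (hasDerivAt_circleMap c r θ)).const_smul r⁻¹
      convert hd2 using 1
      · rfl
      have hn : ‖circleMap c r θ - c‖ = r := by simp [circleMap, abs_of_pos hr0.1]
      rw [hn, circleMap_sub_center, mul_comm Complex.I, smul_smul]
      congr 1
      field_simp [hr0.1.ne']
    rw [← integral_Ioc_eq_integral_Ioo, ← intervalIntegral.integral_of_le hpi]
    rw [intervalIntegral.integral_eq_sub_of_hasDerivAt (fun θ _ => hder θ)]
    · have : circleMap c r π = circleMap c r (-π) := by
        have := periodic_circleMap c r (-π)
        rw [← this]; congr 1; ring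
      simp [this]
    · rw [intervalIntegrable_iff_integrableOn_Ioo_of_le hpi]
      exact hr
  rw [h2, integral_congr_ae h3]; simp

end PolarCoordinates

/-- The Wirtinger derivative `∂/∂z`. -/
def dz (H : ℂ → ℂ) (z : ℂ) : ℂ := (fderiv ℝ H z 1 - Complex.I * fderiv ℝ H z Complex.I) / 2

/-- The Wirtinger derivative `∂/∂z̄`. -/
def dzb (H : ℂ → ℂ) (z : ℂ) : ℂ := (fderiv ℝ H z 1 + Complex.I * fderiv ℝ H z Complex.I) / 2

lemma clm_apply_eq {F : Type*} [NormedAddCommGroup F] [NormedSpace ℝ F] (L : ℂ →L[ℝ] F) (w : ℂ) :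
    L w = w.re • L 1 + w.im • L Complex.I := by
  conv_lhs => rw [← Complex.re_add_im w]
  have h1 : ((w.re : ℂ) + w.im * Complex.I) = w.re • (1:ℂ) + w.im • Complex.I := by simp
  rw [h1, map_add, map_smul, map_smul]

lemma fderiv_eq_dz_dzb (H : ℂ → ℂ) (z w : ℂ) :
    fderiv ℝ H z w = dz H z * w + dzb H z * conj w := by
  rw [clm_apply_eq, dz, dzb, Complex.real_smul, Complex.real_smul]
  conv_rhs => rw [← Complex.re_add_im w]
  simp only [map_add, map_mul, Complex.conj_ofReal, Complex.conj_I]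
  linear_combination ((w.im : ℂ) * fderiv ℝ H z Complex.I) * Complex.I_sq

lemma integrableOn_norm_rpow_neg {p : ℝ} (hp : p < 2) (c : ℂ) (R : ℝ) :
    IntegrableOn (fun z : ℂ => ‖z - c‖ ^ (-p)) (ball c R) := by
  have h0 : IntegrableOn (fun z : ℂ => ‖z‖ ^ (-p)) (ball 0 R) := by
    rw [integrableOn_fun_norm_addHaar volume (f := fun y : ℝ => y ^ (-p))]
    simp only [Complex.finrank_real_complex]
    rcases le_or_gt R 0 with hR | hR
    · simp [Ioo_eq_empty_of_le hR]
    have : IntegrableOn (fun y : ℝ => y ^ (1 - p)) (Ioo 0 R) := by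
      rw [← intervalIntegrable_iff_integrableOn_Ioo_of_le hR.le]
      exact intervalIntegral.intervalIntegrable_rpow' (by linarith)
    refine this.congr_fun (fun y hy => ?_) measurableSet_Ioo
    simp only [smul_eq_mul]
    rw [show (1 - p) = 1 + (-p) by ring, Real.rpow_add hy.1]; simp
  have h1 := (integrable_indicator_iff measurableSet_ball).2 h0
  have h2 := h1.comp_sub_right c
  rw [← integrable_indicator_iff measurableSet_ball]
  refine h2.congr (Eventually.of_forall fun z => ?_)
  simp [indicator, mem_ball, dist_eq_norm]

lemma integrableOn_inv_norm_sub (c a : ℂ) (R : ℝ) :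
    IntegrableOn (fun z : ℂ => ‖z - c‖⁻¹) (ball a R) := by
  have := integrableOn_norm_rpow_neg (p := 1) (by norm_num) c (R + dist a c)
  simp only [Real.rpow_neg_one] at this
  exact this.mono_set (ball_subset_ball' le_rfl)

lemma integral_ball_norm_sub (g : ℝ → ℝ) (c : ℂ) {R : ℝ} (hR : 0 < R) :
    ∫ z in ball c R, g ‖z - c‖ = 2 * π * ∫ r in (0)..R, r * g r := by
  have h := integral_fun_norm_addHaar (volume : Measure ℂ) ((Iio R).indicator g)
  rw [← integral_indicator measurableSet_ball,
    ← integral_add_right_eq_self _ c]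
  have e1 : (fun x : ℂ => (ball c R).indicator (fun z => g ‖z - c‖) (x + c)) =
      fun x : ℂ => (Iio R).indicator g ‖x‖ := by
    ext x; simp [indicator, mem_ball, dist_eq_norm]
  rw [e1, h]
  simp only [Complex.finrank_real_complex, smul_eq_mul, nsmul_eq_mul]
  have e2 : (volume : Measure ℂ).real (ball 0 1) = π := by
    simp [Measure.real]
  rw [e2, intervalIntegral.integral_of_le hR.le, integral_Ioc_eq_integral_Ioo]
  have e3 : (fun y : ℝ => y ^ (2 - 1) * (Iio R).indicator g y) =
      (Iio R).indicator (fun y => y * g y) := by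
    ext y; by_cases hy : y < R <;> simp [indicator, hy]
  rw [e3, setIntegral_indicator measurableSet_Iio, Ioi_inter_Iio]
  push_cast; ring

lemma integral_inv_norm_sub (c : ℂ) {R : ℝ} (hR : 0 < R) :
    ∫ z in ball c R, ‖z - c‖⁻¹ = 2 * π * R := by
  rw [integral_ball_norm_sub (fun r => r⁻¹) c hR]
  congr 1
  rw [intervalIntegral.integral_of_le hR.le]
  rw [setIntegral_congr_fun (g := fun _ => (1:ℝ)) measurableSet_Ioc
    (fun r hr => mul_inv_cancel₀ hr.1.ne')]
  simp [hR.le]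

lemma ae_ne_center (c : ℂ) (s : Set ℂ) : ∀ᵐ z ∂(volume.restrict s), z ≠ c :=
  ae_restrict_of_ae (Measure.ae_ne volume c)

section CauchyPompeiu

variable {H : ℂ → ℂ} {c : ℂ} {R : ℝ} {U : Set ℂ}

lemma integrableOn_fderiv_div (hU : IsOpen U) (hH : ContDiffOn ℝ 1 H U) (hs : closedBall c R ⊆ U)
    {w : ℂ → ℂ} (hw : Continuous w) (hwn : ∀ z, ‖w z‖ = ‖z - c‖) :
    IntegrableOn (fun z => (‖z - c‖ ^ 2)⁻¹ • fderiv ℝ H z (w z)) (ball c R) := by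
  have hc : ContinuousOn (fderiv ℝ H) (closedBall c R) :=
    (hH.continuousOn_fderiv_of_isOpen hU le_rfl).mono hs
  obtain ⟨C, hC⟩ := (isCompact_closedBall c R).exists_bound_of_continuousOn hc
  refine Integrable.mono' ((integrableOn_inv_norm_sub c c R).const_mul C) ?_ ?_
  · have m1 : AEStronglyMeasurable (fun z => (‖z - c‖ ^ 2)⁻¹) (volume.restrict (ball c R)) :=
      (Measurable.inv (by fun_prop)).aestronglyMeasurable
    have m2 : AEStronglyMeasurable (fun z => fderiv ℝ H z (w z)) (volume.restrict (ball c R)) :=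
      ((hc.mono ball_subset_closedBall).clm_apply hw.continuousOn).aestronglyMeasurable
        measurableSet_ball
    exact m1.smul m2
  · filter_upwards [ae_restrict_mem measurableSet_ball, ae_ne_center c (ball c R)] with z hz hzc
    have h0 : 0 < ‖z - c‖ := norm_pos_iff.2 (sub_ne_zero.2 hzc)
    rw [norm_smul, norm_inv, norm_pow, norm_norm]
    have h1 := (fderiv ℝ H z).le_opNorm (w z)
    rw [hwn] at h1
    have h2 := hC z (ball_subset_closedBall hz)
    calc (‖z - c‖ ^ 2)⁻¹ * ‖fderiv ℝ H z (w z)‖ ≤ (‖z - c‖ ^ 2)⁻¹ * (C * ‖z - c‖) := by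
          gcongr; exact h1.trans (by gcongr)
      _ = C * ‖z - c‖⁻¹ := by field_simp

lemma norm_smul_fderiv_sub (z : ℂ) (hz : z ≠ c) :
    dzb H z / (z - c) = ((1/2 : ℂ)) * ((‖z - c‖ ^ 2)⁻¹ • fderiv ℝ H z (z - c) +
      Complex.I * ((‖z - c‖ ^ 2)⁻¹ • fderiv ℝ H z (Complex.I * (z - c)))) ∧
    dz H z / conj (z - c) = ((1/2 : ℂ)) * ((‖z - c‖ ^ 2)⁻¹ • fderiv ℝ H z (z - c) -
      Complex.I * ((‖z - c‖ ^ 2)⁻¹ • fderiv ℝ H z (Complex.I * (z - c)))) := by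
  have h0 : z - c ≠ 0 := sub_ne_zero.2 hz
  have h0' : conj (z - c) ≠ 0 := (map_ne_zero _).2 h0
  have hn : ((‖z - c‖ : ℂ)) ^ 2 = (z - c) * conj (z - c) := (Complex.mul_conj' _).symm
  simp only [fderiv_eq_dz_dzb, map_mul, Complex.conj_I, Complex.real_smul, Complex.ofReal_inv,
    Complex.ofReal_pow, hn]
  generalize z - c = w at *
  generalize conj w = w' at *
  constructor
  · field_simp
    linear_combination (-(dz H z * w) + dzb H z * w') * Complex.I_sq
  · field_simp
    linear_combination ((dz H z * w) - dzb H z * w') * Complex.I_sq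

/-- Cauchy–Pompeiu formula at the centre of a disc. -/
lemma integral_dzb_div (hR : 0 < R) (hU : IsOpen U) (hH : ContDiffOn ℝ 1 H U)
    (hs : closedBall c R ⊆ U) :
    IntegrableOn (fun z => dzb H z / (z - c)) (ball c R) ∧
    ∫ z in ball c R, dzb H z / (z - c) = (∫ θ in (-π)..π, H (circleMap c R θ)) / 2 - π * H c := by
  have i1 := integrableOn_fderiv_div hU hH hs (w := fun z => z - c) (by fun_prop) (fun z => rfl)
  have i2 := integrableOn_fderiv_div hU hH hs (w := fun z => Complex.I * (z - c)) (by fun_prop)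
    (fun z => by simp)
  have hd : ∀ z ∈ ball c R, z ≠ c → HasFDerivAt H (fderiv ℝ H z) z := fun z hz _ =>
    ((hH.differentiableOn one_ne_zero).differentiableAt
      (hU.mem_nhds (hs (ball_subset_closedBall hz)))).hasFDerivAt
  have e1 := integral_radial_deriv hR (hH.continuousOn.mono hs) hd i1
  have e2 := integral_angular_deriv hd i2
  have ae : (fun z => dzb H z / (z - c)) =ᵐ[volume.restrict (ball c R)]
      fun z => ((1/2 : ℂ)) * ((‖z - c‖ ^ 2)⁻¹ • fderiv ℝ H z (z - c) +
        Complex.I * ((‖z - c‖ ^ 2)⁻¹ • fderiv ℝ H z (Complex.I * (z - c)))) := by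
    filter_upwards [ae_ne_center c (ball c R)] with z hz
    exact (norm_smul_fderiv_sub (H := H) z hz).1
  refine ⟨((i1.add (i2.const_mul Complex.I)).const_mul (1/2)).congr ae.symm, ?_⟩
  rw [integral_congr_ae ae, integral_const_mul, integral_add i1 (i2.const_mul _),
    integral_const_mul, e1, e2]
  simp; ring

/-- Conjugate Cauchy–Pompeiu formula at the centre of a disc. -/
lemma integral_dz_div (hR : 0 < R) (hU : IsOpen U) (hH : ContDiffOn ℝ 1 H U)
    (hs : closedBall c R ⊆ U) :
    IntegrableOn (fun z => dz H z / conj (z - c)) (ball c R) ∧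
    ∫ z in ball c R, dz H z / conj (z - c) =
      (∫ θ in (-π)..π, H (circleMap c R θ)) / 2 - π * H c := by
  have i1 := integrableOn_fderiv_div hU hH hs (w := fun z => z - c) (by fun_prop) (fun z => rfl)
  have i2 := integrableOn_fderiv_div hU hH hs (w := fun z => Complex.I * (z - c)) (by fun_prop)
    (fun z => by simp)
  have hd : ∀ z ∈ ball c R, z ≠ c → HasFDerivAt H (fderiv ℝ H z) z := fun z hz _ =>
    ((hH.differentiableOn one_ne_zero).differentiableAt
      (hU.mem_nhds (hs (ball_subset_closedBall hz)))).hasFDerivAt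
  have e1 := integral_radial_deriv hR (hH.continuousOn.mono hs) hd i1
  have e2 := integral_angular_deriv hd i2
  have ae : (fun z => dz H z / conj (z - c)) =ᵐ[volume.restrict (ball c R)]
      fun z => ((1/2 : ℂ)) * ((‖z - c‖ ^ 2)⁻¹ • fderiv ℝ H z (z - c) -
        Complex.I * ((‖z - c‖ ^ 2)⁻¹ • fderiv ℝ H z (Complex.I * (z - c)))) := by
    filter_upwards [ae_ne_center c (ball c R)] with z hz
    exact (norm_smul_fderiv_sub (H := H) z hz).2
  refine ⟨((i1.sub (i2.const_mul Complex.I)).const_mul (1/2)).congr ae.symm, ?_⟩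
  rw [integral_congr_ae ae, integral_const_mul, integral_sub i1 (i2.const_mul _),
    integral_const_mul, e1, e2]
  simp; ring

end CauchyPompeiu

section Wirtinger

variable {f g : ℂ → ℂ} {z : ℂ}

lemma dzb_mul (hf : DifferentiableAt ℝ f z) (hg : DifferentiableAt ℝ g z) :
    dzb (fun y => f y * g y) z = dzb f z * g z + f z * dzb g z := by
  simp only [dzb, fderiv_fun_mul hf hg]
  simp; ring

lemma dz_mul (hf : DifferentiableAt ℝ f z) (hg : DifferentiableAt ℝ g z) :
    dz (fun y => f y * g y) z = dz f z * g z + f z * dz g z := by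
  simp only [dz, fderiv_fun_mul hf hg]
  simp; ring

lemma dzb_of_holomorphic (hf : DifferentiableAt ℂ f z) : dzb f z = 0 := by
  have : fderiv ℝ f z = (fderiv ℂ f z).restrictScalars ℝ := hf.fderiv_restrictScalars ℝ
  simp only [dzb, this, ContinuousLinearMap.coe_restrictScalars']
  have h := (fderiv ℂ f z).map_smul Complex.I 1
  simp only [smul_eq_mul, mul_one] at h
  rw [h, ← mul_assoc, Complex.I_mul_I]; ring

lemma dz_of_holomorphic (hf : DifferentiableAt ℂ f z) : dz f z = deriv f z := by
  have : fderiv ℝ f z = (fderiv ℂ f z).restrictScalars ℝ := hf.fderiv_restrictScalars ℝ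
  simp only [dz, this, ContinuousLinearMap.coe_restrictScalars']
  have h := (fderiv ℂ f z).map_smul Complex.I 1
  simp only [smul_eq_mul, mul_one] at h
  rw [h, ← mul_assoc, Complex.I_mul_I, ← fderiv_apply_one_eq_deriv]; ring

lemma hasFDerivAt_comp_conj (hg : DifferentiableAt ℂ g (conj z)) :
    HasFDerivAt (fun y => g (conj y)) (((fderiv ℂ g (conj z)).restrictScalars ℝ).comp
      (Complex.conjCLE : ℂ →L[ℝ] ℂ)) z := by
  have h1 := hg.hasFDerivAt.restrictScalars ℝ
  have h2 : HasFDerivAt (fun y : ℂ => conj y) (Complex.conjCLE : ℂ →L[ℝ] ℂ) z :=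
    Complex.conjCLE.hasFDerivAt
  exact h1.comp z h2

lemma dzb_comp_conj (hg : DifferentiableAt ℂ g (conj z)) :
    dzb (fun y => g (conj y)) z = deriv g (conj z) := by
  rw [dzb, (hasFDerivAt_comp_conj hg).fderiv, ← fderiv_apply_one_eq_deriv]
  have h := (fderiv ℂ g (conj z)).map_smul Complex.I 1
  simp only [smul_eq_mul, mul_one] at h
  simp only [ContinuousLinearMap.comp_apply, ContinuousLinearMap.coe_restrictScalars',
    ContinuousLinearEquiv.coe_coe, Complex.conjCLE_apply, map_one, Complex.conj_I, map_neg, h]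
  linear_combination (-(fderiv ℂ g (conj z) 1) / 2) * Complex.I_mul_I

lemma dz_comp_conj (hg : DifferentiableAt ℂ g (conj z)) : dz (fun y => g (conj y)) z = 0 := by
  rw [dz, (hasFDerivAt_comp_conj hg).fderiv]
  have h := (fderiv ℂ g (conj z)).map_smul Complex.I 1
  simp only [smul_eq_mul, mul_one] at h
  simp only [ContinuousLinearMap.comp_apply, ContinuousLinearMap.coe_restrictScalars',
    ContinuousLinearEquiv.coe_coe, Complex.conjCLE_apply, map_one, Complex.conj_I, map_neg, h]
  linear_combination ((fderiv ℂ g (conj z) 1) / 2) * Complex.I_mul_I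

lemma dz_conj (z : ℂ) : dz (fun y => conj y) z = 0 :=
  dz_comp_conj (g := fun y => y) differentiableAt_id

lemma differentiableAt_conj (z : ℂ) : DifferentiableAt ℝ (fun y : ℂ => conj y) z :=
  Complex.conjCLE.differentiableAt

end Wirtinger

section Stokes

variable {G : ℂ → ℂ} {c : ℂ} {R : ℝ} {U : Set ℂ}

lemma integral_dzb (hR : 0 < R) (hU : IsOpen U) (hG : ContDiffOn ℝ 1 G U)
    (hs : closedBall c R ⊆ U) :
    ∫ z in ball c R, dzb G z =
      (∫ θ in (-π)..π, (circleMap c R θ - c) * G (circleMap c R θ)) / 2 := by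
  have hH : ContDiffOn ℝ 1 (fun z => (z - c) * G z) U := (contDiffOn_id.sub contDiffOn_const).mul hG
  have h := (integral_dzb_div hR hU hH hs).2
  simp only [sub_self, zero_mul, mul_zero, sub_zero] at h
  rw [← h]
  refine integral_congr_ae ?_
  filter_upwards [ae_restrict_mem measurableSet_ball, ae_ne_center c (ball c R)] with z hz hzc
  have hd : DifferentiableAt ℝ G z := (hG.differentiableOn one_ne_zero).differentiableAt
      (hU.mem_nhds (hs (ball_subset_closedBall hz)))
  rw [dzb_mul (by fun_prop) hd, dzb_of_holomorphic (f := fun z => z - c) (by fun_prop)]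
  have : z - c ≠ 0 := sub_ne_zero.2 hzc
  field_simp; ring

lemma integral_dz (hR : 0 < R) (hU : IsOpen U) (hG : ContDiffOn ℝ 1 G U)
    (hs : closedBall c R ⊆ U) :
    ∫ z in ball c R, dz G z =
      (∫ θ in (-π)..π, conj (circleMap c R θ - c) * G (circleMap c R θ)) / 2 := by
  have hcd : ContDiffOn ℝ 1 (fun z : ℂ => conj (z - c)) U :=
    (Complex.conjCLE.contDiff.comp (contDiff_id.sub contDiff_const)).contDiffOn
  have hH : ContDiffOn ℝ 1 (fun z => conj (z - c) * G z) U := hcd.mul hG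
  have h := (integral_dz_div hR hU hH hs).2
  simp only [sub_self, map_zero, zero_mul, mul_zero, sub_zero] at h
  rw [← h]
  refine integral_congr_ae ?_
  filter_upwards [ae_restrict_mem measurableSet_ball, ae_ne_center c (ball c R)] with z hz hzc
  have hn := hU.mem_nhds (hs (ball_subset_closedBall hz))
  have hd : DifferentiableAt ℝ G z := (hG.differentiableOn one_ne_zero).differentiableAt hn
  have e : dz (fun z : ℂ => conj (z - c)) z = 0 := by
    simp only [map_sub]
    exact dz_comp_conj (g := fun y => y - conj c) (by fun_prop)
  rw [dz_mul ((hcd.differentiableOn one_ne_zero).differentiableAt hn) hd, e]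
  have : conj (z - c) ≠ 0 := (map_ne_zero _).2 (sub_ne_zero.2 hzc)
  field_simp; ring

end Stokes

/-- The complex gradient `(u_x - i u_y) / 2` of a real function. -/
def du (u : ℂ → ℝ) (z : ℂ) : ℂ :=
  ((fderiv ℝ u z 1 : ℂ) - Complex.I * (fderiv ℝ u z Complex.I : ℂ)) / 2

lemma fderiv_ofReal {u : ℂ → ℝ} {z : ℂ} (hu : DifferentiableAt ℝ u z) (w : ℂ) :
    fderiv ℝ (fun y => (u y : ℂ)) z w = (fderiv ℝ u z w : ℂ) := by
  have := (Complex.ofRealCLM.hasFDerivAt.comp z hu.hasFDerivAt).fderiv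
  change fderiv ℝ (Complex.ofRealCLM ∘ u) z w = _
  rw [this]; simp

lemma dz_ofReal {u : ℂ → ℝ} {z : ℂ} (hu : DifferentiableAt ℝ u z) :
    dz (fun y => (u y : ℂ)) z = du u z := by
  simp only [dz, fderiv_ofReal hu, du]

lemma re_mul_du (u : ℂ → ℝ) (z w : ℂ) : 2 * (w * du u z).re = fderiv ℝ u z w := by
  rw [clm_apply_eq (fderiv ℝ u z) w, du]
  simp [Complex.mul_re]
  ring

/-- `u` is a `C²` solution of `-Δu = f` in the unit disc, with `f` continuous. -/
structure IsSol (u f : ℂ → ℝ) : Prop where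
  smooth : ContDiffOn ℝ 2 u (ball 0 1)
  cont : ContinuousOn f (ball 0 1)
  eq : ∀ z ∈ ball (0 : ℂ) 1, lap u z = - f z

namespace IsSol

variable {u f : ℂ → ℝ}

lemma contDiffOn_fderiv (h : IsSol u f) : ContDiffOn ℝ 1 (fderiv ℝ u) (ball 0 1) :=
  h.smooth.fderiv_of_isOpen isOpen_ball (by norm_num)

lemma contDiffOn_fderiv_apply (h : IsSol u f) (w : ℂ) :
    ContDiffOn ℝ 1 (fun z => fderiv ℝ u z w) (ball 0 1) :=
  h.contDiffOn_fderiv.clm_apply contDiffOn_const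

lemma contDiffOn_du (h : IsSol u f) : ContDiffOn ℝ 1 (du u) (ball 0 1) := by
  unfold du
  have h1 := Complex.ofRealCLM.contDiff.comp_contDiffOn (h.contDiffOn_fderiv_apply 1)
  have h2 := Complex.ofRealCLM.contDiff.comp_contDiffOn (h.contDiffOn_fderiv_apply Complex.I)
  exact (h1.sub (contDiffOn_const.mul h2)).div_const 2

lemma differentiableAt (h : IsSol u f) {z : ℂ} (hz : z ∈ ball (0 : ℂ) 1) : DifferentiableAt ℝ u z :=
  (h.smooth.differentiableOn two_ne_zero).differentiableAt (isOpen_ball.mem_nhds hz)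

lemma differentiableAt_du (h : IsSol u f) {z : ℂ} (hz : z ∈ ball (0 : ℂ) 1) :
    DifferentiableAt ℝ (du u) z :=
  (h.contDiffOn_du.differentiableOn one_ne_zero).differentiableAt (isOpen_ball.mem_nhds hz)

lemma dzb_du (h : IsSol u f) {z : ℂ} (hz : z ∈ ball (0 : ℂ) 1) : dzb (du u) z = -f z / 4 := by
  have hd : ∀ w, DifferentiableAt ℝ (fun z => fderiv ℝ u z w) z := fun w =>
    ((h.contDiffOn_fderiv_apply w).differentiableOn one_ne_zero).differentiableAt
      (isOpen_ball.mem_nhds hz)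
  have hdf : DifferentiableAt ℝ (fderiv ℝ u) z :=
    (h.contDiffOn_fderiv.differentiableOn one_ne_zero).differentiableAt (isOpen_ball.mem_nhds hz)
  have hsnd : ∀ w w', fderiv ℝ (fun z => fderiv ℝ u z w) z w' = fderiv ℝ (fderiv ℝ u) z w' w := by
    intro w w'
    rw [fderiv_clm_apply hdf (by fun_prop)]; simp
  have hsymm : fderiv ℝ (fun z => fderiv ℝ u z 1) z Complex.I =
      fderiv ℝ (fun z => fderiv ℝ u z Complex.I) z 1 := by
    rw [hsnd, hsnd]
    exact ((h.smooth.contDiffAt (isOpen_ball.mem_nhds hz)).isSymmSndFDerivAt (by simp)) _ _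
  have hlap : fderiv ℝ (fun z => fderiv ℝ u z 1) z 1 +
      fderiv ℝ (fun z => fderiv ℝ u z Complex.I) z Complex.I = -f z := h.eq z hz
  have e : ∀ w', fderiv ℝ (du u) z w' = ((fderiv ℝ (fun z => fderiv ℝ u z 1) z w' : ℂ) -
      Complex.I * (fderiv ℝ (fun z => fderiv ℝ u z Complex.I) z w' : ℂ)) / 2 := by
    intro w'
    have c1 := Complex.ofRealCLM.hasFDerivAt.comp z (hd 1).hasFDerivAt
    have c2 := Complex.ofRealCLM.hasFDerivAt.comp z (hd Complex.I).hasFDerivAt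
    have c3 := ((c1.sub (c2.const_mul Complex.I)).mul_const (2⁻¹ : ℂ)).fderiv
    have : du u = fun y => ((Complex.ofRealCLM ∘ fun z => fderiv ℝ u z 1) y -
        Complex.I * (Complex.ofRealCLM ∘ fun z => fderiv ℝ u z Complex.I) y) * 2⁻¹ := by
      ext y; simp [du, div_eq_mul_inv]
    rw [this]
    erw [c3]
    simp; ring
  rw [dzb, e, e, hsymm, show f z = -(fderiv ℝ (fun z => fderiv ℝ u z 1) z 1 +
    fderiv ℝ (fun z => fderiv ℝ u z Complex.I) z Complex.I) by linarith]
  push_cast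
  linear_combination (-(fderiv ℝ (fun z => fderiv ℝ u z Complex.I) z Complex.I : ℂ) / 4) *
    Complex.I_mul_I

lemma integrableOn (h : IsSol u f) {c : ℂ} {r : ℝ} (hs : closedBall c r ⊆ ball 0 1) :
    IntegrableOn f (ball c r) :=
  ((h.cont.mono hs).integrableOn_compact (isCompact_closedBall c r)).mono_set ball_subset_closedBall

lemma flux (h : IsSol u f) {c : ℂ} {r : ℝ} (hr : 0 < r) (hs : closedBall c r ⊆ ball 0 1) :
    ∫ θ in (-π)..π, fderiv ℝ u (circleMap c r θ) (circleMap c r θ - c) = - ∫ z in ball c r, f z := by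
  have h1 := integral_dzb hr isOpen_ball h.contDiffOn_du hs
  have h2 : ∫ z in ball c r, dzb (du u) z = ∫ z in ball c r, ((-f z / 4 : ℝ) : ℂ) := by
    refine setIntegral_congr_fun measurableSet_ball fun z hz => ?_
    simp only [h.dzb_du (hs (ball_subset_closedBall hz))]; push_cast; ring
  rw [h2, integral_complex_ofReal, integral_div, integral_neg] at h1
  have hcont : Continuous fun θ => (circleMap c r θ - c) * du u (circleMap c r θ) := by
    refine ((continuous_circleMap c r).sub continuous_const).mul ?_
    exact (h.contDiffOn_du.continuousOn.mono hs).comp_continuous (continuous_circleMap c r)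
      (circleMap_mem_closedBall c hr.le)
  have h3 : ∫ θ in (-π)..π, fderiv ℝ u (circleMap c r θ) (circleMap c r θ - c) =
      2 * (∫ θ in (-π)..π, (circleMap c r θ - c) * du u (circleMap c r θ)).re := by
    have := Complex.reCLM.intervalIntegral_comp_comm (hcont.intervalIntegrable (μ := volume) (-π) π)
    simp only [Complex.reCLM_apply] at this
    rw [← this, ← intervalIntegral.integral_const_mul]
    simp only [re_mul_du]
  rw [h3]
  have h4 := congrArg Complex.re h1
  simp only [Complex.ofReal_re] at h4
  have h5 : ((∫ θ in (-π)..π, (circleMap c r θ - c) * du u (circleMap c r θ)) / 2).re =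
    (∫ θ in (-π)..π, (circleMap c r θ - c) * du u (circleMap c r θ)).re / 2 := by simp
  rw [h5] at h4
  linarith

/-- The mean value formula. -/
lemma mean_formula (h : IsSol u f) {c : ℂ} {t : ℝ} (ht : 0 < t) (hs : closedBall c t ⊆ ball 0 1) :
    IntegrableOn (fun r => r⁻¹ * ∫ z in ball c r, f z) (Ioo 0 t) ∧
    2 * π * u c = (∫ θ in (-π)..π, u (circleMap c t θ)) +
      ∫ r in Ioo 0 t, r⁻¹ * ∫ z in ball c r, f z := by
  have hd : ∀ z ∈ ball c t, z ≠ c → HasFDerivAt u (fderiv ℝ u z) z := fun z hz _ =>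
    (h.differentiableAt (hs (ball_subset_closedBall hz))).hasFDerivAt
  have hi : IntegrableOn (fun z => (‖z - c‖ ^ 2)⁻¹ • fderiv ℝ u z (z - c)) (ball c t) := by
    have hc := h.contDiffOn_fderiv.continuousOn.mono hs
    obtain ⟨C, hC⟩ := (isCompact_closedBall c t).exists_bound_of_continuousOn hc
    refine Integrable.mono' ((integrableOn_inv_norm_sub c c t).const_mul C) ?_ ?_
    · have m1 : AEStronglyMeasurable (fun z => (‖z - c‖ ^ 2)⁻¹) (volume.restrict (ball c t)) :=
        (Measurable.inv (by fun_prop)).aestronglyMeasurable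
      have m2 : AEStronglyMeasurable (fun z => fderiv ℝ u z (z - c)) (volume.restrict (ball c t)) :=
        ((hc.mono ball_subset_closedBall).clm_apply (by fun_prop)).aestronglyMeasurable
          measurableSet_ball
      exact m1.smul m2
    · filter_upwards [ae_restrict_mem measurableSet_ball, ae_ne_center c (ball c t)] with z hz hzc
      have h0 : 0 < ‖z - c‖ := norm_pos_iff.2 (sub_ne_zero.2 hzc)
      rw [norm_smul, norm_inv, norm_pow, norm_norm]
      have h1 := (fderiv ℝ u z).le_opNorm (z - c)
      have h2 := hC z (ball_subset_closedBall hz)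
      calc (‖z - c‖ ^ 2)⁻¹ * ‖fderiv ℝ u z (z - c)‖ ≤ (‖z - c‖ ^ 2)⁻¹ * (C * ‖z - c‖) := by
            gcongr; exact h1.trans (by gcongr)
        _ = C * ‖z - c‖⁻¹ := by field_simp
  have e1 := integral_radial_deriv ht (h.smooth.continuousOn.mono hs) hd hi
  obtain ⟨-, e2⟩ := polar_ball_radius_angle hi
  obtain ⟨e3, -⟩ := polar_ball hi
  rw [IntegrableOn, Measure.volume_eq_prod, ← Measure.prod_restrict] at e3
  have e4 := e3.integral_prod_left
  have key : ∀ r ∈ Ioo 0 t, ∫ θ in Ioo (-π) π, r • ((‖circleMap c r θ - c‖ ^ 2)⁻¹ •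
      fderiv ℝ u (circleMap c r θ) (circleMap c r θ - c)) = -(r⁻¹ * ∫ z in ball c r, f z) := by
    intro r hr
    have hfl := h.flux hr.1 ((closedBall_subset_closedBall hr.2.le).trans hs)
    have hn : ∀ θ, ‖circleMap c r θ - c‖ = r := fun θ => by simp [circleMap, abs_of_pos hr.1]
    simp only [hn, smul_eq_mul]
    rw [← integral_Ioc_eq_integral_Ioo, ← intervalIntegral.integral_of_le (by linarith [Real.pi_pos]),
      intervalIntegral.integral_const_mul, intervalIntegral.integral_const_mul, hfl]
    have := hr.1.ne'
    field_simp
  constructor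
  · refine (e4.neg).congr ?_
    filter_upwards [ae_restrict_mem measurableSet_Ioo] with r hr
    simp only [Pi.neg_apply]
    rw [key r hr, neg_neg]
  · rw [e2, setIntegral_congr_fun measurableSet_Ioo key, integral_neg] at e1
    simp only [smul_eq_mul] at e1
    linarith

end IsSol

lemma neg_pi_le_pi : -π ≤ π := by linarith [Real.pi_pos]

lemma norm_circleMap_sub {c : ℂ} {r θ : ℝ} (hr : 0 ≤ r) : ‖circleMap c r θ - c‖ = r := by
  simp [circleMap, abs_of_nonneg hr]

lemma continuous_comp_circleMap {F : Type*} [TopologicalSpace F] {g : ℂ → F} {c : ℂ} {r : ℝ}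
    (hr : 0 ≤ r)
    (hg : ContinuousOn g (sphere c r)) : Continuous fun θ => g (circleMap c r θ) :=
  hg.comp_continuous (continuous_circleMap c r) (circleMap_mem_sphere c hr)

lemma circle_integral_mono {g h : ℂ → ℝ} {c : ℂ} {r : ℝ} (hr : 0 ≤ r)
    (hg : ContinuousOn g (sphere c r)) (hh : ContinuousOn h (sphere c r))
    (hgh : ∀ z ∈ sphere c r, g z ≤ h z) :
    ∫ θ in (-π)..π, g (circleMap c r θ) ≤ ∫ θ in (-π)..π, h (circleMap c r θ) :=
  intervalIntegral.integral_mono_on neg_pi_le_pi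
    ((continuous_comp_circleMap hr hg).intervalIntegrable _ _)
    ((continuous_comp_circleMap hr hh).intervalIntegrable _ _)
    (fun θ _ => hgh _ (circleMap_mem_sphere c hr θ))

/-- Polar lower bound for an integral over a disc. -/
lemma polar_lower_bound {g : ℂ → ℝ} {c : ℂ} {R : ℝ} (hg : IntegrableOn g (ball c R)) {φ : ℝ → ℝ}
    (hφ : IntegrableOn (fun r => r * φ r) (Ioo 0 R))
    (hle : ∀ r ∈ Ioo 0 R, φ r ≤ ∫ θ in (-π)..π, g (circleMap c r θ)) :
    ∫ r in Ioo 0 R, r * φ r ≤ ∫ z in ball c R, g z := by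
  obtain ⟨-, e2⟩ := polar_ball_radius_angle hg
  obtain ⟨e3, -⟩ := polar_ball hg
  rw [IntegrableOn, Measure.volume_eq_prod, ← Measure.prod_restrict] at e3
  have e4 := e3.integral_prod_left
  rw [e2]
  refine setIntegral_mono_on hφ e4 measurableSet_Ioo fun r hr => ?_
  have := hle r hr
  simp only [smul_eq_mul]
  rw [← integral_Ioc_eq_integral_Ioo, ← intervalIntegral.integral_of_le neg_pi_le_pi,
    intervalIntegral.integral_const_mul]
  exact mul_le_mul_of_nonneg_left this hr.1.le

lemma exp_ge_tangent (s m : ℝ) : Real.exp m * (1 + (s - m)) ≤ Real.exp s := by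
  have h := Real.add_one_le_exp (s - m)
  calc Real.exp m * (1 + (s - m)) ≤ Real.exp m * Real.exp (s - m) := by gcongr; linarith
    _ = Real.exp s := by rw [← Real.exp_add]; congr 1; ring

lemma circle_integral_exp_ge {u : ℂ → ℝ} {c : ℂ} {r : ℝ} (hr : 0 ≤ r)
    (hu : ContinuousOn u (sphere c r)) (m : ℝ) :
    Real.exp m * (2 * π + ((∫ θ in (-π)..π, u (circleMap c r θ)) - 2 * π * m)) ≤
      ∫ θ in (-π)..π, Real.exp (u (circleMap c r θ)) := by
  have h1 := circle_integral_mono (g := fun z => Real.exp m * (1 + (u z - m)))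
    (h := fun z => Real.exp (u z)) hr (by fun_prop) (by fun_prop) (fun z _ => exp_ge_tangent _ _)
  refine le_trans (le_of_eq ?_) h1
  have hi := (continuous_comp_circleMap hr hu).intervalIntegrable (μ := volume) (-π) π
  rw [intervalIntegral.integral_const_mul, intervalIntegral.integral_add (by simp)
    (hi.sub (by simp)), intervalIntegral.integral_sub hi (by simp)]
  simp; ring

namespace IsSol

variable {u f : ℂ → ℝ}

lemma le_circle_integral (h : IsSol u f) {c : ℂ} {t K : ℝ} (ht : 0 < t)
    (hs : closedBall c t ⊆ ball 0 1) (hK : ∀ z ∈ ball c t, f z ≤ K) :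
    2 * π * u c ≤ (∫ θ in (-π)..π, u (circleMap c t θ)) + K * π * t ^ 2 / 2 := by
  obtain ⟨h1, h2⟩ := h.mean_formula ht hs
  have h3 : ∀ r ∈ Ioo 0 t, r⁻¹ * ∫ z in ball c r, f z ≤ K * π * r := by
    intro r hr
    have hsub : closedBall c r ⊆ ball 0 1 := (closedBall_subset_closedBall hr.2.le).trans hs
    have h4 : ∫ z in ball c r, f z ≤ ∫ z in ball c r, K :=
      setIntegral_mono_on (h.integrableOn hsub) (integrableOn_const measure_ball_lt_top.ne)
        measurableSet_ball fun z hz => hK z (ball_subset_ball hr.2.le hz)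
    have h5 : ∫ z in ball c r, K = π * r ^ 2 * K := by
      simp [Measure.real, hr.1.le]; left; ring
    rw [h5] at h4
    rw [inv_mul_le_iff₀ hr.1]
    linarith
  have h6 : ∫ r in Ioo 0 t, r⁻¹ * ∫ z in ball c r, f z ≤ ∫ r in Ioo 0 t, K * π * r := by
    refine setIntegral_mono_on h1 ?_ measurableSet_Ioo h3
    exact ((by fun_prop : Continuous fun r => K * π * r).integrableOn_Icc (a := 0) (b := t)).mono_set
      Ioo_subset_Icc_self
  have h7 : ∫ r in Ioo 0 t, K * π * r = K * π * t ^ 2 / 2 := by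
    rw [← integral_Ioc_eq_integral_Ioo, ← intervalIntegral.integral_of_le ht.le,
      intervalIntegral.integral_const_mul, integral_id]; ring
  linarith

lemma log_mass_le (h : IsSol u f) (hf : ∀ z ∈ ball (0 : ℂ) 1, 0 ≤ f z)
    (huc : ContinuousOn u (closedBall 0 1)) (hu0 : ∀ z ∈ sphere (0 : ℂ) 1, u z = 0)
    {r : ℝ} (hr : 0 < r) (hr1 : r < 1) :
    Real.log (1 / r) * ∫ z in ball 0 r, f z ≤ ∫ θ in (-π)..π, u (circleMap 0 r θ) := by
  set m := ∫ z in ball 0 r, f z with hm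
  have hsub : ∀ t < (1:ℝ), closedBall (0:ℂ) t ⊆ ball 0 1 := fun t ht => closedBall_subset_ball ht
  have key : ∀ t ∈ Ioo r 1, Real.log (t / r) * m + ∫ θ in (-π)..π, u (circleMap 0 t θ) ≤
      ∫ θ in (-π)..π, u (circleMap 0 r θ) := by
    intro t ht
    obtain ⟨a1, a2⟩ := h.mean_formula (hr.trans ht.1) (hsub t ht.2)
    obtain ⟨b1, b2⟩ := h.mean_formula hr (hsub r hr1)
    have hun : Ioo 0 t = Ioc 0 r ∪ Ioo r t := (Ioc_union_Ioo_eq_Ioo hr.le ht.1).symm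
    have c1 : IntegrableOn (fun r => r⁻¹ * ∫ z in ball 0 r, f z) (Ioo r t) :=
      a1.mono_set (Ioo_subset_Ioo_left hr.le)
    have hsplit : ∫ s in Ioo 0 t, s⁻¹ * ∫ z in ball 0 s, f z =
        (∫ s in Ioo 0 r, s⁻¹ * ∫ z in ball 0 s, f z) +
          ∫ s in Ioo r t, s⁻¹ * ∫ z in ball 0 s, f z := by
      rw [hun, setIntegral_union _ measurableSet_Ioo _ c1, integral_Ioc_eq_integral_Ioo]
      · exact disjoint_left.2 fun x hx hx' => not_lt.2 hx.2 hx'.1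
      · exact a1.mono_set (by rw [hun]; exact subset_union_left)
    have hlow : ∫ s in Ioo r t, s⁻¹ * m ≤ ∫ s in Ioo r t, s⁻¹ * ∫ z in ball 0 s, f z := by
      refine setIntegral_mono_on ?_ c1 measurableSet_Ioo fun s hs => ?_
      · have : ContinuousOn (fun s : ℝ => s⁻¹ * m) (Icc r t) :=
          (continuousOn_inv₀.mono fun s hs => (hr.trans_le hs.1).ne').mul continuousOn_const
        exact (this.integrableOn_Icc).mono_set Ioo_subset_Icc_self
      · have hs1 : s < 1 := hs.2.trans ht.2
        have : m ≤ ∫ z in ball 0 s, f z := by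
          refine setIntegral_mono_set (h.integrableOn (hsub s hs1)) ?_
            (ball_subset_ball hs.1.le).eventuallyLE
          filter_upwards [ae_restrict_mem measurableSet_ball] with z hz
          exact hf z (ball_subset_ball hs1.le hz)
        exact mul_le_mul_of_nonneg_left this (inv_nonneg.2 (hr.trans hs.1).le)
    have hval : ∫ s in Ioo r t, s⁻¹ * m = Real.log (t / r) * m := by
      rw [integral_mul_const, ← integral_Ioc_eq_integral_Ioo,
        ← intervalIntegral.integral_of_le ht.1.le, integral_inv_of_pos hr (hr.trans ht.1)]
    linarith
  have hlim : Tendsto (fun t => Real.log (t / r) * m + ∫ θ in (-π)..π, u (circleMap 0 t θ))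
      (nhdsWithin 1 (Ioo r 1)) (nhds (Real.log (1 / r) * m + ∫ θ in (-π)..π, u (circleMap 0 1 θ))) := by
    refine Tendsto.add ?_ ?_
    · refine Tendsto.mul_const m ?_
      have : ContinuousAt (fun t => Real.log (t / r)) 1 :=
        (continuousAt_id.div_const r).log (by simpa using hr.ne')
      exact this.tendsto.mono_left nhdsWithin_le_nhds
    · obtain ⟨C, hC⟩ := (isCompact_closedBall (0:ℂ) 1).exists_bound_of_continuousOn huc
      have hmem : ∀ t ∈ Ioo r 1, ∀ θ, circleMap 0 t θ ∈ closedBall (0:ℂ) 1 := fun t ht θ => by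
        simp [circleMap, abs_of_pos (hr.trans ht.1), ht.2.le]
      refine intervalIntegral.tendsto_integral_filter_of_dominated_convergence (fun _ => C) ?_ ?_
        (by simp) ?_
      · filter_upwards [self_mem_nhdsWithin] with t ht
        exact (continuous_comp_circleMap (hr.trans ht.1).le (huc.mono (sphere_subset_closedBall.trans
          (closedBall_subset_closedBall ht.2.le)))).aestronglyMeasurable
      · filter_upwards [self_mem_nhdsWithin] with t ht
        exact Eventually.of_forall fun θ _ => hC _ (hmem t ht θ)
      · refine Eventually.of_forall fun θ _ => ?_
        have h1 : circleMap (0:ℂ) 1 θ ∈ closedBall (0:ℂ) 1 := circleMap_mem_closedBall 0 zero_le_one θ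
        have h2 := huc _ h1
        refine h2.tendsto.comp (tendsto_nhdsWithin_iff.2 ⟨?_, ?_⟩)
        · have : Continuous fun t : ℝ => circleMap (0:ℂ) t θ := by unfold circleMap; fun_prop
          exact (this.tendsto 1).mono_left nhdsWithin_le_nhds
        · filter_upwards [self_mem_nhdsWithin] with t ht using hmem t ht θ
  have hz : ∫ θ in (-π)..π, u (circleMap 0 1 θ) = 0 := by
    rw [intervalIntegral.integral_congr (g := fun _ => 0)
      (fun θ _ => hu0 _ (circleMap_mem_sphere 0 zero_le_one θ))]
    simp
  rw [hz, add_zero] at hlim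
  have : (nhdsWithin (1:ℝ) (Ioo r 1)).NeBot := by
    rw [nhdsWithin_Ioo_eq_nhdsLT hr1]; infer_instance
  refine le_of_tendsto hlim ?_
  filter_upwards [self_mem_nhdsWithin] with t ht
  exact key t ht

end IsSol

lemma dzb_congr {f g : ℂ → ℂ} {z : ℂ} (h : f =ᶠ[nhds z] g) : dzb f z = dzb g z := by
  simp only [dzb, h.fderiv_eq]

lemma dzb_add {f g : ℂ → ℂ} {z : ℂ} (hf : DifferentiableAt ℝ f z) (hg : DifferentiableAt ℝ g z) :
    dzb (fun y => f y + g y) z = dzb f z + dzb g z := by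
  simp only [dzb, fderiv_fun_add hf hg]
  simp; ring

lemma dzb_zero (z : ℂ) : dzb (fun _ => 0) z = 0 := by simp [dzb]

/-- Cauchy–Pompeiu formula at an arbitrary interior point. -/
lemma integral_dzb_div_off {H : ℂ → ℂ} {c x : ℂ} {R : ℝ} {U : Set ℂ} (hU : IsOpen U)
    (hH : ContDiffOn ℝ 1 H U) (hs : closedBall c R ⊆ U) (hx : x ∈ ball c R) :
    IntegrableOn (fun z => dzb H z / (z - x)) (ball c R) ∧
    ∫ z in ball c R, dzb H z / (z - x) =
      (∫ θ in (-π)..π, (circleMap c R θ - c) * (H (circleMap c R θ) / (circleMap c R θ - x))) / 2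
        - π * H x := by
  have hR : 0 < R := pos_of_mem_ball hx
  have hdist : 0 < R - dist x c := by rw [mem_ball] at hx; linarith
  set δ := (R - dist x c) / 4 with hδ
  have hδ0 : 0 < δ := by positivity
  let ω : ContDiffBump x := ⟨δ, 2 * δ, hδ0, by linarith⟩
  have hωs : ContDiff ℝ 1 ω := ω.contDiff
  have hωc : ContDiff ℝ 1 (fun z => (ω z : ℂ)) := Complex.ofRealCLM.contDiff.comp hωs
  have hsub : closedBall x (3 * δ) ⊆ ball c R := by
    refine closedBall_subset_ball' ?_
    linarith
  have hd : ∀ z ∈ ball c R, DifferentiableAt ℝ H z := fun z hz =>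
    (hH.differentiableOn one_ne_zero).differentiableAt
      (hU.mem_nhds (hs (ball_subset_closedBall hz)))
  set H1 : ℂ → ℂ := fun z => ω z * H z with hH1
  set H2 : ℂ → ℂ := fun z => (1 - ω z) * H z with hH2
  have s1 : ContDiffOn ℝ 1 H1 U := hωc.contDiffOn.mul hH
  have s2 : ContDiffOn ℝ 1 H2 U := (contDiffOn_const.sub hωc.contDiffOn).mul hH
  have hd1 : ∀ z ∈ ball c R, DifferentiableAt ℝ H1 z := fun z hz =>
    (s1.differentiableOn one_ne_zero).differentiableAt
      (hU.mem_nhds (hs (ball_subset_closedBall hz)))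
  have hd2 : ∀ z ∈ ball c R, DifferentiableAt ℝ H2 z := fun z hz =>
    (s2.differentiableOn one_ne_zero).differentiableAt
      (hU.mem_nhds (hs (ball_subset_closedBall hz)))
  -- the part supported near `x`
  obtain ⟨i1, e1⟩ := integral_dzb_div (c := x) (R := 3 * δ) (by positivity) hU s1
    (hsub.trans (ball_subset_closedBall.trans hs))
  have hω0 : ∀ z, 2 * δ ≤ dist z x → ω z = 0 := fun z hz => ω.zero_of_le_dist hz
  have z1 : ∀ z, z ∉ ball x (3 * δ) → dzb H1 z / (z - x) = 0 := by
    intro z hz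
    have : H1 =ᶠ[nhds z] fun _ => 0 := by
      have : ∀ᶠ y in nhds z, 2 * δ < dist y x := by
        refine (continuous_id.dist continuous_const).continuousAt.eventually_const_lt ?_
        simp only [mem_ball, not_lt, id] at hz ⊢; linarith
      filter_upwards [this] with y hy
      simp [hH1, hω0 y hy.le]
    rw [dzb_congr this, dzb_zero, zero_div]
  have j1 : IntegrableOn (fun z => dzb H1 z / (z - x)) (ball c R) :=
    (i1.integrable_of_forall_notMem_eq_zero z1).integrableOn
  have e1' : ∫ z in ball c R, dzb H1 z / (z - x) = - (π * H x) := by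
    rw [setIntegral_eq_of_subset_of_forall_sdiff_eq_zero measurableSet_ball
      (ball_subset_closedBall.trans hsub) (fun z hz => z1 z hz.2), e1]
    have : ∀ θ, H1 (circleMap x (3 * δ) θ) = 0 := by
      intro θ
      have : ω (circleMap x (3 * δ) θ) = 0 := hω0 _ (by
        rw [dist_eq_norm, norm_circleMap_sub (by positivity)]; linarith)
      simp [hH1, this]
    have hx1 : H1 x = H x := by
      have : ω x = 1 := ω.one_of_mem_closedBall (mem_closedBall_self hδ0.le)
      simp [hH1, this]
    simp [this, hx1]
  -- the part away from `x`
  set G : ℂ → ℂ := fun z => H2 z / (z - x) with hG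
  have hnear : ∀ z, dist z x < δ → G =ᶠ[nhds z] fun _ => 0 := by
    intro z hz
    have : ∀ᶠ y in nhds z, dist y x < δ :=
      (continuous_id.dist continuous_const).continuousAt.eventually_lt_const hz
    filter_upwards [this] with y hy
    have : ω y = 1 := ω.one_of_mem_closedBall (mem_closedBall.2 hy.le)
    simp [hG, hH2, this]
  have sG : ContDiffOn ℝ 1 G U := by
    intro z hz
    by_cases hzx : dist z x < δ
    · exact ((contDiffAt_const (c := (0:ℂ))).congr_of_eventuallyEq (hnear z hzx)).contDiffWithinAt
    · have hne : z - x ≠ 0 := by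
        intro h; apply hzx; rw [sub_eq_zero.1 h, dist_self]; exact hδ0
      simp only [hG, div_eq_mul_inv]
      exact (s2 z hz).mul ((contDiffWithinAt_id.sub contDiffWithinAt_const).inv hne)
  have e2 := integral_dzb hR hU sG hs
  have hG' : ∀ z ∈ ball c R, dzb H2 z / (z - x) = dzb G z := by
    intro z hz
    by_cases hzx : dist z x < δ
    · rw [dzb_congr (hnear z hzx), dzb_zero]
      have : H2 =ᶠ[nhds z] fun _ => 0 := by
        have : ∀ᶠ y in nhds z, dist y x < δ :=
          (continuous_id.dist continuous_const).continuousAt.eventually_lt_const hzx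
        filter_upwards [this] with y hy
        have : ω y = 1 := ω.one_of_mem_closedBall (mem_closedBall.2 hy.le)
        simp [hH2, this]
      rw [dzb_congr this, dzb_zero, zero_div]
    · have hne : z - x ≠ 0 := by
        intro h; apply hzx; rw [sub_eq_zero.1 h, dist_self]; exact hδ0
      have hinv : DifferentiableAt ℂ (fun z => (z - x)⁻¹) z :=
        ((differentiableAt_id).sub_const x).inv hne
      simp only [hG, div_eq_mul_inv]
      rw [dzb_mul (hd2 z hz) (hinv.restrictScalars ℝ), dzb_of_holomorphic hinv]
      ring
  have iG : IntegrableOn (fun z => dzb G z) (ball c R) := by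
    have hc : ContinuousOn (fun z => dzb G z) (closedBall c R) := by
      have := (sG.continuousOn_fderiv_of_isOpen hU le_rfl).mono hs
      unfold dzb
      fun_prop
    exact (hc.integrableOn_compact (isCompact_closedBall c R)).mono_set ball_subset_closedBall
  have j2 : IntegrableOn (fun z => dzb H2 z / (z - x)) (ball c R) :=
    iG.congr_fun (fun z hz => (hG' z hz).symm) measurableSet_ball
  have e2' : ∫ z in ball c R, dzb H2 z / (z - x) =
      (∫ θ in (-π)..π,
        (circleMap c R θ - c) * (H (circleMap c R θ) / (circleMap c R θ - x))) / 2 := by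
    rw [setIntegral_congr_fun measurableSet_ball hG', e2]
    congr 1
    refine intervalIntegral.integral_congr fun θ _ => ?_
    have : ω (circleMap c R θ) = 0 := by
      apply hω0
      have h1 : dist (circleMap c R θ) c = R := by
        rw [dist_eq_norm, norm_circleMap_sub hR.le]
      have h2 := dist_triangle (circleMap c R θ) x c
      linarith
    simp [hG, hH2, this]
  have hsum : ∀ z ∈ ball c R,
      dzb H1 z / (z - x) + dzb H2 z / (z - x) = dzb H z / (z - x) := by
    intro z hz
    rw [← add_div, ← dzb_add (hd1 z hz) (hd2 z hz)]
    congr 2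
    ext y; simp only [hH1, hH2]; ring
  refine ⟨(j1.add j2).congr_fun hsum measurableSet_ball, ?_⟩
  rw [← setIntegral_congr_fun measurableSet_ball hsum, integral_add j1 j2, e1', e2']
  ring

namespace IsSol

variable {u f : ℂ → ℝ}

lemma sq_sub_mul_conj_ne_zero {x y : ℂ} {R : ℝ} (hR : 0 < R) (hx : ‖x‖ < R) (hy : ‖y‖ ≤ R) :
    (R : ℂ) ^ 2 - x * conj y ≠ 0 := by
  intro h
  have h1 : ‖(R : ℂ) ^ 2‖ = ‖x * conj y‖ := by rw [sub_eq_zero.1 h]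
  rw [norm_pow, Complex.norm_real, Real.norm_of_nonneg hR.le, norm_mul, Complex.norm_conj] at h1
  nlinarith [norm_nonneg x, norm_nonneg y]

lemma du_eq_of_lt_one (h : IsSol u f) {x : ℂ} {R : ℝ} (hR1 : R < 1) (hx : ‖x‖ < R) :
    IntegrableOn (fun y => (f y : ℂ) * (1 / (y - x) - conj y / (R ^ 2 - x * conj y))) (ball 0 R) ∧
    π * du u x = (∫ y in ball (0 : ℂ) R,
        (f y : ℂ) * (1 / (y - x) - conj y / (R ^ 2 - x * conj y))) / 4 +
      (∫ θ in (-π)..π, conj (circleMap 0 R θ) * ((u (circleMap 0 R θ) : ℂ) *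
        (R ^ 2 / (R ^ 2 - x * conj (circleMap 0 R θ)) ^ 2))) / 2 := by
  have hR : 0 < R := (norm_nonneg x).trans_lt hx
  have hs : closedBall (0:ℂ) R ⊆ ball 0 1 := closedBall_subset_ball hR1
  obtain ⟨i1, e1⟩ := integral_dzb_div_off isOpen_ball h.contDiffOn_du hs
    (x := x) (by simpa using hx)
  -- a neighbourhood of the closed disc on which the kernels are smooth
  set U : Set ℂ := ball 0 1 ∩ {y | (R : ℂ) ^ 2 - x * conj y ≠ 0} with hU
  have hUo : IsOpen U := isOpen_ball.inter (isOpen_ne_fun (by fun_prop) (by fun_prop))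
  have hsU : closedBall (0:ℂ) R ⊆ U := fun y hy =>
    ⟨hs hy, sq_sub_mul_conj_ne_zero hR hx (by simpa using hy)⟩
  have hconj : ContDiff ℝ 1 (fun y : ℂ => conj y) := Complex.conjCLE.contDiff
  have hden : ContDiffOn ℝ 1 (fun y => (R : ℂ) ^ 2 - x * conj y) U :=
    (contDiff_const.sub (contDiff_const.mul hconj)).contDiffOn
  set k : ℂ → ℂ := fun y => conj y / (R ^ 2 - x * conj y) with hk
  set k' : ℂ → ℂ := fun y => R ^ 2 / (R ^ 2 - x * conj y) ^ 2 with hk'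
  have sk : ContDiffOn ℝ 1 k U := by
    simp only [hk, div_eq_mul_inv]
    exact hconj.contDiffOn.mul (hden.inv fun y hy => hy.2)
  have sk' : ContDiffOn ℝ 1 k' U :=
by
    simp only [hk', div_eq_mul_inv]
    exact contDiffOn_const.mul ((hden.pow 2).inv fun y hy => pow_ne_zero 2 hy.2)
  have sdu : ContDiffOn ℝ 1 (du u) U := h.contDiffOn_du.mono inter_subset_left
  have su : ContDiffOn ℝ 1 (fun y => (u y : ℂ)) U :=
    (Complex.ofRealCLM.contDiff.comp_contDiffOn (h.smooth.of_le (by norm_num))).mono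
      inter_subset_left
  have dk : ∀ y ∈ U, dzb k y = k' y := by
    intro y hy
    have hne : (R : ℂ) ^ 2 - x * conj y ≠ 0 := hy.2
    have hder : HasDerivAt (fun w : ℂ => w / ((R:ℂ) ^ 2 - x * w))
        ((1 * ((R:ℂ) ^ 2 - x * conj y) - conj y * (-(x * 1))) / ((R:ℂ) ^ 2 - x * conj y) ^ 2)
        (conj y) := by
      refine (hasDerivAt_id _).div ?_ hne
      exact ((hasDerivAt_id _).const_mul x).const_sub _
    rw [hk, dzb_comp_conj (g := fun w : ℂ => w / ((R:ℂ) ^ 2 - x * w)) hder.differentiableAt,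
      hder.deriv]
    simp only [hk']; congr 1; ring
  have dk' : ∀ y ∈ U, dz k' y = 0 := by
    intro y hy
    have hne : (R : ℂ) ^ 2 - x * conj y ≠ 0 := hy.2
    refine dz_comp_conj (g := fun w : ℂ => (R:ℂ) ^ 2 / ((R:ℂ) ^ 2 - x * w) ^ 2) ?_
    refine DifferentiableAt.div (by fun_prop) (by fun_prop) (pow_ne_zero 2 hne)
  have diff : ∀ {g : ℂ → ℂ}, ContDiffOn ℝ 1 g U → ∀ y ∈ U, DifferentiableAt ℝ g y :=
    fun hg y hy => (hg.differentiableOn one_ne_zero).differentiableAt (hUo.mem_nhds hy)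
  have e2 := integral_dzb hR hUo (sk.mul sdu) hsU
  have e3 := integral_dz hR hUo (su.mul sk') hsU
  have fc : ContinuousOn (fun y => (f y : ℂ)) (closedBall 0 R) :=
    Complex.continuous_ofReal.comp_continuousOn (h.cont.mono hs)
  have i2 : IntegrableOn (fun y => (f y : ℂ) * k y) (ball 0 R) :=
    ((fc.mul (sk.continuousOn.mono hsU)).integrableOn_compact
      (isCompact_closedBall 0 R)).mono_set ball_subset_closedBall
  have i3 : IntegrableOn (fun y => k' y * du u y) (ball 0 R) :=
    (((sk'.continuousOn.mul sdu.continuousOn).mono hsU).integrableOn_compact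
      (isCompact_closedBall 0 R)).mono_set ball_subset_closedBall
  have e2' : ∫ y in ball (0:ℂ) R, dzb (fun y => k y * du u y) y =
      (∫ y in ball (0:ℂ) R, k' y * du u y) + (-1/4) * ∫ y in ball (0:ℂ) R, (f y : ℂ) * k y := by
    rw [← integral_const_mul, ← integral_add i3 (i2.const_mul _)]
    refine setIntegral_congr_fun measurableSet_ball fun y hy => ?_
    have hy' := hsU (ball_subset_closedBall hy)
    rw [dzb_mul (diff sk y hy') (diff sdu y hy'), dk y hy', h.dzb_du hy'.1]
    ring
  have e3' : ∫ y in ball (0:ℂ) R, dz (fun y => (u y : ℂ) * k' y) y =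
      ∫ y in ball (0:ℂ) R, k' y * du u y := by
    refine setIntegral_congr_fun measurableSet_ball fun y hy => ?_
    have hy' := hsU (ball_subset_closedBall hy)
    rw [dz_mul (diff su y hy') (diff sk' y hy'), dk' y hy', dz_ofReal (h.differentiableAt hy'.1)]
    ring
  have ebd : ∫ θ in (-π)..π, (circleMap 0 R θ - 0) * (k (circleMap 0 R θ) * du u (circleMap 0 R θ)) =
      ∫ θ in (-π)..π, (circleMap 0 R θ - 0) * (du u (circleMap 0 R θ) / (circleMap 0 R θ - x)) := by
    refine intervalIntegral.integral_congr fun θ _ => ?_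
    have hz : ‖circleMap 0 R θ‖ = R := by simpa using norm_circleMap_sub (c := 0) (θ := θ) hR.le
    simp only [hk]
    generalize circleMap 0 R θ = z at *
    have h1 : (R : ℂ) ^ 2 = z * conj z := by rw [Complex.mul_conj', hz]
    have h2 : conj z ≠ 0 := by
      rw [map_ne_zero, ← norm_pos_iff, hz]; exact hR
    have h3 : z - x ≠ 0 := by
      rw [sub_ne_zero]; rintro rfl; exact hx.ne hz
    have h4 : z * conj z - x * conj z ≠ 0 := by rw [← sub_mul]; exact mul_ne_zero h3 h2
    rw [h1]
    field_simp
  have i1' : IntegrableOn (fun y => (-4) * (dzb (du u) y / (y - x))) (ball 0 R) := i1.const_mul _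
  have pt : ∀ y ∈ ball (0:ℂ) R, (-4) * (dzb (du u) y / (y - x)) - (f y : ℂ) * k y =
      (f y : ℂ) * (1 / (y - x) - conj y / (R ^ 2 - x * conj y)) := by
    intro y hy
    rw [h.dzb_du (hs (ball_subset_closedBall hy))]
    simp only [hk]; ring
  refine ⟨(i1'.sub i2).congr_fun pt measurableSet_ball, ?_⟩
  rw [← setIntegral_congr_fun measurableSet_ball pt, integral_sub i1' i2, integral_const_mul]
  rw [e2', ebd] at e2
  rw [e3'] at e3
  simp only [sub_zero] at e1 e2 e3
  rw [e1]
  linear_combination (-1 : ℂ) * e2 + e3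

end IsSol

namespace IsSol

variable {u f : ℂ → ℝ}

/-- Representation of the complex gradient by the Green function of the disc. -/
lemma du_eq (h : IsSol u f) (huc : ContinuousOn u (closedBall 0 1))
    (hu0 : ∀ z ∈ sphere (0 : ℂ) 1, u z = 0) {B : ℝ} (hB : ∀ z ∈ ball (0 : ℂ) 1, |f z| ≤ B)
    {x : ℂ} (hx : ‖x‖ < 1) :
    4 * π * du u x =
      ∫ y in ball (0 : ℂ) 1, (f y : ℂ) * (1 / (y - x) - conj y / (1 - x * conj y)) := by
  have hne : (𝓝[Ioo ‖x‖ 1] (1:ℝ)).NeBot := by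
    rw [nhdsWithin_Ioo_eq_nhdsLT hx]; infer_instance
  have hcg : (𝓝[Ioo ‖x‖ 1] (1:ℝ)).IsCountablyGenerated := inferInstance
  set x1 := (‖x‖ + 1) / 2 with hx1
  have hxx1 : ‖x‖ < x1 := by linarith
  have hx11 : x1 < 1 := by linarith
  have hev : ∀ᶠ R in 𝓝[Ioo ‖x‖ 1] (1:ℝ), x1 < R ∧ R < 1 := by
    have : ∀ᶠ R in 𝓝[Ioo ‖x‖ 1] (1:ℝ), x1 < R :=
      nhdsWithin_le_nhds (lt_mem_nhds hx11)
    filter_upwards [this, self_mem_nhdsWithin] with R h1 h2 using ⟨h1, h2.2⟩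
  have hx10 : 0 < x1 := by have := norm_nonneg x; linarith
  have hlow : ∀ R, x1 < R → ∀ y : ℂ, ‖y‖ ≤ R → R * (x1 - ‖x‖) ≤ ‖(R:ℂ) ^ 2 - x * conj y‖ := by
    intro R hR y hy
    have h1 := norm_sub_norm_le ((R:ℂ) ^ 2) (x * conj y)
    rw [norm_pow, Complex.norm_real, Real.norm_of_nonneg (hx10.trans hR).le, norm_mul,
      Complex.norm_conj] at h1
    have h2 := mul_le_mul_of_nonneg_left hy (norm_nonneg x)
    nlinarith
  have hR2 : Tendsto (fun R : ℝ => (R : ℂ) ^ 2) (𝓝[Ioo ‖x‖ 1] (1:ℝ)) (𝓝 1) := by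
    have : Continuous fun R : ℝ => (R : ℂ) ^ 2 := by fun_prop
    simpa using (this.tendsto 1).mono_left nhdsWithin_le_nhds
  have hden0 : ∀ y : ℂ, ‖y‖ ≤ 1 → (1:ℂ) - x * conj y ≠ 0 := fun y hy => by
    simpa using sq_sub_mul_conj_ne_zero (R := 1) one_pos hx hy
  -- the interior term
  have hint : Tendsto (fun R : ℝ => ∫ y in ball (0 : ℂ) 1, (ball (0:ℂ) R).indicator (fun y =>
        (f y : ℂ) * (1 / (y - x) - conj y / (R ^ 2 - x * conj y))) y) (𝓝[Ioo ‖x‖ 1] (1:ℝ))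
      (𝓝 (∫ y in ball (0 : ℂ) 1, (f y : ℂ) * (1 / (y - x) - conj y / (1 - x * conj y)))) := by
    refine tendsto_integral_filter_of_dominated_convergence
      (fun y => B * (‖y - x‖⁻¹ + (x1 - ‖x‖)⁻¹)) ?_ ?_ ?_ ?_
    · filter_upwards [hev] with R hR
      have := (h.du_eq_of_lt_one hR.2 (hxx1.trans hR.1)).1
      exact ((integrable_indicator_iff measurableSet_ball).2 this).aestronglyMeasurable.restrict
    · filter_upwards [hev] with R hR
      filter_upwards [ae_restrict_mem measurableSet_ball] with y hy
      have hB0 : 0 ≤ B := (abs_nonneg _).trans (hB y hy)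
      have hpos : 0 < x1 - ‖x‖ := by linarith
      by_cases hyR : y ∈ ball (0:ℂ) R
      · rw [indicator_of_mem hyR, norm_mul, Complex.norm_real, Real.norm_eq_abs]
        refine mul_le_mul (hB y hy) ?_ (norm_nonneg _) hB0
        refine (norm_sub_le _ _).trans (add_le_add (by simp) ?_)
        have hyR' : ‖y‖ ≤ R := by simpa using (mem_ball_zero_iff.1 hyR).le
        rw [norm_div, Complex.norm_conj]
        have h1 := hlow R hR.1 y hyR'
        have hR0 : 0 < R := hx10.trans hR.1
        rw [div_le_iff₀ (lt_of_lt_of_le (by positivity) h1)]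
        calc ‖y‖ ≤ R := hyR'
          _ = (x1 - ‖x‖)⁻¹ * (R * (x1 - ‖x‖)) := by field_simp
          _ ≤ _ := by gcongr
      · rw [indicator_of_notMem hyR, norm_zero]; positivity
    · exact ((integrableOn_inv_norm_sub x 0 1).add
        (integrableOn_const measure_ball_lt_top.ne)).const_mul B
    · filter_upwards [ae_restrict_mem measurableSet_ball] with y hy
      have hy1 : ‖y‖ < 1 := by simpa using hy
      have : ∀ᶠ R in 𝓝[Ioo ‖x‖ 1] (1:ℝ), (ball (0:ℂ) R).indicator (fun y =>
        (f y : ℂ) * (1 / (y - x) - conj y / (R ^ 2 - x * conj y))) y =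
        (f y : ℂ) * (1 / (y - x) - conj y / (R ^ 2 - x * conj y)) := by
        have : ∀ᶠ R in 𝓝[Ioo ‖x‖ 1] (1:ℝ), ‖y‖ < R := nhdsWithin_le_nhds (lt_mem_nhds hy1)
        filter_upwards [this] with R hR
        rw [indicator_of_mem (by simpa using hR)]
      refine Tendsto.congr' (this.mono fun _ h => h.symm) ?_
      refine tendsto_const_nhds.mul (tendsto_const_nhds.sub (tendsto_const_nhds.div ?_
        (hden0 y hy1.le)))
      exact hR2.sub_const _
  -- the boundary term
  have hbdy : Tendsto (fun R : ℝ => ∫ θ in (-π)..π, conj (circleMap 0 R θ) *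
      ((u (circleMap 0 R θ) : ℂ) * (R ^ 2 / (R ^ 2 - x * conj (circleMap 0 R θ)) ^ 2)))
      (𝓝[Ioo ‖x‖ 1] (1:ℝ)) (𝓝 (∫ θ in (-π)..π, (0:ℂ))) := by
    obtain ⟨C, hC⟩ := (isCompact_closedBall (0:ℂ) 1).exists_bound_of_continuousOn huc
    have hnorm : ∀ R, x1 < R → ∀ θ, ‖circleMap 0 R θ‖ = R := fun R hR θ => by
      simpa using norm_circleMap_sub (c := 0) (θ := θ) (hx10.trans hR).le
    refine intervalIntegral.tendsto_integral_filter_of_dominated_convergence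
      (fun _ => 1 * (C * ((x1 - ‖x‖)⁻¹ ^ 2))) ?_ ?_ (by simp) ?_
    · filter_upwards [hev] with R hR
      have hc : ContinuousOn (fun z : ℂ => conj z * ((u z : ℂ) * (R ^ 2 /
          (R ^ 2 - x * conj z) ^ 2))) (sphere 0 R) := by
        have hu' : ContinuousOn (fun z => (u z : ℂ)) (sphere 0 R) :=
          Complex.continuous_ofReal.comp_continuousOn (huc.mono (sphere_subset_closedBall.trans
            (closedBall_subset_closedBall hR.2.le)))
        have hcj : Continuous fun z : ℂ => conj z := Complex.continuous_conj
        refine hcj.continuousOn.mul (hu'.mul (continuousOn_const.div ?_ fun z hz => ?_))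
        · exact ((continuous_const.sub (continuous_const.mul hcj)).pow 2).continuousOn
        · exact pow_ne_zero 2 (sq_sub_mul_conj_ne_zero (hx10.trans hR.1) (hxx1.trans hR.1)
            (by simpa using (mem_sphere_zero_iff_norm.1 hz).le))
      exact (continuous_comp_circleMap (hx10.trans hR.1).le hc).aestronglyMeasurable
    · filter_upwards [hev] with R hR
      refine Eventually.of_forall fun θ _ => ?_
      have hz := hnorm R hR.1 θ
      have hR0 : 0 < R := hx10.trans hR.1
      have hpos : 0 < x1 - ‖x‖ := by linarith
      generalize circleMap 0 R θ = z at *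
      have h1 := hlow R hR.1 z hz.le
      have h2 := hC z (by simpa [hz] using hR.2.le)
      rw [norm_mul, norm_mul, Complex.norm_conj, Complex.norm_real, hz]
      refine mul_le_mul hR.2.le ?_ (by positivity) zero_le_one
      refine mul_le_mul h2 ?_ (by positivity) ((norm_nonneg _).trans h2)
      rw [norm_div, norm_pow, norm_pow, Complex.norm_real, Real.norm_of_nonneg hR0.le, ← div_pow]
      gcongr
      rw [div_le_iff₀ (lt_of_lt_of_le (by positivity) h1)]
      calc R = (x1 - ‖x‖)⁻¹ * (R * (x1 - ‖x‖)) := by field_simp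
        _ ≤ _ := by gcongr
    · refine Eventually.of_forall fun θ _ => ?_
      have hcm : Continuous fun t : ℝ => circleMap (0:ℂ) t θ := by unfold circleMap; fun_prop
      have hcl := (hcm.tendsto 1).mono_left (nhdsWithin_le_nhds (s := Ioo ‖x‖ 1))
      have hmem : circleMap (0:ℂ) 1 θ ∈ sphere (0:ℂ) 1 := circleMap_mem_sphere 0 zero_le_one θ
      have hut : Tendsto (fun R => u (circleMap 0 R θ)) (𝓝[Ioo ‖x‖ 1] (1:ℝ)) (𝓝 0) := by
        rw [← hu0 _ hmem]
        refine (huc _ (sphere_subset_closedBall hmem)).tendsto.comp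
          (tendsto_nhdsWithin_iff.2 ⟨hcl, ?_⟩)
        filter_upwards [hev] with R hR
        simpa using (hnorm R hR.1 θ).trans_le hR.2.le
      have hcj := (Complex.continuous_conj.tendsto _).comp hcl
      have hd := hden0 (circleMap (0:ℂ) 1 θ) (by simp)
      have := hcj.mul (((Complex.continuous_ofReal.tendsto _).comp hut).mul (hR2.div
        ((hR2.sub (hcj.const_mul x)).pow 2) (pow_ne_zero 2 hd)))
      simpa using this
  have hconst : ∀ᶠ R in 𝓝[Ioo ‖x‖ 1] (1:ℝ), (∫ y in ball (0 : ℂ) 1, (ball (0:ℂ) R).indicator (fun y =>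
        (f y : ℂ) * (1 / (y - x) - conj y / (R ^ 2 - x * conj y))) y) / 4 +
      (∫ θ in (-π)..π, conj (circleMap 0 R θ) *
      ((u (circleMap 0 R θ) : ℂ) * (R ^ 2 / (R ^ 2 - x * conj (circleMap 0 R θ)) ^ 2))) / 2
      = π * du u x := by
    filter_upwards [hev] with R hR
    rw [(h.du_eq_of_lt_one hR.2 (hxx1.trans hR.1)).2, setIntegral_indicator measurableSet_ball,
      inter_eq_self_of_subset_right (ball_subset_ball hR.2.le)]
  have hlim := (hint.div_const 4).add (hbdy.div_const 2)
  have := tendsto_nhds_unique (hlim.congr' hconst) tendsto_const_nhds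
  simp only [intervalIntegral.integral_zero, zero_div, add_zero] at this
  linear_combination (-4 : ℂ) * this

end IsSol

namespace IsSol

variable {u f : ℂ → ℝ}

lemma integrableOn_of_bdd (h : IsSol u f) {B : ℝ} (hB : ∀ z ∈ ball (0 : ℂ) 1, |f z| ≤ B) :
    IntegrableOn f (ball 0 1) :=
  Integrable.mono' (integrableOn_const (C := B) measure_ball_lt_top.ne)
    (h.cont.aestronglyMeasurable measurableSet_ball)
    ((ae_restrict_mem measurableSet_ball).mono fun z hz => hB z hz)

lemma half_le_norm_one_sub {x y : ℂ} (hx : ‖x‖ ≤ 1 / 2) (hy : ‖y‖ ≤ 1) :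
    1 / 2 ≤ ‖1 - x * conj y‖ := by
  have h1 := norm_sub_norm_le (1:ℂ) (x * conj y)
  rw [norm_one, norm_mul, Complex.norm_conj] at h1
  nlinarith [norm_nonneg x, norm_nonneg y]

lemma norm_conj_div_le {x y : ℂ} (hx : ‖x‖ ≤ 1 / 2) (hy : ‖y‖ ≤ 1) :
    ‖conj y / (1 - x * conj y)‖ ≤ 2 * ‖y‖ := by
  have h1 := half_le_norm_one_sub hx hy
  rw [norm_div, Complex.norm_conj, div_le_iff₀ (by linarith)]
  nlinarith [norm_nonneg y]

lemma integral_inv_norm_sub_ball_le {x : ℂ} {σ : ℝ} (hσ : 0 < σ) (hx : ‖x‖ ≤ σ / 2) :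
    ∫ y in ball (0:ℂ) σ, ‖y - x‖⁻¹ ≤ 3 * π * σ := by
  have h1 : ∫ y in ball (0:ℂ) σ, ‖y - x‖⁻¹ ≤ ∫ y in ball x (3 / 2 * σ), ‖y - x‖⁻¹ := by
    refine setIntegral_mono_set (integrableOn_inv_norm_sub x x _)
      (Eventually.of_forall fun y => inv_nonneg.2 (norm_nonneg _))
      (ball_subset_ball' ?_).eventuallyLE
    rw [dist_comm, dist_zero_right]; linarith
  rw [integral_inv_norm_sub x (by positivity)] at h1
  linarith

lemma norm_du_add_le (h : IsSol u f) (huc : ContinuousOn u (closedBall 0 1))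
    (hu0 : ∀ z ∈ sphere (0 : ℂ) 1, u z = 0) (hf : ∀ z ∈ ball (0 : ℂ) 1, 0 ≤ f z)
    {B : ℝ} (hB : ∀ z ∈ ball (0 : ℂ) 1, |f z| ≤ B)
    {x : ℂ} {ρ σ η : ℝ} (hx : x ≠ 0) (hx2 : ‖x‖ ≤ 1 / 2) (hρ : 0 < ρ) (hρx : ρ ≤ ‖x‖ / 2)
    (hσ : 2 * ‖x‖ ≤ σ) (hσ1 : σ ≤ 1) (hη : ∀ y : ℂ, ρ ≤ ‖y‖ → ‖y‖ < σ → f y ≤ η) (hη0 : 0 ≤ η) :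
    ‖4 * π * (x * du u x) + ((∫ y in ball (0:ℂ) ρ, f y : ℝ) : ℂ)‖ ≤
      4 * (ρ / ‖x‖) * (∫ y in ball (0:ℂ) ρ, f y) + 5 * π * η * σ * ‖x‖ +
      4 * (‖x‖ / σ) * ∫ y in ball (0:ℂ) 1 \ ball 0 σ, f y := by
  set R := ‖x‖ with hR
  have hR0 : 0 < R := norm_pos_iff.2 hx
  have hσ0 : 0 < σ := by linarith
  have hfi := h.integrableOn_of_bdd hB
  have hρ1 : ρ ≤ 1 := by linarith
  have m1 : MeasurableSet (ball (0:ℂ) 1) := measurableSet_ball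
  have hfC : IntegrableOn (fun y => (f y : ℂ)) (ball 0 1) := hfi.ofReal
  have hg : AEStronglyMeasurable (fun y : ℂ => (f y : ℂ) * (1 / (y - x) - conj y / (1 - x * conj y)))
      (volume.restrict (ball 0 1)) := by
    have : Measurable fun y : ℂ => 1 / (y - x) - conj y / (1 - x * conj y) := by
      have : Measurable fun y : ℂ => conj y := Complex.continuous_conj.measurable
      fun_prop
    exact hfC.aestronglyMeasurable.mul this.aestronglyMeasurable
  have hB0 : 0 ≤ B := (abs_nonneg _).trans (hB 0 (by simp))
  have hK : ∀ y : ℂ, ‖y‖ ≤ 1 → ‖1 / (y - x) - conj y / (1 - x * conj y)‖ ≤ ‖y - x‖⁻¹ + 2 := by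
    intro y hy
    refine (norm_sub_le _ _).trans (add_le_add (by simp) ?_)
    exact (norm_conj_div_le hx2 hy).trans (by linarith)
  have hgi : IntegrableOn (fun y : ℂ => (f y : ℂ) * (1 / (y - x) - conj y / (1 - x * conj y)))
      (ball 0 1) := by
    refine Integrable.mono' (((integrableOn_inv_norm_sub x 0 1).add
      (integrableOn_const (C := (2:ℝ)) measure_ball_lt_top.ne)).const_mul B) hg ?_
    filter_upwards [ae_restrict_mem m1] with y hy
    rw [norm_mul, Complex.norm_real]
    exact mul_le_mul (hB y hy) (hK y (by simpa using (mem_ball_zero_iff.1 hy).le)) (norm_nonneg _) hB0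
  have hi1 : IntegrableOn ((ball (0:ℂ) ρ).indicator f) (ball 0 1) := hfi.indicator measurableSet_ball
  have hi1C : IntegrableOn (fun y => (((ball (0:ℂ) ρ).indicator f y : ℝ) : ℂ) / x) (ball 0 1) :=
    hi1.ofReal.div_const x
  have hb : ((∫ y in ball (0:ℂ) ρ, f y : ℝ) : ℂ) / x =
      ∫ y in ball (0:ℂ) 1, (((ball (0:ℂ) ρ).indicator f y : ℝ) : ℂ) / x := by
    rw [integral_div, integral_complex_ofReal, setIntegral_indicator measurableSet_ball,
      inter_eq_self_of_subset_right (ball_subset_ball hρ1)]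
  have hi2 : IntegrableOn ((ball (0:ℂ) σ).indicator fun y => η * (‖y - x‖⁻¹ + 2)) (ball 0 1) :=
    IntegrableOn.indicator (((integrableOn_inv_norm_sub x 0 1).add
      (integrableOn_const (C := (2:ℝ)) measure_ball_lt_top.ne)).const_mul η) measurableSet_ball
  have hi3 : IntegrableOn ((ball (0:ℂ) σ)ᶜ.indicator f) (ball 0 1) :=
    hfi.indicator measurableSet_ball.compl
  have hmain : ‖4 * π * du u x + ((∫ y in ball (0:ℂ) ρ, f y : ℝ) : ℂ) / x‖ ≤
      ∫ y in ball (0:ℂ) 1, (4 * ρ / R ^ 2 * (ball (0:ℂ) ρ).indicator f y +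
        (ball (0:ℂ) σ).indicator (fun y => η * (‖y - x‖⁻¹ + 2)) y +
        4 / σ * (ball (0:ℂ) σ)ᶜ.indicator f y) := by
    rw [h.du_eq huc hu0 hB (by linarith), hb, ← integral_add hgi hi1C]
    refine norm_integral_le_of_norm_le (((hi1.const_mul _).add hi2).add (hi3.const_mul _)) ?_
    filter_upwards [ae_restrict_mem m1, ae_ne_center x (ball 0 1)] with y hy hyx
    have hy1 : ‖y‖ < 1 := by simpa using hy
    have hf0 := hf y hy
    have hyx0 : y - x ≠ 0 := sub_ne_zero.2 hyx
    rcases lt_or_ge ‖y‖ ρ with hyρ | hyρ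
    · have hyσ : y ∈ ball (0:ℂ) σ := by rw [mem_ball_zero_iff]; linarith
      have hyρ' : y ∈ ball (0:ℂ) ρ := by simpa using hyρ
      rw [indicator_of_mem hyρ', indicator_of_mem hyσ, indicator_of_notMem (by simpa using hyσ)]
      have e : (f y : ℂ) * (1 / (y - x) - conj y / (1 - x * conj y)) + (f y : ℂ) / x =
          (f y : ℂ) * (y / (x * (y - x)) - conj y / (1 - x * conj y)) := by
        generalize conj y / (1 - x * conj y) = w
        field_simp; ring
      rw [e, norm_mul, Complex.norm_real, Real.norm_of_nonneg hf0]
      have hd : R / 2 ≤ ‖y - x‖ := by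
        have := norm_sub_norm_le x y
        rw [norm_sub_rev] at this; linarith
      have k1 : ‖y / (x * (y - x))‖ ≤ 2 * ρ / R ^ 2 := by
        rw [norm_div, norm_mul, ← hR, div_le_div_iff₀ (by positivity) (by positivity)]
        calc ‖y‖ * R ^ 2 ≤ ρ * R ^ 2 := by gcongr
          _ = 2 * ρ * (R * (R / 2)) := by ring
          _ ≤ _ := by gcongr
      have k2 : ‖conj y / (1 - x * conj y)‖ ≤ 2 * ρ / R ^ 2 := by
        refine (norm_conj_div_le hx2 hy1.le).trans ?_
        rw [le_div_iff₀ (by positivity)]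
        have : R ^ 2 ≤ 1 := by nlinarith
        calc 2 * ‖y‖ * R ^ 2 ≤ 2 * ρ * 1 := by gcongr
          _ = 2 * ρ := by ring
      have k3 := (norm_sub_le (y / (x * (y - x))) (conj y / (1 - x * conj y))).trans
        (add_le_add k1 k2)
      have : 0 ≤ η * (‖y - x‖⁻¹ + 2) := by positivity
      have k4 := mul_le_mul_of_nonneg_left k3 hf0
      have e4 : f y * (2 * ρ / R ^ 2 + 2 * ρ / R ^ 2) = 4 * ρ / R ^ 2 * f y := by ring
      linarith
    · have hyρ' : y ∉ ball (0:ℂ) ρ := by simpa using hyρ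
      rw [indicator_of_notMem hyρ']
      simp only [Complex.ofReal_zero, zero_div, add_zero, mul_zero, zero_add]
      rw [norm_mul, Complex.norm_real, Real.norm_of_nonneg hf0]
      rcases lt_or_ge ‖y‖ σ with hyσ | hyσ
      · have hyσ' : y ∈ ball (0:ℂ) σ := by simpa using hyσ
        rw [indicator_of_mem hyσ', indicator_of_notMem (by simpa using hyσ), mul_zero, add_zero]
        exact mul_le_mul (hη y hyρ hyσ) (hK y hy1.le) (norm_nonneg _) hη0
      · have hyσ' : y ∉ ball (0:ℂ) σ := by simpa using hyσ
        rw [indicator_of_notMem hyσ', indicator_of_mem (by simpa using hyσ), zero_add, mul_comm]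
        refine mul_le_mul_of_nonneg_right ?_ hf0
        have hd : σ / 2 ≤ ‖y - x‖ := by
          have := norm_sub_norm_le y x
          linarith
        have k1 : ‖1 / (y - x)‖ ≤ 2 / σ := by
          rw [norm_div, norm_one, div_le_div_iff₀ (by positivity) (by positivity)]; linarith
        have k2 : ‖conj y / (1 - x * conj y)‖ ≤ 2 / σ := by
          refine (norm_conj_div_le hx2 hy1.le).trans ?_
          rw [le_div_iff₀ hσ0]
          nlinarith [norm_nonneg y]
        calc _ ≤ 2 / σ + 2 / σ := (norm_sub_le _ _).trans (add_le_add k1 k2)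
          _ = 4 / σ := by ring
  have hi12 : IntegrableOn (fun y => 4 * ρ / R ^ 2 * (ball (0:ℂ) ρ).indicator f y +
      (ball (0:ℂ) σ).indicator (fun y => η * (‖y - x‖⁻¹ + 2)) y) (ball 0 1) :=
    (hi1.const_mul _).add hi2
  rw [integral_add hi12 (hi3.const_mul _), integral_add (hi1.const_mul _) hi2, integral_const_mul, integral_const_mul,
    setIntegral_indicator measurableSet_ball, setIntegral_indicator measurableSet_ball,
    setIntegral_indicator measurableSet_ball.compl,
    inter_eq_self_of_subset_right (ball_subset_ball hρ1),
    inter_eq_self_of_subset_right (ball_subset_ball hσ1), ← sdiff_eq, integral_const_mul,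
    integral_add (integrableOn_inv_norm_sub x 0 σ) (integrableOn_const measure_ball_lt_top.ne)]
    at hmain
  have hI := integral_inv_norm_sub_ball_le hσ0 (x := x) (by linarith)
  have hc : ∫ y in ball (0:ℂ) σ, (2:ℝ) = 2 * π * σ ^ 2 := by
    simp [Measure.real, hσ0.le]; ring
  rw [hc] at hmain
  have hmid : η * ((∫ y in ball (0:ℂ) σ, ‖y - x‖⁻¹) + 2 * π * σ ^ 2) ≤ 5 * π * η * σ := by
    have : (∫ y in ball (0:ℂ) σ, ‖y - x‖⁻¹) + 2 * π * σ ^ 2 ≤ 5 * π * σ := by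
      nlinarith [Real.pi_pos, mul_pos Real.pi_pos hσ0]
    nlinarith
  have e : 4 * π * (x * du u x) + ((∫ y in ball (0:ℂ) ρ, f y : ℝ) : ℂ) =
      x * (4 * π * du u x + ((∫ y in ball (0:ℂ) ρ, f y : ℝ) : ℂ) / x) := by
    field_simp
  rw [e, norm_mul, ← hR]
  calc _ ≤ R * (4 * ρ / R ^ 2 * (∫ y in ball (0:ℂ) ρ, f y) + 5 * π * η * σ +
      4 / σ * ∫ y in ball (0:ℂ) 1 \ ball 0 σ, f y) := by
        refine mul_le_mul_of_nonneg_left ?_ hR0.le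
        linarith
    _ = _ := by field_simp

end IsSol

/-- Solutions of the Dirichlet problem `-Δu = lam |z|² V eᵘ` in the unit disc. -/
structure IsLiouvilleSol (lam : ℝ) (V u : ℂ → ℝ) : Prop where
  lam_pos : 0 < lam
  continuousOn : ContinuousOn u (closedBall 0 1)
  smooth : ContDiffOn ℝ 2 u (ball 0 1)
  pde : ∀ z ∈ ball (0 : ℂ) 1, -lap u z = lam * ‖z‖ ^ 2 * V z * Real.exp (u z)
  zero : ∀ z ∈ sphere (0 : ℂ) 1, u z = 0
  smooth_weight : ContDiffOn ℝ 1 V (closedBall 0 1)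
  weight_pos : ∀ z ∈ closedBall (0 : ℂ) 1, 0 < V z

/-- The right-hand side `lam |z|² V eᵘ` of the weighted Liouville equation. -/
def dens (lam : ℝ) (V u : ℂ → ℝ) (z : ℂ) : ℝ := lam * ‖z‖ ^ 2 * V z * Real.exp (u z)

namespace IsLiouvilleSol

variable {lam : ℝ} {V u : ℂ → ℝ}

lemma continuousOn_dens (h : IsLiouvilleSol lam V u) : ContinuousOn (dens lam V u) (closedBall 0 1) := by
  have h1 := h.continuousOn
  have h2 := h.smooth_weight.continuousOn
  unfold dens
  fun_prop

lemma isSol (h : IsLiouvilleSol lam V u) : IsSol u (dens lam V u) where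
  smooth := h.smooth
  cont := h.continuousOn_dens.mono ball_subset_closedBall
  eq z hz := by rw [dens, ← h.pde z hz, neg_neg]

lemma dens_nonneg (h : IsLiouvilleSol lam V u) {z : ℂ} (hz : z ∈ closedBall (0 : ℂ) 1) :
    0 ≤ dens lam V u z := by
  have h1 := h.lam_pos
  have h2 := h.weight_pos z hz
  unfold dens
  positivity

lemma dens_nonneg' (h : IsLiouvilleSol lam V u) : ∀ z ∈ ball (0 : ℂ) 1, 0 ≤ dens lam V u z :=
  fun _ hz => h.dens_nonneg (ball_subset_closedBall hz)

lemma exists_dens_le (h : IsLiouvilleSol lam V u) :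
    ∃ B, ∀ z ∈ ball (0 : ℂ) 1, |dens lam V u z| ≤ B := by
  obtain ⟨B, hB⟩ := (isCompact_closedBall (0 : ℂ) 1).exists_bound_of_continuousOn h.continuousOn_dens
  exact ⟨B, fun z hz => hB z (ball_subset_closedBall hz)⟩

lemma integrableOn_dens (h : IsLiouvilleSol lam V u) : IntegrableOn (dens lam V u) (ball 0 1) :=
  h.isSol.integrableOn_of_bdd h.exists_dens_le.choose_spec

lemma contDiffOn_weight (h : IsLiouvilleSol lam V u) : ContDiffOn ℝ 1 V (ball 0 1) :=
  h.smooth_weight.mono ball_subset_closedBall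

lemma differentiableAt_weight (h : IsLiouvilleSol lam V u) {z : ℂ} (hz : z ∈ ball (0 : ℂ) 1) :
    DifferentiableAt ℝ V z :=
  (h.contDiffOn_weight.differentiableOn one_ne_zero).differentiableAt (isOpen_ball.mem_nhds hz)

lemma contDiffOn_smul_exp (h : IsLiouvilleSol lam V u) :
    ContDiffOn ℝ 1 (fun z => lam * V z * Real.exp (u z)) (ball 0 1) :=
  (contDiffOn_const.mul h.contDiffOn_weight).mul (h.smooth.of_le one_le_two).exp

lemma du_smul_exp (h : IsLiouvilleSol lam V u) {z : ℂ} (hz : z ∈ ball (0 : ℂ) 1) :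
    du (fun z => lam * V z * Real.exp (u z)) z =
      lam * Real.exp (u z) * du V z + (lam * V z * Real.exp (u z)) * du u z := by
  have hV := (h.differentiableAt_weight hz).hasFDerivAt
  have hu := (h.isSol.differentiableAt hz).hasFDerivAt
  have hd : fderiv ℝ (fun z => lam * V z * Real.exp (u z)) z = _ :=
    ((hV.const_mul lam).mul hu.exp).fderiv
  simp only [du, hd]
  simp
  ring

lemma continuousOn_du_weight (h : IsLiouvilleSol lam V u) : ContinuousOn (du V) (ball 0 1) := by
  have h1 : ContinuousOn (fderiv ℝ V) (ball 0 1) :=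
    h.contDiffOn_weight.continuousOn_fderiv_of_isOpen isOpen_ball le_rfl
  unfold du
  have h2 : ∀ w : ℂ, ContinuousOn (fun z => fderiv ℝ V z w) (ball 0 1) := fun w =>
    h1.clm_apply continuousOn_const
  have h3 := h2 1
  have h4 := h2 Complex.I
  fun_prop

/-- A Pohozaev-type identity for the holomorphic quadratic differential `g (∂u)²`. -/
lemma pohozaev (h : IsLiouvilleSol lam V u) {g : ℂ → ℂ} (hg : Differentiable ℂ g) {R : ℝ} (hR : 0 < R)
    (hR1 : R < 1) :
    (∫ θ in (-π)..π, g (circleMap 0 R θ) * du u (circleMap 0 R θ) ^ 2) / 2 - π * (g 0 * du u 0 ^ 2) =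
      -(∫ θ in (-π)..π, conj (circleMap 0 R θ) * (g (circleMap 0 R θ) * conj (circleMap 0 R θ) *
        (lam * V (circleMap 0 R θ) * Real.exp (u (circleMap 0 R θ))))) / 4 +
      (∫ z in ball (0 : ℂ) R, (deriv g z * conj z * (lam * V z * Real.exp (u z)) +
        g z * conj z * (lam * Real.exp (u z) * du V z))) / 2 := by
  have hsub : closedBall (0 : ℂ) R ⊆ ball 0 1 := closedBall_subset_ball hR1
  have hgR : ContDiff ℝ 1 g := hg.contDiff.restrict_scalars ℝ
  have hQ := h.contDiffOn_smul_exp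
  have hcj : ContDiff ℝ 1 (fun z : ℂ => conj z) := Complex.conjCLE.contDiff
  have hG : ContDiffOn ℝ 1 (fun z => g z * conj z * ((lam * V z * Real.exp (u z) : ℝ) : ℂ)) (ball 0 1) :=
    (hgR.contDiffOn.mul hcj.contDiffOn).mul (Complex.ofRealCLM.contDiff.comp_contDiffOn hQ)
  have e1 := (integral_dzb_div hR isOpen_ball (hgR.contDiffOn.mul (h.isSol.contDiffOn_du.pow 2)) hsub).2
  have e2 := integral_dz hR isOpen_ball hG hsub
  have hdu := h.isSol.contDiffOn_du.continuousOn
  have hdg : Continuous (deriv g) := hg.contDiff.continuous_deriv le_rfl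
  have hVc := h.contDiffOn_weight.continuousOn
  have huc := h.smooth.continuousOn
  have hdV := h.continuousOn_du_weight
  have hgc := hg.continuous
  have i2 : IntegrableOn (fun z => deriv g z * conj z * (lam * V z * Real.exp (u z)) +
        g z * conj z * (lam * Real.exp (u z) * du V z)) (ball (0:ℂ) R) := by
    refine (ContinuousOn.integrableOn_compact (isCompact_closedBall (0:ℂ) R) ?_).mono_set
      ball_subset_closedBall
    refine ContinuousOn.mono ?_ hsub
    fun_prop
  have i1 : IntegrableOn (fun z => g z * conj z * ((lam * V z * Real.exp (u z)) * du u z))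
      (ball (0:ℂ) R) := by
    refine (ContinuousOn.integrableOn_compact (isCompact_closedBall (0:ℂ) R) ?_).mono_set
      ball_subset_closedBall
    refine ContinuousOn.mono ?_ hsub
    fun_prop
  have e3 : ∫ z in ball (0:ℂ) R, dzb (fun z => g z * du u z ^ 2) z / (z - 0) =
      ∫ z in ball (0:ℂ) R, -(1 / 2) * (g z * conj z * ((lam * V z * Real.exp (u z)) * du u z)) := by
    refine integral_congr_ae ?_
    filter_upwards [ae_restrict_mem measurableSet_ball, ae_ne_center 0 (ball 0 R)] with z hz hz0
    have hz1 := hsub (ball_subset_closedBall hz)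
    have hd := h.isSol.differentiableAt_du hz1
    have hgd : DifferentiableAt ℝ g z := hgR.differentiable one_ne_zero z
    have : (fun z => g z * du u z ^ 2) = fun z => g z * (du u z * du u z) := by ext; ring
    rw [this, dzb_mul hgd (hd.fun_mul hd), dzb_mul hd hd, dzb_of_holomorphic (hg z), h.isSol.dzb_du hz1,
      sub_zero, div_eq_iff hz0, dens]
    push_cast
    rw [← Complex.mul_conj']
    ring
  have e4 : ∫ z in ball (0:ℂ) R, dz (fun z => g z * conj z * ((lam * V z * Real.exp (u z) : ℝ) : ℂ)) z =
      ∫ z in ball (0:ℂ) R, ((deriv g z * conj z * (lam * V z * Real.exp (u z)) +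
        g z * conj z * (lam * Real.exp (u z) * du V z)) +
        g z * conj z * ((lam * V z * Real.exp (u z)) * du u z)) := by
    refine setIntegral_congr_fun measurableSet_ball fun z hz => ?_
    have hz1 := hsub (ball_subset_closedBall hz)
    have hgd : DifferentiableAt ℝ g z := hgR.differentiable one_ne_zero z
    have hqd : DifferentiableAt ℝ (fun z => lam * V z * Real.exp (u z)) z :=
      (hQ.differentiableOn one_ne_zero).differentiableAt (isOpen_ball.mem_nhds hz1)
    have hqd' : DifferentiableAt ℝ (fun z => ((lam * V z * Real.exp (u z) : ℝ) : ℂ)) z :=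
      Complex.ofRealCLM.differentiableAt.comp z hqd
    rw [dz_mul (hgd.fun_mul (differentiableAt_conj z)) hqd', dz_mul hgd (differentiableAt_conj z),
      dz_ofReal hqd, dz_conj, dz_of_holomorphic (hg z), h.du_smul_exp hz1]
    push_cast
    ring
  rw [e4, integral_add i2 i1] at e2
  rw [e3, integral_const_mul] at e1
  simp only [sub_zero] at e2
  simp only [Complex.ofReal_mul] at e2
  linear_combination -e1 - e2 / 2

end IsLiouvilleSol

lemma circle_integral_norm_sq (x : ℂ) (t : ℝ) :
    ∫ θ in (-π)..π, ‖circleMap x t θ‖ ^ 2 = 2 * π * (‖x‖ ^ 2 + t ^ 2) := by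
  have e : ∀ θ : ℝ, ‖circleMap x t θ‖ ^ 2 =
      ‖x‖ ^ 2 + t ^ 2 + (2 * t * x.re * Real.cos θ + 2 * t * x.im * Real.sin θ) := by
    intro θ
    rw [← Complex.normSq_eq_norm_sq, ← Complex.normSq_eq_norm_sq, Complex.normSq_apply,
      Complex.normSq_apply]
    simp only [circleMap, Complex.exp_mul_I, Complex.add_re, Complex.add_im, ← Complex.ofReal_cos, ← Complex.ofReal_sin, Complex.ofReal_re,
      Complex.ofReal_im, Complex.mul_re, Complex.mul_im, Complex.I_re, Complex.I_im]
    linear_combination t ^ 2 * Real.sin_sq_add_cos_sq θ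
  simp_rw [e]
  rw [intervalIntegral.integral_add (by simp) (Continuous.intervalIntegrable (by fun_prop) _ _),
    intervalIntegral.integral_add (Continuous.intervalIntegrable (by fun_prop) _ _)
      (Continuous.intervalIntegrable (by fun_prop) _ _)]
  simp
  ring

/-- Uniform bounds for the weight `V` on the unit disc. -/
structure WeightBounds (V : ℂ → ℝ) (Vm VM CV : ℝ) : Prop where
  pos : 0 < Vm
  lower : ∀ z ∈ closedBall (0 : ℂ) 1, Vm ≤ V z
  upper : ∀ z ∈ closedBall (0 : ℂ) 1, V z ≤ VM
  deriv : ∀ z ∈ ball (0 : ℂ) 1, ‖du V z‖ ≤ CV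

namespace WeightBounds

variable {V : ℂ → ℝ} {Vm VM CV : ℝ}

lemma upper_pos (hV : WeightBounds V Vm VM CV) : 0 < VM :=
  hV.pos.trans_le ((hV.lower 0 (by simp)).trans (hV.upper 0 (by simp)))

lemma deriv_nonneg (hV : WeightBounds V Vm VM CV) : 0 ≤ CV :=
  (norm_nonneg _).trans (hV.deriv 0 (by simp))

end WeightBounds

namespace IsLiouvilleSol

variable {lam Vm VM CV : ℝ} {V u : ℂ → ℝ}

lemma continuousOn_sq_exp (h : IsLiouvilleSol lam V u) :
    ContinuousOn (fun z => ‖z‖ ^ 2 * Real.exp (u z)) (closedBall 0 1) := by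
  have := h.continuousOn
  fun_prop

lemma integrableOn_sq_exp (h : IsLiouvilleSol lam V u) :
    IntegrableOn (fun z => ‖z‖ ^ 2 * Real.exp (u z)) (ball 0 1) :=
  (h.continuousOn_sq_exp.integrableOn_compact (isCompact_closedBall (0:ℂ) 1)).mono_set
    ball_subset_closedBall

lemma le_dens (h : IsLiouvilleSol lam V u) (hV : WeightBounds V Vm VM CV) {z : ℂ}
    (hz : z ∈ closedBall (0 : ℂ) 1) : lam * Vm * (‖z‖ ^ 2 * Real.exp (u z)) ≤ dens lam V u z := by
  have h1 := hV.lower z hz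
  have h2 := h.lam_pos
  calc _ = lam * ‖z‖ ^ 2 * Vm * Real.exp (u z) := by ring
    _ ≤ _ := by unfold dens; gcongr

lemma dens_le (h : IsLiouvilleSol lam V u) (hV : WeightBounds V Vm VM CV) {z : ℂ}
    (hz : z ∈ closedBall (0 : ℂ) 1) : dens lam V u z ≤ lam * VM * (‖z‖ ^ 2 * Real.exp (u z)) := by
  have h1 := hV.upper z hz
  have h2 := h.lam_pos
  calc _ ≤ lam * ‖z‖ ^ 2 * VM * Real.exp (u z) := by unfold dens; gcongr
    _ = _ := by ring

lemma mass_ge_of_isMaxOn (h : IsLiouvilleSol lam V u) (hV : WeightBounds V Vm VM CV) {ρ : ℝ}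
    (hρ1 : ρ < 1) {x : ℂ} (hmax : ∀ y ∈ closedBall (0 : ℂ) 1, u y ≤ u x) (hx : ‖x‖ < ρ / 2)
    (hbig : 16 ≤ lam * VM * Real.exp (u x) * ρ ^ 4) :
    π * Vm / (8 * VM) ≤ ∫ z in ball (0 : ℂ) ρ, dens lam V u z := by
  have hρ : 0 < ρ := by linarith [norm_nonneg x]
  have hl := h.lam_pos
  have hVM := hV.upper_pos
  have hVm := hV.pos
  set μ := Real.exp (u x) with hμ
  have hμ0 : 0 < μ := Real.exp_pos _
  set X := ‖x‖ with hX
  have hX0 : 0 ≤ X := norm_nonneg x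
  have hcont : ContinuousOn (fun r => lam * VM * μ * (X + r) ^ 2 * r ^ 2) (Icc 0 (ρ / 2)) := by
    fun_prop
  obtain ⟨r, ⟨hr0, hrρ⟩, hr⟩ := intermediate_value_Icc (by positivity : 0 ≤ ρ / 2) hcont
    (show (1:ℝ) ∈ _ from ⟨by simp, by
      calc (1:ℝ) ≤ (lam * VM * μ * ρ ^ 4) / 16 := by linarith
        _ = lam * VM * μ * (0 + ρ / 2) ^ 2 * (ρ / 2) ^ 2 := by ring
        _ ≤ _ := by gcongr⟩)
  simp only at hr
  have hr0 : 0 < r := lt_of_le_of_ne hr0 (by rintro rfl; simp at hr)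
  have hsub : closedBall x r ⊆ ball 0 ρ := by
    refine closedBall_subset_ball' ?_
    rw [dist_zero_right]; linarith
  have hρsub : ball (0:ℂ) ρ ⊆ ball 0 1 := ball_subset_ball hρ1.le
  have hint := h.integrableOn_sq_exp.mono_set ((ball_subset_closedBall.trans hsub).trans hρsub)
  have key : ∀ t ∈ Ioo 0 r, μ * π * (X ^ 2 + t ^ 2) ≤
      ∫ θ in (-π)..π, (fun z => ‖z‖ ^ 2 * Real.exp (u z)) (circleMap x t θ) := by
    intro t ht
    have hts : closedBall x t ⊆ ball 0 1 :=
      ((closedBall_subset_closedBall ht.2.le).trans hsub).trans hρsub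
    have hnorm : ∀ z ∈ closedBall x t, ‖z‖ ≤ X + t := fun z hz => by
      have := norm_le_norm_add_norm_sub' z x
      rw [mem_closedBall, dist_eq_norm] at hz; linarith
    have hle := h.isSol.le_circle_integral (K := lam * VM * ((X + t) ^ 2 * μ)) ht.1 hts
      (fun z hz => by
        have hz1 := ball_subset_closedBall (hts (ball_subset_closedBall hz))
        refine (h.dens_le hV hz1).trans ?_
        have := hnorm z (ball_subset_closedBall hz)
        have := Real.exp_le_exp.2 (hmax z hz1)
        gcongr)
    have hcs : ContinuousOn u (sphere x t) := h.smooth.continuousOn.mono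
      (sphere_subset_closedBall.trans hts)
    have hmono := circle_integral_mono (c := x) (g := fun z => μ * ‖z‖ ^ 2 + μ * (X + t) ^ 2 * (u z - u x))
      (h := fun z => ‖z‖ ^ 2 * Real.exp (u z)) ht.1.le (by fun_prop) (by fun_prop) (fun z hz => by
        have hz' := sphere_subset_closedBall hz
        have h1 := exp_ge_tangent (u z) (u x)
        have h2 := hmax z (ball_subset_closedBall (hts hz'))
        have h3 : ‖z‖ ^ 2 ≤ (X + t) ^ 2 := by
          have := hnorm z hz'; gcongr
        have h4 := mul_le_mul_of_nonneg_left h1 (sq_nonneg ‖z‖)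
        have h5 := mul_le_mul_of_nonneg_left (mul_le_mul_of_nonpos_right h3 (sub_nonpos.2 h2)) hμ0.le
        rw [← hμ] at h4
        linarith)
    refine le_trans ?_ hmono
    have i1 : Continuous fun θ => u (circleMap x t θ) := continuous_comp_circleMap ht.1.le hcs
    have i2 : Continuous fun θ => μ * (X + t) ^ 2 * (u (circleMap x t θ) - u x) :=
      continuous_const.mul (i1.sub continuous_const)
    rw [intervalIntegral.integral_add (Continuous.intervalIntegrable (by fun_prop) _ _)
      (i2.intervalIntegrable _ _),
      intervalIntegral.integral_const_mul,
      intervalIntegral.integral_const_mul, circle_integral_norm_sq,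
      intervalIntegral.integral_sub (i1.intervalIntegrable _ _) (by simp),
      intervalIntegral.integral_const, smul_eq_mul]
    have hK : lam * VM * ((X + t) ^ 2 * μ) * t ^ 2 ≤ 1 := by
      rw [← hr]
      have : lam * VM * ((X + t) ^ 2 * μ) * t ^ 2 = lam * VM * μ * (X + t) ^ 2 * t ^ 2 := by ring
      rw [this]
      have := ht.1
      have := ht.2.le
      gcongr
    have hlow : -(π / 2) ≤ (∫ θ in (-π)..π, u (circleMap x t θ)) - (π - -π) * u x := by
      nlinarith [Real.pi_pos]
    have h6 : (X + t) ^ 2 ≤ 2 * (X ^ 2 + t ^ 2) := by nlinarith [sq_nonneg (X - t)]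
    have h7 := mul_le_mul_of_nonneg_left hlow (by positivity : 0 ≤ μ * (X + t) ^ 2)
    have h8 := mul_le_mul_of_nonneg_left h6 (by positivity : 0 ≤ μ * (π / 2))
    rw [← hX]
    linarith
  have hpol := polar_lower_bound hint (φ := fun t => μ * π * (X ^ 2 + t ^ 2))
    ((Continuous.integrableOn_Icc (by fun_prop)).mono_set Ioo_subset_Icc_self) key
  have hI : ∫ t in Ioo 0 r, t * (μ * π * (X ^ 2 + t ^ 2)) = μ * π * (X ^ 2 * r ^ 2 / 2 + r ^ 4 / 4) := by
    rw [← integral_Ioc_eq_integral_Ioo, ← intervalIntegral.integral_of_le hr0.le]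
    have e : ∀ t : ℝ, t * (μ * π * (X ^ 2 + t ^ 2)) = μ * π * X ^ 2 * t + μ * π * t ^ 3 := fun t => by ring
    simp_rw [e]
    rw [intervalIntegral.integral_add (Continuous.intervalIntegrable (by fun_prop) _ _)
      (Continuous.intervalIntegrable (by fun_prop) _ _), intervalIntegral.integral_const_mul,
      intervalIntegral.integral_const_mul, integral_id, integral_pow]
    push_cast
    ring
  have h9 : μ * π * (r ^ 2 * (X + r) ^ 2 / 8) ≤ μ * π * (X ^ 2 * r ^ 2 / 2 + r ^ 4 / 4) := by
    gcongr
    nlinarith [mul_nonneg (sq_nonneg r) (sq_nonneg (X - r)), sq_nonneg (X * r)]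
  calc π * Vm / (8 * VM) = π * Vm / (8 * VM) * (lam * VM * μ * (X + r) ^ 2 * r ^ 2) := by
        rw [hr, mul_one]
    _ = lam * Vm * (μ * π * (r ^ 2 * (X + r) ^ 2 / 8)) := by field_simp
    _ ≤ lam * Vm * ∫ z in ball x r, ‖z‖ ^ 2 * Real.exp (u z) := by
        gcongr
        linarith
    _ = ∫ z in ball x r, lam * Vm * (‖z‖ ^ 2 * Real.exp (u z)) := (integral_const_mul _ _).symm
    _ ≤ ∫ z in ball x r, dens lam V u z := by
        refine setIntegral_mono_on (hint.const_mul _) (h.integrableOn_dens.mono_set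
          ((ball_subset_closedBall.trans hsub).trans hρsub)) measurableSet_ball fun z hz => ?_
        exact h.le_dens hV (ball_subset_closedBall (hρsub (hsub (ball_subset_closedBall hz))))
    _ ≤ _ := setIntegral_mono_set (h.integrableOn_dens.mono_set hρsub)
        ((ae_restrict_mem measurableSet_ball).mono fun z hz => h.dens_nonneg' z (hρsub hz))
        (ball_subset_closedBall.trans hsub).eventuallyLE

lemma log_le_of_mass_ge (h : IsLiouvilleSol lam V u) {ρ : ℝ} (hρ : 0 < ρ) (hρ1 : ρ < 1)
    (hb : 8 * π ≤ ∫ z in ball (0 : ℂ) ρ, dens lam V u z) :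
    2 * π * Real.log (1 / ρ) ≤ ∫ z in ball (0 : ℂ) 1, ‖z‖ ^ 2 * Real.exp (u z) := by
  set φ : ℝ → ℝ := (Ici ρ).indicator fun r => 2 * π * (r ^ 2)⁻¹ with hφ
  have e : EqOn (fun r => r * φ r) ((Ici ρ).indicator fun r => 2 * π * r⁻¹) (Ioo 0 1) := by
    intro r hr
    have := hr.1.ne'
    by_cases hrρ : r ∈ Ici ρ
    · simp only [hφ, indicator_of_mem hrρ]; field_simp
    · simp only [hφ, indicator_of_notMem hrρ, mul_zero]
  have hset : Ioo (0:ℝ) 1 ∩ Ici ρ = Ico ρ 1 := by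
    ext r; simp only [mem_inter_iff, mem_Ioo, mem_Ici, mem_Ico]
    constructor
    · rintro ⟨⟨_, h2⟩, h3⟩; exact ⟨h3, h2⟩
    · rintro ⟨h1, h2⟩; exact ⟨⟨hρ.trans_le h1, h2⟩, h1⟩
  have hci : IntegrableOn (fun r : ℝ => 2 * π * r⁻¹) (Ico ρ 1) := by
    refine (ContinuousOn.integrableOn_Icc ?_).mono_set Ico_subset_Icc_self
    exact continuousOn_const.mul (continuousOn_inv₀.mono fun r hr => (hρ.trans_le hr.1).ne')
  have hi : IntegrableOn (fun r => r * φ r) (Ioo 0 1) := by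
    rw [integrableOn_congr_fun e measurableSet_Ioo, IntegrableOn,
      integrable_indicator_iff measurableSet_Ici, IntegrableOn,
      Measure.restrict_restrict measurableSet_Ici, inter_comm, hset]
    exact hci
  have hpol := polar_lower_bound h.integrableOn_sq_exp hi fun r hr => by
    by_cases hrρ : r ∈ Ici ρ
    · simp only [hφ, indicator_of_mem hrρ]
      have hs : closedBall (0:ℂ) r ⊆ ball 0 1 := closedBall_subset_ball hr.2
      have h1 := h.isSol.log_mass_le h.dens_nonneg' h.continuousOn h.zero hr.1 hr.2
      have h2 := circle_integral_exp_ge hr.1.le (c := 0)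
        (h.continuousOn.mono ((sphere_subset_closedBall.trans hs).trans ball_subset_closedBall))
        (4 * Real.log (1 / r))
      have h3 : 0 ≤ Real.log (1 / r) := Real.log_nonneg (by rw [le_div_iff₀ hr.1]; linarith [hr.2])
      have h4 : ∫ z in ball (0 : ℂ) ρ, dens lam V u z ≤ ∫ z in ball (0 : ℂ) r, dens lam V u z :=
        setIntegral_mono_set (h.integrableOn_dens.mono_set (ball_subset_ball hr.2.le))
          ((ae_restrict_mem measurableSet_ball).mono fun z hz =>
            h.dens_nonneg' z (ball_subset_ball hr.2.le hz)) (ball_subset_ball hrρ).eventuallyLE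
      have h5 := mul_le_mul_of_nonneg_left (hb.trans h4) h3
      have h6 : Real.exp (4 * Real.log (1 / r)) = (r ^ 4)⁻¹ := by
        have : Real.exp (4 * Real.log (1 / r)) = Real.exp (Real.log (1 / r)) ^ 4 := by
          rw [← Real.exp_nat_mul]; norm_num
        rw [this, Real.exp_log (by have := hr.1; positivity)]; simp
      rw [h6] at h2
      have h7 : (r ^ 4)⁻¹ * (2 * π) ≤ ∫ θ in (-π)..π, Real.exp (u (circleMap 0 r θ)) := by
        refine le_trans ?_ h2
        have := hr.1
        gcongr
        linarith
      have hn : ∀ θ, ‖circleMap (0:ℂ) r θ‖ = r := fun θ => by simp [abs_of_pos hr.1]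
      simp only [hn, intervalIntegral.integral_const_mul]
      have := hr.1.ne'
      calc 2 * π * (r ^ 2)⁻¹ = r ^ 2 * ((r ^ 4)⁻¹ * (2 * π)) := by field_simp
        _ ≤ _ := by gcongr
    · simp only [hφ, indicator_of_notMem hrρ]
      exact intervalIntegral.integral_nonneg neg_pi_le_pi fun θ _ => by positivity
  refine le_trans (le_of_eq ?_) hpol
  rw [setIntegral_congr_fun measurableSet_Ioo e, setIntegral_indicator measurableSet_Ici, hset,
    integral_Ico_eq_integral_Ioo, ← integral_Ioc_eq_integral_Ioo,
    ← intervalIntegral.integral_of_le hρ1.le, intervalIntegral.integral_const_mul,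
    integral_inv_of_pos hρ one_pos]

end IsLiouvilleSol

namespace IsLiouvilleSol

variable {lam Vm VM CV : ℝ} {V u : ℂ → ℝ}

lemma sq_mul_dens_le_mass (h : IsLiouvilleSol lam V u) (hV : WeightBounds V Vm VM CV) {y : ℂ} {r : ℝ}
    (hr : 0 < r) (hs : closedBall y r ⊆ ball 0 1)
    (hcmp : ∀ z ∈ closedBall y r, ‖y‖ ^ 2 ≤ 9 * ‖z‖ ^ 2)
    (hle : ∀ z ∈ ball y r, dens lam V u z ≤ 4 * dens lam V u y)
    (hr2 : 2 * dens lam V u y * r ^ 2 ≤ 1) :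
    π * (Vm / VM) * (r ^ 2 * dens lam V u y) ≤ 18 * ∫ z in ball y r, dens lam V u z := by
  have hVM := hV.upper_pos
  have hVm := hV.pos
  have hl := h.lam_pos
  have hy1 : y ∈ closedBall (0:ℂ) 1 := ball_subset_closedBall (hs (mem_closedBall_self hr.le))
  have hy0 := h.dens_nonneg hy1
  have hint := h.isSol.integrableOn hs
  set D := dens lam V u y with hD
  have key : ∀ t ∈ Ioo 0 r, π * (Vm / VM) * D / 9 ≤
      ∫ θ in (-π)..π, dens lam V u (circleMap y t θ) := by
    intro t ht
    have hts : closedBall y t ⊆ closedBall y r := closedBall_subset_closedBall ht.2.le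
    have h1 := h.isSol.le_circle_integral (K := 4 * D) ht.1 (hts.trans hs)
      (fun z hz => hle z (ball_subset_ball ht.2.le hz))
    have hcs : ContinuousOn u (sphere y t) := h.smooth.continuousOn.mono
      ((sphere_subset_closedBall.trans hts).trans hs)
    have hcd : ContinuousOn (dens lam V u) (sphere y t) := h.isSol.cont.mono
      ((sphere_subset_closedBall.trans hts).trans hs)
    have h2 := circle_integral_exp_ge ht.1.le hcs (u y)
    have h3 : 2 * D * t ^ 2 ≤ 1 := by
      refine le_trans ?_ hr2
      have := ht.1; have := ht.2.le
      gcongr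
    have h4 : Real.exp (u y) * π ≤ ∫ θ in (-π)..π, Real.exp (u (circleMap y t θ)) := by
      refine le_trans ?_ h2
      gcongr
      nlinarith [Real.pi_pos]
    have h5 := circle_integral_mono (c := y)
      (g := fun z => lam * Vm * (‖y‖ ^ 2 / 9) * Real.exp (u z)) ht.1.le
      (by fun_prop) hcd (fun z hz => by
        have hz' := hts (sphere_subset_closedBall hz)
        refine le_trans ?_ (h.le_dens hV (ball_subset_closedBall (hs hz')))
        have := hcmp z hz'
        rw [mul_assoc (lam * Vm)]
        gcongr
        linarith)
    rw [intervalIntegral.integral_const_mul] at h5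
    refine le_trans ?_ (le_trans (mul_le_mul_of_nonneg_left h4 (by positivity)) h5)
    have h6 := h.dens_le hV hy1
    calc π * (Vm / VM) * D / 9 ≤
          π * (Vm / VM) * (lam * VM * (‖y‖ ^ 2 * Real.exp (u y))) / 9 := by gcongr
      _ = _ := by field_simp
  have hpol := polar_lower_bound hint (φ := fun _ => π * (Vm / VM) * D / 9)
    ((Continuous.integrableOn_Icc (by fun_prop)).mono_set Ioo_subset_Icc_self) key
  rw [← integral_Ioc_eq_integral_Ioo, ← intervalIntegral.integral_of_le hr.le,
    intervalIntegral.integral_mul_const, integral_id] at hpol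
  linarith

/-- Small mass on a disc bounded away from the origin controls the density at its centre. -/
lemma dens_le_of_small_mass (h : IsLiouvilleSol lam V u) (hV : WeightBounds V Vm VM CV) {x : ℂ} {a : ℝ}
    (hx : x ≠ 0) (hx2 : ‖x‖ ≤ 1 / 2) (ha : ∫ z in ball x (‖x‖ / 2), dens lam V u z ≤ a)
    (ha2 : 36 * a < π * (Vm / VM)) : Vm / VM * (‖x‖ ^ 2 * dens lam V u x) ≤ 96 * a := by
  set d := ‖x‖ / 2 with hd
  have hd0 : 0 < d := by have := norm_pos_iff.2 hx; positivity
  have hVM := hV.upper_pos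
  have hVm := hV.pos
  have hs : closedBall x d ⊆ ball 0 1 := closedBall_subset_ball' (by rw [dist_zero_right]; linarith)
  have hκ : 0 < Vm / VM := by positivity
  have hnn : ∀ z ∈ closedBall x d, 0 ≤ dens lam V u z := fun z hz => h.dens_nonneg' z (hs hz)
  have hint := h.isSol.integrableOn hs
  have ha0 : 0 ≤ a := le_trans (setIntegral_nonneg measurableSet_ball fun z hz =>
    hnn z (ball_subset_closedBall hz)) ha
  have hcont : ContinuousOn (fun y => (d - ‖y - x‖) ^ 2 * dens lam V u y) (closedBall x d) := by
    have := h.isSol.cont.mono hs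
    fun_prop
  obtain ⟨y, hy, hymax⟩ := (isCompact_closedBall x d).exists_isMaxOn
    ⟨x, mem_closedBall_self hd0.le⟩ hcont
  have hyd : ‖y - x‖ ≤ d := by simpa [dist_eq_norm] using hy
  set D := dens lam V u y with hD
  set τ := (d - ‖y - x‖) / 2 with hτ
  have hD0 : 0 ≤ D := hnn y hy
  have hxF : d ^ 2 * dens lam V u x ≤ 4 * (τ ^ 2 * D) := by
    have := hymax (mem_closedBall_self hd0.le)
    simp only [mem_ofPred_eq, sub_self, norm_zero, sub_zero] at this
    rw [hτ]; linarith
  rcases hyd.lt_or_eq with hyd | hyd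
  swap
  · have hτ0 : τ = 0 := by rw [hτ, hyd]; simp
    rw [hτ0] at hxF
    have : ‖x‖ ^ 2 * dens lam V u x ≤ 0 := by
      have : ‖x‖ = 2 * d := by rw [hd]; ring
      rw [this]; linarith
    nlinarith
  have hτ0 : 0 < τ := by rw [hτ]; linarith
  have hτd : ∀ z ∈ closedBall y τ, z ∈ closedBall x d ∧ τ ≤ d - ‖z - x‖ := by
    intro z hz
    rw [mem_closedBall, dist_eq_norm] at hz ⊢
    have : ‖z - x‖ ≤ ‖z - y‖ + ‖y - x‖ := by simpa using norm_add_le (z - y) (y - x)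
    constructor <;> linarith
  have hle : ∀ z ∈ closedBall y τ, dens lam V u z ≤ 4 * D := by
    intro z hz
    obtain ⟨h1, h2⟩ := hτd z hz
    have h3 := hymax h1
    simp only [mem_ofPred_eq] at h3
    have h4 : τ ^ 2 * dens lam V u z ≤ (d - ‖z - x‖) ^ 2 * dens lam V u z := by
      have := hnn z h1
      gcongr
    have h5 : τ ^ 2 * dens lam V u z ≤ τ ^ 2 * (4 * D) := by
      have : d - ‖y - x‖ = 2 * τ := by rw [hτ]; ring
      rw [this] at h3
      linarith
    exact le_of_mul_le_mul_left h5 (by positivity)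
  have hcmp : ∀ z ∈ closedBall y τ, ‖y‖ ^ 2 ≤ 9 * ‖z‖ ^ 2 := by
    intro z hz
    obtain ⟨h1, -⟩ := hτd z hz
    rw [mem_closedBall, dist_eq_norm] at h1
    have h2 : ‖y‖ ≤ ‖x‖ + d := by linarith [norm_le_norm_add_norm_sub' y x]
    have h3 : ‖x‖ ≤ ‖z‖ + d := by linarith [norm_le_norm_add_norm_sub z x]
    have h4 : ‖y‖ ≤ 3 * ‖z‖ := by linarith
    calc ‖y‖ ^ 2 ≤ (3 * ‖z‖) ^ 2 := by gcongr
      _ = _ := by ring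
  have hmass : ∀ r, 0 < r → r ≤ τ → 2 * D * r ^ 2 ≤ 1 → π * (Vm / VM) * (r ^ 2 * D) ≤ 18 * a := by
    intro r hr hrτ hr2
    have hrs : closedBall y r ⊆ closedBall y τ := closedBall_subset_closedBall hrτ
    refine (h.sq_mul_dens_le_mass hV hr (fun z hz => hs (hτd z (hrs hz)).1)
      (fun z hz => hcmp z (hrs hz)) (fun z hz => hle z (hrs (ball_subset_closedBall hz))) hr2).trans ?_
    gcongr
    refine (setIntegral_mono_set hint ((ae_restrict_mem measurableSet_ball).mono fun z hz =>
      hnn z (ball_subset_closedBall hz)) (LE.le.eventuallyLE fun z hz => ?_)).trans ha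
    have := (hτd z (hrs (ball_subset_closedBall hz))).2
    rw [mem_ball, dist_eq_norm]; linarith
  have hDτ : 2 * D * τ ^ 2 ≤ 1 := by
    by_contra! hcon
    have hDpos : 0 < D := by
      by_contra! h0
      have : D = 0 := le_antisymm h0 hD0
      rw [this] at hcon; norm_num at hcon
    have h1 := hmass (Real.sqrt (1 / (2 * D))) (by positivity)
      (by
        rw [Real.sqrt_le_left hτ0.le, div_le_iff₀ (by positivity)]; linarith)
      (by rw [Real.sq_sqrt (by positivity)]; field_simp; norm_num)
    rw [Real.sq_sqrt (by positivity)] at h1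
    have : 1 / (2 * D) * D = 1 / 2 := by field_simp
    rw [this] at h1
    linarith
  have h1 := hmass τ hτ0 le_rfl hDτ
  have h2 : ‖x‖ ^ 2 * dens lam V u x ≤ 16 * (τ ^ 2 * D) := by
    have : ‖x‖ = 2 * d := by rw [hd]; ring
    rw [this]; linarith
  have h3 : 3 * (Vm / VM * (τ ^ 2 * D)) ≤ 18 * a := by
    refine le_trans ?_ h1
    have : 0 ≤ Vm / VM * (τ ^ 2 * D) := by positivity
    nlinarith [Real.pi_gt_three]
  calc Vm / VM * (‖x‖ ^ 2 * dens lam V u x) ≤ Vm / VM * (16 * (τ ^ 2 * D)) := by gcongr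
    _ ≤ 96 * a := by linarith

end IsLiouvilleSol

lemma norm_circle_integral_sq_sub_le {w ψ : ℂ → ℂ} {R b E W : ℝ} (hR : 0 ≤ R)
    (hw : ContinuousOn w (sphere 0 R)) (hψ : ContinuousOn ψ (sphere 0 R))
    (hW : ∀ z ∈ sphere (0 : ℂ) R, ‖w z‖ ≤ W)
    (hE : ∀ z ∈ sphere (0 : ℂ) R, ‖4 * π * ψ z + b‖ ≤ E) (hb : 0 ≤ b) :
    ‖(∫ θ in (-π)..π, w (circleMap 0 R θ) * ψ (circleMap 0 R θ) ^ 2) -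
      (b / (4 * π)) ^ 2 * ∫ θ in (-π)..π, w (circleMap 0 R θ)‖ ≤ W * (2 * b * E + E ^ 2) / (8 * π) := by
  have cw : Continuous fun θ => w (circleMap 0 R θ) := continuous_comp_circleMap hR hw
  have cψ : Continuous fun θ => ψ (circleMap 0 R θ) := continuous_comp_circleMap hR hψ
  have c1 : Continuous fun θ => w (circleMap 0 R θ) * ψ (circleMap 0 R θ) ^ 2 := cw.mul (cψ.pow 2)
  have c2 : Continuous fun θ => ((b : ℂ) / (4 * π)) ^ 2 * w (circleMap 0 R θ) := continuous_const.mul cw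
  rw [← intervalIntegral.integral_const_mul, ← intervalIntegral.integral_sub
    (c1.intervalIntegrable _ _) (c2.intervalIntegrable _ _)]
  refine (intervalIntegral.norm_integral_le_of_norm_le_const
    (C := W * (2 * b * E + E ^ 2) / (16 * π ^ 2)) fun θ _ => ?_).trans (le_of_eq ?_)
  · have hz := circleMap_mem_sphere 0 hR θ
    have h1 := hW _ hz
    have h2 := hE _ hz
    set z := circleMap 0 R θ
    have hE0 : 0 ≤ E := (norm_nonneg _).trans h2
    have hW0 : 0 ≤ W := (norm_nonneg _).trans h1
    have hpi : (π : ℂ) ≠ 0 := by exact_mod_cast Real.pi_ne_zero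
    have e : w z * ψ z ^ 2 - (b / (4 * π)) ^ 2 * w z =
        w z * ((4 * π * ψ z + b) * ((4 * π * ψ z + b) - 2 * b)) / (16 * π ^ 2) := by
      field_simp; ring
    have h3 : ‖(4 * π * ψ z + b) - 2 * b‖ ≤ E + 2 * b := by
      refine (norm_sub_le _ _).trans (add_le_add h2 (le_of_eq ?_))
      rw [norm_mul, Complex.norm_real, Real.norm_of_nonneg hb]; simp
    rw [e, norm_div, norm_mul, norm_mul]
    have h4 : ‖(16 * π ^ 2 : ℂ)‖ = 16 * π ^ 2 := by
      rw [norm_mul, norm_pow, Complex.norm_real, Real.norm_of_nonneg Real.pi_pos.le]; simp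
    rw [h4]
    refine div_le_div_of_nonneg_right ?_ (by positivity)
    calc ‖w z‖ * (‖4 * π * ψ z + b‖ * ‖(4 * π * ψ z + b) - 2 * b‖) ≤ W * (E * (E + 2 * b)) := by gcongr
      _ = _ := by ring
  · rw [abs_of_pos (by linarith [Real.pi_pos])]
    have := Real.pi_ne_zero
    field_simp; ring

namespace IsLiouvilleSol

variable {lam Vm VM CV C₀ : ℝ} {V u : ℂ → ℝ}

lemma mass_mono (h : IsLiouvilleSol lam V u) {s t : Set ℂ} (hst : s ⊆ t) (ht : t ⊆ ball 0 1)
    (hm : MeasurableSet t) : ∫ z in s, dens lam V u z ≤ ∫ z in t, dens lam V u z :=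
  setIntegral_mono_set (h.integrableOn_dens.mono_set ht)
    ((ae_restrict_mem hm).mono fun z hz => h.dens_nonneg' z (ht hz)) (LE.le.eventuallyLE hst)

lemma mass_nonneg (h : IsLiouvilleSol lam V u) {s : Set ℂ} (hs : s ⊆ ball 0 1)
    (hm : MeasurableSet s) : 0 ≤ ∫ z in s, dens lam V u z :=
  setIntegral_nonneg hm fun z hz => h.dens_nonneg' z (hs hz)

lemma mass_le (h : IsLiouvilleSol lam V u) (hV : WeightBounds V Vm VM CV)
    (hC : lam * ∫ z in ball (0 : ℂ) 1, ‖z‖ ^ 2 * Real.exp (u z) ≤ C₀) {s : Set ℂ}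
    (hs : s ⊆ ball 0 1) : ∫ z in s, dens lam V u z ≤ VM * C₀ := by
  refine (h.mass_mono hs subset_rfl measurableSet_ball).trans ?_
  calc _ ≤ ∫ z in ball (0 : ℂ) 1, lam * VM * (‖z‖ ^ 2 * Real.exp (u z)) :=
        setIntegral_mono_on h.integrableOn_dens (h.integrableOn_sq_exp.const_mul _) measurableSet_ball
          fun z hz => h.dens_le hV (ball_subset_closedBall hz)
    _ = VM * (lam * ∫ z in ball (0 : ℂ) 1, ‖z‖ ^ 2 * Real.exp (u z)) := by
        rw [integral_const_mul]; ring
    _ ≤ _ := mul_le_mul_of_nonneg_left hC hV.upper_pos.le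

lemma mass_diff (h : IsLiouvilleSol lam V u) {r s : ℝ} (hrs : r ≤ s) (hs : s ≤ 1) :
    ∫ z in ball (0 : ℂ) s \ ball 0 r, dens lam V u z =
      (∫ z in ball (0 : ℂ) s, dens lam V u z) - ∫ z in ball (0 : ℂ) r, dens lam V u z :=
  setIntegral_sdiff measurableSet_ball (h.integrableOn_dens.mono_set (ball_subset_ball hs))
    (ball_subset_ball hrs)

lemma norm_integral_le_mass (h : IsLiouvilleSol lam V u) {s : Set ℂ} (hs : s ⊆ ball 0 1)
    (hm : MeasurableSet s) {F : ℂ → ℂ} {K : ℝ} (hK : 0 ≤ K)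
    (hC : lam * ∫ z in ball (0 : ℂ) 1, ‖z‖ ^ 2 * Real.exp (u z) ≤ C₀)
    (hF : ∀ z ∈ s, ‖F z‖ ≤ K * (lam * (‖z‖ ^ 2 * Real.exp (u z)))) : ‖∫ z in s, F z‖ ≤ K * C₀ := by
  have hl := h.lam_pos
  calc _ ≤ ∫ z in s, K * (lam * (‖z‖ ^ 2 * Real.exp (u z))) :=
        norm_integral_le_of_norm_le (((h.integrableOn_sq_exp.mono_set hs).const_mul _).const_mul _)
          ((ae_restrict_mem hm).mono hF)
    _ = K * (lam * ∫ z in s, ‖z‖ ^ 2 * Real.exp (u z)) := by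
        rw [integral_const_mul, integral_const_mul]
    _ ≤ _ := by
        refine mul_le_mul_of_nonneg_left (le_trans ?_ hC) hK
        refine mul_le_mul_of_nonneg_left ?_ hl.le
        exact setIntegral_mono_set h.integrableOn_sq_exp (Eventually.of_forall fun z => by positivity)
          (LE.le.eventuallyLE hs)

/-- The Pohozaev identity for `z² (∂u)²`. -/
lemma pohozaev_sq (h : IsLiouvilleSol lam V u) {R : ℝ} (hR : 0 < R) (hR1 : R < 1) :
    (∫ θ in (-π)..π, (circleMap 0 R θ * du u (circleMap 0 R θ)) ^ 2) / 2 =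
      -(R ^ 2 * ((∫ θ in (-π)..π, dens lam V u (circleMap 0 R θ) : ℝ) : ℂ)) / 4 +
      (2 * ((∫ z in ball (0 : ℂ) R, dens lam V u z : ℝ) : ℂ) +
        ∫ z in ball (0 : ℂ) R, z ^ 2 * conj z * (lam * Real.exp (u z) * du V z)) / 2 := by
  have hsub : closedBall (0:ℂ) R ⊆ ball 0 1 := closedBall_subset_ball hR1
  have hp := h.pohozaev (g := fun z => z ^ 2) (by fun_prop) hR hR1
  have hi1 : IntegrableOn (dens lam V u) (ball 0 R) := h.integrableOn_dens.mono_set (ball_subset_ball hR1.le)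
  have hi1C : IntegrableOn (fun z => (dens lam V u z : ℂ)) (ball 0 R) := hi1.ofReal
  have hdVc := h.continuousOn_du_weight.mono hsub
  have huc := h.smooth.continuousOn.mono hsub
  have hi2 : IntegrableOn (fun z => z ^ 2 * conj z * (lam * Real.exp (u z) * du V z)) (ball 0 R) := by
    refine (ContinuousOn.integrableOn_compact (isCompact_closedBall (0:ℂ) R) ?_).mono_set
      ball_subset_closedBall
    fun_prop
  have e1 : ∫ z in ball (0 : ℂ) R, (deriv (fun z : ℂ => z ^ 2) z * conj z * (lam * V z * Real.exp (u z)) +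
        z ^ 2 * conj z * (lam * Real.exp (u z) * du V z)) =
      2 * ((∫ z in ball (0 : ℂ) R, dens lam V u z : ℝ) : ℂ) +
        ∫ z in ball (0 : ℂ) R, z ^ 2 * conj z * (lam * Real.exp (u z) * du V z) := by
    rw [← integral_complex_ofReal, ← integral_const_mul, ← integral_add (hi1C.const_mul 2) hi2]
    refine integral_congr_ae (Eventually.of_forall fun z => ?_)
    simp only [dens, deriv_pow_field]
    push_cast
    rw [← Complex.mul_conj']
    ring
  have e2 : ∫ θ in (-π)..π, conj (circleMap 0 R θ) * (circleMap 0 R θ ^ 2 * conj (circleMap 0 R θ) *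
        (lam * V (circleMap 0 R θ) * Real.exp (u (circleMap 0 R θ)))) =
      R ^ 2 * ((∫ θ in (-π)..π, dens lam V u (circleMap 0 R θ) : ℝ) : ℂ) := by
    rw [← intervalIntegral.integral_ofReal, ← intervalIntegral.integral_const_mul]
    refine intervalIntegral.integral_congr fun θ _ => ?_
    have hn : ‖circleMap 0 R θ‖ = R := by simp [hR.le]
    simp only [dens, hn]
    push_cast
    rw [← congrArg Complex.ofReal hn, ← Complex.mul_conj']
    ring
  rw [e1, e2] at hp
  have e3 : ∫ θ in (-π)..π, circleMap 0 R θ ^ 2 * du u (circleMap 0 R θ) ^ 2 =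
      ∫ θ in (-π)..π, (circleMap 0 R θ * du u (circleMap 0 R θ)) ^ 2 := by
    simp_rw [mul_pow]
  rw [e3] at hp
  rw [← hp]; simp

end IsLiouvilleSol

namespace IsLiouvilleSol

variable {lam Vm VM CV C₀ : ℝ} {V u : ℂ → ℝ}

/-- If the annulus around `|z| = R` carries little mass, then the mass inside nearly satisfies
the quadratic balance `b = b² / 16π`. -/
lemma abs_mass_sub_sq_le (h : IsLiouvilleSol lam V u) (hV : WeightBounds V Vm VM CV)
    (hC : lam * ∫ z in ball (0 : ℂ) 1, ‖z‖ ^ 2 * Real.exp (u z) ≤ C₀) {L R a E : ℝ}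
    (hL : 2 ≤ L) (hR : 0 < R) (hLR : L * R ≤ 1 / 2)
    (ha : ∫ z in ball (0 : ℂ) (2 * L * R) \ ball 0 (R / (2 * L)), dens lam V u z ≤ a)
    (ha2 : 36 * a < π * (Vm / VM))
    (hE : 8 / L * (VM * C₀) + 480 * π * L ^ 3 * a / (Vm / VM) ≤ E) :
    |(∫ z in ball (0 : ℂ) (R / L), dens lam V u z) -
        (∫ z in ball (0 : ℂ) (R / L), dens lam V u z) ^ 2 / (16 * π)| ≤
      (2 * (VM * C₀) * E + E ^ 2) / (16 * π) + 48 * π * L ^ 2 * a / (Vm / VM) + a + CV * R * C₀ / 2 := by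
  have hl := h.lam_pos
  have hL0 : 0 < L := by linarith
  have hVM := hV.upper_pos
  have hVm := hV.pos
  have hCV := hV.deriv_nonneg
  have hR1 : R < 1 := by nlinarith
  have hRL : R / L ≤ R / 2 := by gcongr
  have hRL0 : 0 < R / L := by positivity
  have hRL2 : R / (2 * L) = R / L / 2 := by field_simp
  have hκ : 0 < Vm / VM := by positivity
  set κ := Vm / VM with hκdef
  set b := ∫ z in ball (0 : ℂ) (R / L), dens lam V u z with hb
  have hball : ∀ {r : ℝ}, r ≤ 1 → ball (0:ℂ) r ⊆ ball 0 1 := fun hr => ball_subset_ball hr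
  have hb0 : 0 ≤ b := h.mass_nonneg (hball (by linarith)) measurableSet_ball
  have hbM : b ≤ VM * C₀ := h.mass_le hV hC (hball (by linarith))
  have hann : ball (0 : ℂ) (2 * L * R) \ ball 0 (R / (2 * L)) ⊆ ball 0 1 :=
    sdiff_subset.trans (hball (by linarith))
  have hannm : MeasurableSet (ball (0 : ℂ) (2 * L * R) \ ball 0 (R / (2 * L))) :=
    measurableSet_ball.diff measurableSet_ball
  have ha0 : 0 ≤ a := (h.mass_nonneg hann hannm).trans ha
  set η := 96 * L ^ 2 * a / (κ * R ^ 2) with hη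
  have hη0 : 0 ≤ η := by positivity
  have hdens : ∀ y : ℂ, R / L ≤ ‖y‖ → ‖y‖ < L * R → dens lam V u y ≤ η := by
    intro y h1 h2
    have hy0 : 0 < ‖y‖ := hRL0.trans_le h1
    have hsub : ball y (‖y‖ / 2) ⊆ ball (0 : ℂ) (2 * L * R) \ ball 0 (R / (2 * L)) := by
      intro z hz
      rw [mem_ball, dist_eq_norm] at hz
      rw [Set.mem_sdiff, mem_ball_zero_iff, mem_ball_zero_iff, not_lt, hRL2]
      constructor
      · linarith [norm_le_norm_add_norm_sub' z y]
      · linarith [norm_le_norm_add_norm_sub z y]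
    have h3 := h.dens_le_of_small_mass (a := a) hV (norm_pos_iff.1 hy0) (by linarith)
      ((h.mass_mono hsub hann hannm).trans ha) ha2
    rw [← hκdef] at h3
    have h4 : (R / L) ^ 2 * (κ * dens lam V u y) ≤ 96 * a := by
      refine le_trans ?_ h3
      have := h.dens_nonneg' y (by rw [mem_ball_zero_iff]; linarith)
      calc _ ≤ ‖y‖ ^ 2 * (κ * dens lam V u y) := by gcongr
        _ = _ := by ring
    rw [hη, le_div_iff₀ (by positivity)]
    calc _ = L ^ 2 * ((R / L) ^ 2 * (κ * dens lam V u y)) := by field_simp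
      _ ≤ L ^ 2 * (96 * a) := by gcongr
      _ = _ := by ring
  obtain ⟨B, hB⟩ := h.exists_dens_le
  have hsR : ∀ z ∈ sphere (0:ℂ) R, ‖z‖ = R := fun z hz => by simpa using hz
  have hsub : closedBall (0:ℂ) R ⊆ ball 0 1 := closedBall_subset_ball hR1
  have hssub : sphere (0:ℂ) R ⊆ ball 0 1 := sphere_subset_closedBall.trans hsub
  have hψ : ∀ z ∈ sphere (0:ℂ) R, ‖4 * π * (z * du u z) + b‖ ≤ E := by
    intro z hz
    have hzR := hsR z hz
    have h1 := h.isSol.norm_du_add_le h.continuousOn h.zero h.dens_nonneg' hB (x := z) (ρ := R / L)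
      (σ := L * R) (η := η) (norm_pos_iff.1 (hzR ▸ hR)) (by nlinarith) hRL0 (hzR ▸ hRL)
      (by rw [hzR]; gcongr) (by linarith) hdens hη0
    rw [← hb, hzR] at h1
    have h2 : ∫ y in ball (0:ℂ) 1 \ ball 0 (L * R), dens lam V u y ≤ VM * C₀ - b := by
      rw [h.mass_diff (by linarith) le_rfl]
      have h3 : b ≤ ∫ z in ball (0 : ℂ) (L * R), dens lam V u z :=
        h.mass_mono (ball_subset_ball (by nlinarith)) (hball (by linarith)) measurableSet_ball
      have h4 := h.mass_le hV hC subset_rfl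
      linarith
    refine h1.trans (le_trans ?_ hE)
    have e1 : R / L / R = 1 / L := by field_simp
    have e2 : R / (L * R) = 1 / L := by field_simp
    have e3 : 5 * π * η * (L * R) * R = 480 * π * L ^ 3 * a / κ := by
      rw [hη]; field_simp; ring
    rw [e1, e2, e3]
    have e4 : 8 / L * (VM * C₀) = 8 * (1 / L) * (VM * C₀) := by ring
    have h5 : 4 * (1 / L) * (∫ y in ball (0:ℂ) 1 \ ball 0 (L * R), dens lam V u y) ≤
      4 * (1 / L) * (VM * C₀ - b) := by gcongr
    have h6 : 0 ≤ (1 / L) * (VM * C₀ - b) := mul_nonneg (by positivity) (by linarith)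
    rw [e4]
    nlinarith [mul_nonneg (by positivity : 0 ≤ 1 / L) hb0]
  have hE0 : 0 ≤ E := (norm_nonneg _).trans (hψ R (by simp [hR.le]))
  have hduc : ContinuousOn (fun z => z * du u z) (sphere 0 R) :=
    continuousOn_id.mul (h.isSol.contDiffOn_du.continuousOn.mono hssub)
  have hq := norm_circle_integral_sq_sub_le (w := fun _ => 1) (W := 1) hR.le continuousOn_const hduc
    (by simp) hψ hb0
  simp only [one_mul] at hq
  have hp := h.pohozaev_sq hR hR1
  set I := ∫ θ in (-π)..π, dens lam V u (circleMap 0 R θ) with hI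
  set T := ∫ z in ball (0 : ℂ) R, dens lam V u z with hT
  have hIle : |I| ≤ 2 * π * η := by
    have := intervalIntegral.norm_integral_le_of_norm_le_const (a := -π) (b := π) (C := η)
      (f := fun θ => dens lam V u (circleMap 0 R θ)) fun θ _ => by
        have hn : ‖circleMap 0 R θ‖ = R := by simp [hR.le]
        rw [Real.norm_of_nonneg (h.dens_nonneg' _ (hssub (circleMap_mem_sphere 0 hR.le θ)))]
        exact hdens _ (by rw [hn]; linarith) (by rw [hn]; nlinarith)
    rw [abs_of_pos (by linarith [Real.pi_pos]), Real.norm_eq_abs] at this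
    linarith
  have hTb : |T - b| ≤ a := by
    have h1 : b ≤ T := h.mass_mono (ball_subset_ball (by linarith)) (hball hR1.le) measurableSet_ball
    have h2 := h.mass_diff (r := R / L) (s := R) (by linarith) hR1.le
    have h3 := (h.mass_mono (s := ball (0:ℂ) R \ ball 0 (R / L)) (sdiff_subset_sdiff
      (ball_subset_ball (by nlinarith)) (ball_subset_ball (by rw [hRL2]; linarith))) hann hannm).trans ha
    rw [abs_of_nonneg (by linarith)]
    linarith
  have hV3 := h.norm_integral_le_mass (s := ball 0 R) (hball hR1.le) measurableSet_ball
    (F := fun z => z ^ 2 * conj z * (lam * Real.exp (u z) * du V z)) (K := CV * R) (by positivity) hC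
    (fun z hz => by
      have h1 := hV.deriv z (hball hR1.le hz)
      have h2 : ‖z‖ ≤ R := (mem_ball_zero_iff.1 hz).le
      rw [norm_mul, norm_mul, norm_mul, norm_mul, norm_pow, Complex.norm_conj, Complex.norm_real,
        Complex.norm_real, Real.norm_of_nonneg hl.le, Real.norm_of_nonneg (Real.exp_pos _).le]
      calc ‖z‖ ^ 2 * ‖z‖ * (lam * Real.exp (u z) * ‖du V z‖) ≤
            ‖z‖ ^ 2 * R * (lam * Real.exp (u z) * CV) := by gcongr
        _ = _ := by ring)
  set S := ∫ z in ball (0 : ℂ) R, z ^ 2 * conj z * (lam * Real.exp (u z) * du V z) with hS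
  set Q := ∫ θ in (-π)..π, (circleMap 0 R θ * du u (circleMap 0 R θ)) ^ 2 with hQ
  rw [intervalIntegral.integral_const] at hq
  have e4 : ((b - b ^ 2 / (16 * π) : ℝ) : ℂ) =
      (Q - (b / (4 * π)) ^ 2 * ((π - -π) • (1:ℂ))) / 2 + R ^ 2 * I / 4 - ((T - b : ℝ) : ℂ) - S / 2 := by
    have hpi : (π : ℂ) ≠ 0 := by exact_mod_cast Real.pi_ne_zero
    push_cast
    rw [sub_div, hp]
    simp only [Complex.real_smul]
    push_cast
    field_simp
    ring
  rw [← Real.norm_eq_abs, ← Complex.norm_real, e4]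
  refine (norm_sub_le _ _).trans ?_
  refine (add_le_add ((norm_sub_le _ _).trans (add_le_add (norm_add_le _ _) le_rfl)) le_rfl).trans ?_
  have n1 : ‖(Q - (b / (4 * π)) ^ 2 * ((π - -π) • (1:ℂ))) / 2‖ ≤ (2 * (VM * C₀) * E + E ^ 2) / (16 * π) := by
    rw [norm_div, Complex.norm_two]
    calc _ ≤ (2 * b * E + E ^ 2) / (8 * π) / 2 := by gcongr
      _ = (2 * b * E + E ^ 2) / (16 * π) := by field_simp; ring
      _ ≤ _ := by gcongr
  have n2 : ‖(R ^ 2 * I / 4 : ℂ)‖ ≤ 48 * π * L ^ 2 * a / κ := by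
    rw [norm_div, norm_mul, norm_pow, Complex.norm_real, Complex.norm_real, Real.norm_of_nonneg hR.le,
      Real.norm_eq_abs]
    calc _ ≤ R ^ 2 * (2 * π * η) / 4 := by simp; gcongr
      _ = _ := by rw [hη]; field_simp; ring
  have n3 : ‖((T - b : ℝ) : ℂ)‖ ≤ a := by rw [Complex.norm_real]; exact hTb
  have n4 : ‖S / 2‖ ≤ CV * R * C₀ / 2 := by
    rw [norm_div, Complex.norm_two]; gcongr
  linarith

end IsLiouvilleSol

lemma exists_small_decrement {F : ℕ → ℝ} {M a : ℝ} {J : ℕ} (h0 : F 0 ≤ M) (hJ : 0 ≤ F J)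
    (hM : M < J * a) : ∃ j < J, F j - F (j + 1) ≤ a := by
  by_contra! hcon
  have h1 : ∑ j ∈ Finset.range J, a ≤ ∑ j ∈ Finset.range J, (F j - F (j + 1)) :=
    Finset.sum_le_sum fun j hj => (hcon j (Finset.mem_range.1 hj)).le
  rw [Finset.sum_range_sub', Finset.sum_const, Finset.card_range, nsmul_eq_mul] at h1
  linarith

namespace IsLiouvilleSol

set_option maxHeartbeats 1000000 in
/-- When `lam` is bounded below, solutions with bounded mass cannot concentrate at the origin. -/
lemma exists_radius_of_le {Vm VM CV C₀ c : ℝ} (hVm : 0 < Vm) (hVM : 0 < VM) (hC₀ : 0 ≤ C₀)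
    (hc : 0 < c) :
    ∃ ρ : ℝ, 0 < ρ ∧ ρ < 1 ∧ ∀ (lam : ℝ) (V u : ℂ → ℝ), IsLiouvilleSol lam V u →
      WeightBounds V Vm VM CV → c ≤ lam →
      lam * ∫ z in ball (0 : ℂ) 1, ‖z‖ ^ 2 * Real.exp (u z) ≤ C₀ →
      ∀ x, (∀ y ∈ closedBall (0 : ℂ) 1, u y ≤ u x) → ‖x‖ < ρ / 2 →
        lam * VM * Real.exp (u x) * ρ ^ 4 < 16 := by
  set κ := Vm / VM with hκdef
  have hκ : 0 < κ := by positivity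
  set m₀ := π * Vm / (8 * VM) with hm₀def
  have hm₀ : 0 < m₀ := by positivity
  set M := VM * C₀ with hMdef
  have hM : 0 ≤ M := by positivity
  have small : ∀ K ε : ℝ, 0 < ε → ∀ᶠ a in 𝓝[>] (0:ℝ), K * a < ε := fun K ε hε => by
    have : Tendsto (fun a : ℝ => K * a) (𝓝[>] 0) (𝓝 (K * 0)) :=
      ((continuous_const.mul continuous_id).tendsto 0).mono_left nhdsWithin_le_nhds
    exact this.eventually_lt_const (by simpa using hε)
  obtain ⟨e, ⟨he1, he2⟩, he0⟩ := (((small 1 1 one_pos).and (small (2 * M + 1) m₀ hm₀)).and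
    self_mem_nhdsWithin).exists
  replace he0 : 0 < e := he0
  obtain ⟨L, hL2, hLe⟩ : ∃ L : ℝ, 2 ≤ L ∧ 8 / L * M ≤ e / 2 := by
    refine ⟨2 + 16 * M / e, by have : 0 ≤ 16 * M / e := by positivity
                               linarith, ?_⟩
    have : 0 < 2 + 16 * M / e := by positivity
    rw [div_mul_eq_mul_div, div_le_iff₀ this]
    have : e / 2 * (2 + 16 * M / e) = e + 8 * M := by field_simp; ring
    linarith
  have hL0 : 0 < L := by linarith
  obtain ⟨a, ⟨⟨⟨ha1, ha2⟩, ha3⟩, ha4⟩, ha0⟩ := (((((small 36 (π * κ) (by positivity)).and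
    (small (480 * π * L ^ 3 / κ) (e / 2) (by positivity))).and
    (small (48 * π * L ^ 2 / κ) (m₀ / 16) (by positivity))).and (small 1 (m₀ / 16) (by positivity))).and
    self_mem_nhdsWithin).exists
  replace ha0 : 0 < a := ha0
  obtain ⟨R₀, ⟨⟨hR1, hR2⟩, hR3⟩, hR0⟩ := ((((small (2 * L) 1 one_pos).and
    (small (CV * C₀ / 2) (m₀ / 16) (by positivity))).and
    (small 1 (Real.exp (-(C₀ / c))) (Real.exp_pos _))).and self_mem_nhdsWithin).exists
  replace hR0 : 0 < R₀ := hR0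
  obtain ⟨J, hJ⟩ := exists_nat_gt (M / a)
  rw [div_lt_iff₀ ha0] at hJ
  set q := 1 / (4 * L ^ 2) with hq
  have hq0 : 0 < q := by positivity
  have hq1 : q ≤ 1 := by
    rw [hq, div_le_one (by positivity)]; nlinarith
  set s : ℕ → ℝ := fun j => 2 * L * R₀ * q ^ j with hs
  have hs0 : ∀ j, 0 < s j := fun j => by simp only [hs]; positivity
  have hsanti : Antitone s := fun i j hij => by
    simp only [hs]
    exact mul_le_mul_of_nonneg_left (pow_le_pow_of_le_one hq0.le hq1 hij) (by positivity)
  have hs1 : ∀ j, s j < 1 := fun j => (hsanti (Nat.zero_le j)).trans_lt (by simpa [hs] using hR1)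
  refine ⟨s J, hs0 J, hs1 J, fun lam V u h hV hlam hC x hmax hx => ?_⟩
  by_contra! hbig
  have hm := h.mass_ge_of_isMaxOn hV (hs1 J) hmax hx hbig
  have hsub : ∀ {r : ℝ}, r ≤ 1 → ball (0:ℂ) r ⊆ ball 0 1 := fun hr => ball_subset_ball hr
  obtain ⟨j, hjJ, hj⟩ := exists_small_decrement (F := fun j => ∫ z in ball (0:ℂ) (s j), dens lam V u z)
    (h.mass_le hV hC (hsub (hs1 0).le)) (h.mass_nonneg (hsub (hs1 J).le) measurableSet_ball) hJ
  rw [← h.mass_diff (hsanti j.le_succ) (hs1 j).le] at hj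
  set R := R₀ * q ^ j with hR
  have hRpos : 0 < R := by positivity
  have hRR0 : R ≤ R₀ := by
    have := pow_le_one₀ hq0.le hq1 (n := j)
    exact mul_le_of_le_one_right hR0.le this
  have e1 : s j = 2 * L * R := by rw [hR]; simp only [hs]; ring
  have e2 : s (j + 1) = R / (2 * L) := by
    rw [hR]; simp only [hs, pow_succ]; rw [hq]; field_simp; ring
  rw [e1, e2] at hj
  have hLR : L * R ≤ 1 / 2 := by
    have := mul_le_mul_of_nonneg_left hRR0 hL0.le
    linarith
  have hkey := h.abs_mass_sub_sq_le (E := e) hV hC hL2 hRpos hLR hj ha1 (by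
    have : 480 * π * L ^ 3 * a / κ = 480 * π * L ^ 3 / κ * a := by ring
    rw [← hMdef, this]; linarith)
  rw [← hMdef, ← hκdef] at hkey
  set b := ∫ z in ball (0 : ℂ) (R / L), dens lam V u z with hb
  have hRL : R / L ≤ R₀ := (div_le_self hRpos.le (by linarith)).trans hRR0
  have hR01 : R₀ < 1 := by
    have := mul_le_mul_of_nonneg_right hL2 hR0.le
    linarith
  have hb1 : m₀ ≤ b := hm.trans (h.mass_mono (ball_subset_ball (by
    calc s J ≤ s (j + 1) := hsanti hjJ
      _ = R / L / 2 := by rw [e2]; field_simp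
      _ ≤ R / L := half_le_self (by positivity))) (hsub (hRL.trans hR01.le)) measurableSet_ball)
  have hb2 : b < 8 * π := by
    by_contra! hcon
    have h1 := h.log_le_of_mass_ge hR0 hR01
      (hcon.trans (h.mass_mono (ball_subset_ball hRL) (hsub hR01.le) measurableSet_ball))
    have h2 : C₀ / c < Real.log (1 / R₀) := by
      rw [one_div, Real.log_inv, lt_neg]
      rw [one_mul] at hR3
      exact (Real.log_lt_iff_lt_exp hR0).2 hR3
    have h3 : 0 ≤ C₀ / c := by positivity
    have h4 : ∫ z in ball (0 : ℂ) 1, ‖z‖ ^ 2 * Real.exp (u z) ≤ C₀ / c := by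
      rw [le_div_iff₀ hc]
      refine le_trans ?_ hC
      rw [mul_comm]
      exact mul_le_mul_of_nonneg_right hlam (setIntegral_nonneg measurableSet_ball fun z _ => by
        positivity)
    nlinarith [Real.pi_gt_three]
  have hbal : m₀ / 2 ≤ b - b ^ 2 / (16 * π) := by
    have : b ^ 2 / (16 * π) ≤ b / 2 := by
      rw [div_le_iff₀ (by positivity)]; nlinarith
    linarith
  have t1 : (2 * M * e + e ^ 2) / (16 * π) ≤ m₀ / 16 := by
    rw [div_le_iff₀ (by positivity)]
    nlinarith [Real.pi_gt_three]
  have t2 : 48 * π * L ^ 2 * a / κ = 48 * π * L ^ 2 / κ * a := by ring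
  have t3 : CV * R * C₀ / 2 ≤ CV * C₀ / 2 * R₀ := by
    have := hV.deriv_nonneg
    calc _ = CV * C₀ / 2 * R := by ring
      _ ≤ _ := by gcongr
  have := le_abs_self (b - b ^ 2 / (16 * π))
  rw [t2] at hkey
  linarith

end IsLiouvilleSol

lemma norm_du_le {u : ℂ → ℝ} (z : ℂ) : ‖du u z‖ ≤ ‖fderiv ℝ u z‖ := by
  have h1 : ‖fderiv ℝ u z 1‖ ≤ ‖fderiv ℝ u z‖ := by
    simpa using (fderiv ℝ u z).le_opNorm 1
  have h2 : ‖fderiv ℝ u z Complex.I‖ ≤ ‖fderiv ℝ u z‖ := by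
    simpa using (fderiv ℝ u z).le_opNorm Complex.I
  have h3 := norm_sub_le (fderiv ℝ u z 1 : ℂ) (Complex.I * (fderiv ℝ u z Complex.I : ℂ))
  rw [norm_mul, Complex.norm_I, one_mul, Complex.norm_real, Complex.norm_real] at h3
  rw [du, norm_div, Complex.norm_two]
  linarith

lemma exists_weightBounds {V : ℂ → ℝ} (hV1 : ContDiffOn ℝ 1 V (closedBall (0 : ℂ) 1))
    (hVpos : ∀ x ∈ closedBall (0 : ℂ) 1, 0 < V x) : ∃ Vm VM CV : ℝ, WeightBounds V Vm VM CV := by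
  have hK := isCompact_closedBall (0 : ℂ) 1
  have hne : (closedBall (0 : ℂ) 1).Nonempty := ⟨0, by simp⟩
  obtain ⟨x, hx, hxm⟩ := hK.exists_isMinOn hne hV1.continuousOn
  obtain ⟨y, hy, hyM⟩ := hK.exists_isMaxOn hne hV1.continuousOn
  have hu : UniqueDiffOn ℝ (closedBall (0 : ℂ) 1) := by
    refine uniqueDiffOn_convex (convex_closedBall _ _) ?_
    rw [interior_closedBall _ one_ne_zero]
    exact ⟨0, by simp⟩
  obtain ⟨B, hB⟩ := hK.exists_bound_of_continuousOn (hV1.continuousOn_fderivWithin hu le_rfl)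
  refine ⟨V x, V y, B, ⟨hVpos x hx, fun z hz => hxm hz, fun z hz => hyM hz, fun z hz => ?_⟩⟩
  refine (norm_du_le z).trans ?_
  rw [← fderivWithin_of_mem_nhds (mem_of_superset (isOpen_ball.mem_nhds hz) ball_subset_closedBall)]
  exact hB z (ball_subset_closedBall hz)

/-- A sequence of solutions with bounded mass that blows up exactly at the origin. -/
structure IsBubbling (lam : ℕ → ℝ) (V : ℂ → ℝ) (v : ℕ → ℂ → ℝ) (C₀ : ℝ) : Prop where
  sol : ∀ k, IsLiouvilleSol (lam k) V (v k)
  mass : ∀ k, lam k * ∫ x in ball (0 : ℂ) 1, ‖x‖ ^ 2 * Real.exp (v k x) ≤ C₀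
  blowup : ∀ M₀ : ℝ, ∀ᶠ k in atTop, ∃ x ∈ ball (0 : ℂ) 1, M₀ < v k x
  away : ∀ ε : ℝ, 0 < ε → ε < 1 → ∃ C : ℝ, ∀ k, ∀ x : ℂ, ε ≤ ‖x‖ → ‖x‖ ≤ 1 → v k x ≤ C

namespace IsBubbling

variable {lam : ℕ → ℝ} {V : ℂ → ℝ} {v : ℕ → ℂ → ℝ} {C₀ : ℝ}

lemma mass_bound_nonneg (h : IsBubbling lam V v C₀) : 0 ≤ C₀ :=
  (mul_nonneg (h.sol 0).lam_pos.le
    (setIntegral_nonneg measurableSet_ball fun _ _ => by positivity)).trans (h.mass 0)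

lemma tendsto_lam (h : IsBubbling lam V v C₀) : Tendsto lam atTop (𝓝 0) := by
  obtain ⟨Vm, VM, CV, hV⟩ := exists_weightBounds (h.sol 0).smooth_weight (h.sol 0).weight_pos
  have hVM := hV.upper_pos
  refine tendsto_order.2 ⟨fun a ha => Eventually.of_forall fun k => ha.trans (h.sol k).lam_pos,
    fun c hc => ?_⟩
  obtain ⟨ρ, hρ, hρ1, hrad⟩ := IsLiouvilleSol.exists_radius_of_le (CV := CV) hV.pos hVM
    h.mass_bound_nonneg hc
  obtain ⟨C, hC⟩ := h.away (ρ / 2) (by positivity) (by linarith)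
  filter_upwards [h.blowup (max C (Real.log (16 / (c * VM * ρ ^ 4))))] with k ⟨y, hy, hky⟩
  by_contra! hck
  obtain ⟨x, hx, hxM⟩ := (isCompact_closedBall (0 : ℂ) 1).exists_isMaxOn ⟨0, by simp⟩
    (h.sol k).continuousOn
  have hyx : max C (Real.log (16 / (c * VM * ρ ^ 4))) < v k x :=
    hky.trans_le (hxM (ball_subset_closedBall hy))
  have hxρ : ‖x‖ < ρ / 2 := by
    by_contra! hcon
    exact absurd (hC k x hcon (by simpa using hx)) ((le_max_left _ _).trans_lt hyx).not_ge
  have h1 := hrad (lam k) V (v k) (h.sol k) hV hck (h.mass k) x (fun z hz => hxM hz) hxρ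
  have h2 : 16 / (c * VM * ρ ^ 4) < Real.exp (v k x) :=
    (Real.log_lt_iff_lt_exp (by positivity)).1 ((le_max_right _ _).trans_lt hyx)
  rw [div_lt_iff₀ (by positivity)] at h2
  have h3 : c * (VM * Real.exp (v k x) * ρ ^ 4) ≤ lam k * (VM * Real.exp (v k x) * ρ ^ 4) :=
    mul_le_mul_of_nonneg_right hck (by positivity)
  linarith

/-- Away from the origin, `lam k * exp (v k)` tends to zero uniformly. -/
lemma eventually_exp_le (h : IsBubbling lam V v C₀) {ρ η : ℝ} (hρ : 0 < ρ) (hη : 0 < η) :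
    ∀ᶠ k in atTop, ∀ x : ℂ, ρ ≤ ‖x‖ → ‖x‖ ≤ 1 → lam k * Real.exp (v k x) ≤ η := by
  have hρ' : 0 < min ρ (1 / 2) := by positivity
  obtain ⟨C, hC⟩ := h.away (min ρ (1 / 2)) hρ' ((min_le_right _ _).trans_lt (by norm_num))
  have h1 : Tendsto (fun k => lam k * Real.exp C) atTop (𝓝 0) := by
    simpa using h.tendsto_lam.mul_const (Real.exp C)
  filter_upwards [h1.eventually_lt_const hη] with k hk x hx1 hx2
  refine le_trans ?_ hk.le
  exact mul_le_mul_of_nonneg_left (Real.exp_le_exp.2 (hC k x ((min_le_left _ _).trans hx1) hx2))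
    (h.sol k).lam_pos.le

/-- Concentration: a weighted integral tends to zero as soon as the weight vanishes suitably
at the origin. -/
lemma tendsto_integral (h : IsBubbling lam V v C₀) {R : ℝ} (hR : R ≤ 1) {w : ℂ → ℂ} {K : ℝ}
    (hK : ∀ z ∈ ball (0 : ℂ) R, ‖w z‖ ≤ K)
    (hw : AEStronglyMeasurable w (volume.restrict (ball 0 R)))
    (h0 : ∀ ε > 0, ∃ ρ > 0, ∀ z ∈ ball (0 : ℂ) R, ‖z‖ < ρ → ‖w z‖ ≤ ε * ‖z‖ ^ 2) :
    Tendsto (fun k => ∫ z in ball (0 : ℂ) R, (lam k * Real.exp (v k z) : ℝ) * w z) atTop (𝓝 0) := by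
  have hC₀ := h.mass_bound_nonneg
  have hsub := ball_subset_ball (x := (0:ℂ)) hR
  rw [Metric.tendsto_nhds]
  intro ε hε
  obtain ⟨ρ, hρ, hw0⟩ := h0 (ε / (2 * (C₀ + 1))) (by positivity)
  set η := ε / (4 * π * (|K| + 1)) with hη
  have hη0 : 0 < η := by positivity
  filter_upwards [h.eventually_exp_le hρ hη0] with k hk
  have hl := (h.sol k).lam_pos
  have hmeas : AEStronglyMeasurable (fun z => ((lam k * Real.exp (v k z) : ℝ) : ℂ) * w z)
      (volume.restrict (ball 0 R)) := by
    have := (h.sol k).continuousOn.mono (hsub.trans ball_subset_closedBall)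
    have hc : ContinuousOn (fun z => ((lam k * Real.exp (v k z) : ℝ) : ℂ)) (ball 0 R) := by
      fun_prop
    exact (hc.aestronglyMeasurable measurableSet_ball).mul hw
  set F := fun z => ((lam k * Real.exp (v k z) : ℝ) : ℂ) * w z with hF
  have hFn : ∀ z, ‖F z‖ = lam k * Real.exp (v k z) * ‖w z‖ := fun z => by
    rw [hF]; simp only [norm_mul, Complex.norm_real]
    rw [Real.norm_of_nonneg hl.le, Real.norm_of_nonneg (Real.exp_pos _).le]
  obtain ⟨B, hB⟩ := (isCompact_closedBall (0 : ℂ) 1).exists_bound_of_continuousOn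
    ((h.sol k).continuousOn.rexp)
  have hint : IntegrableOn F (ball 0 R) := by
    refine IntegrableOn.of_bound measure_ball_lt_top hmeas
      (lam k * B * K) ((ae_restrict_mem measurableSet_ball).mono fun z hz => ?_)
    rw [hFn]
    have h1 := hB z (ball_subset_closedBall (hsub hz))
    rw [Real.norm_of_nonneg (Real.exp_pos _).le] at h1
    have h2 := hK z hz
    have := (Real.exp_pos (v k z)).le.trans h1
    gcongr
  rw [dist_zero_right, ← integral_inter_add_sdiff (t := ball 0 ρ) measurableSet_ball hint]
  have e1 : ‖∫ z in ball (0:ℂ) R ∩ ball 0 ρ, F z‖ ≤ ε / (2 * (C₀ + 1)) * C₀ := by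
    refine (h.sol k).norm_integral_le_mass (inter_subset_left.trans hsub)
      (measurableSet_ball.inter measurableSet_ball) (by positivity) (h.mass k) fun z hz => ?_
    rw [hFn]
    have h1 := hw0 z hz.1 (by simpa using hz.2)
    calc _ ≤ lam k * Real.exp (v k z) * (ε / (2 * (C₀ + 1)) * ‖z‖ ^ 2) := by gcongr
      _ = _ := by ring
  have e2 : ‖∫ z in ball (0:ℂ) R \ ball 0 ρ, F z‖ ≤ η * |K| * π := by
    have hvol : volume.real (ball (0:ℂ) 1) = π := by
      rw [Measure.real, Complex.volume_ball]; simp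
    have hm : volume.real (ball (0:ℂ) R \ ball 0 ρ) ≤ π := by
      rw [← hvol]
      exact measureReal_mono (sdiff_subset.trans hsub) measure_ball_lt_top.ne
    have := norm_setIntegral_le_of_norm_le_const (μ := volume) (s := ball (0:ℂ) R \ ball 0 ρ)
      (f := F) (C := η * |K|) ((measure_mono (sdiff_subset.trans hsub)).trans_lt measure_ball_lt_top)
      fun z hz => by
        rw [hFn]
        have h1 := hk z (by simpa using hz.2) (by simpa using (ball_subset_closedBall (hsub hz.1)))
        have h2 := (hK z hz.1).trans (le_abs_self K)
        gcongr
    exact this.trans (by gcongr)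
  have e3 : ε / (2 * (C₀ + 1)) * C₀ ≤ ε / 2 := by
    rw [div_mul_eq_mul_div, div_le_div_iff₀ (by positivity) (by positivity)]
    nlinarith
  have e4 : η * |K| * π < ε / 2 := by
    have : η * (|K| + 1) * π = ε / 4 := by rw [hη]; field_simp
    nlinarith [Real.pi_pos]
  exact (norm_add_le _ _).trans_lt (by linarith)

end IsBubbling

lemma circle_integral_inv_pow {n : ℕ} (hn : n ≠ 0) (R : ℝ) :
    ∫ θ in (-π)..π, (circleMap 0 R θ)⁻¹ ^ n = 0 := by
  have e : ∀ θ : ℝ, (circleMap 0 R θ)⁻¹ ^ n =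
      (R : ℂ)⁻¹ ^ n * Complex.exp (-(n * Complex.I) * θ) := fun θ => by
    rw [circleMap_zero, mul_inv, mul_pow, ← Complex.exp_neg, ← Complex.exp_nat_mul]
    ring_nf
  have hc : -(n * Complex.I) ≠ 0 := by simp [hn]
  simp_rw [e]
  rw [intervalIntegral.integral_const_mul, integral_exp_mul_complex hc]
  have : Complex.exp (-(n * Complex.I) * ((-π : ℝ) : ℂ)) = Complex.exp (-(n * Complex.I) * (π : ℂ)) := by
    have h := Complex.exp_periodic.nat_mul n (-(n * Complex.I) * (π : ℂ))
    rw [← h]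
    push_cast; ring_nf
  rw [this]; simp

lemma du_eq_zero_of_grad {V : ℂ → ℝ} {z : ℂ} (h : grad V z = 0) : du V z = 0 := by
  have h1 := congrArg Complex.re h
  have h2 := congrArg Complex.im h
  simp [grad, dderiv] at h1 h2
  simp [du, h1, h2]

namespace IsBubbling

variable {lam : ℕ → ℝ} {V : ℂ → ℝ} {v : ℕ → ℂ → ℝ} {C₀ : ℝ}

/-- Away from the origin `v k` looks like a multiple of the Green function. -/
lemma eventually_norm_du_add_le (h : IsBubbling lam V v C₀) {Vm VM CV : ℝ}
    (hV : WeightBounds V Vm VM CV) {ε : ℝ} (hε : 0 < ε) :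
    ∀ᶠ k in atTop, ∃ b : ℝ, 0 ≤ b ∧ b ≤ VM * C₀ ∧ ∀ z ∈ sphere (0 : ℂ) (1 / 2),
      ‖4 * π * (z * du (v k) z) + b‖ ≤ ε := by
  have hVM := hV.upper_pos
  have hC₀ := h.mass_bound_nonneg
  set ρ := min (1 / 4) (ε / (16 * (VM * C₀ + 1))) with hρdef
  have hρ : 0 < ρ := by positivity
  have hρ1 : ρ ≤ 1 / 4 := min_le_left _ _
  have hρ2 : 8 * ρ * (VM * C₀) ≤ ε / 2 := by
    have h1 : ρ ≤ ε / (16 * (VM * C₀ + 1)) := min_le_right _ _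
    rw [le_div_iff₀ (by positivity)] at h1
    nlinarith
  filter_upwards [h.eventually_exp_le hρ (η := ε / (5 * π) / VM) (by positivity)] with k hk
  have hs := h.sol k
  have hsub : ball (0 : ℂ) ρ ⊆ ball 0 1 := ball_subset_ball (by linarith)
  have hb := hs.mass_le hV (h.mass k) hsub
  have hb0 := hs.mass_nonneg hsub measurableSet_ball
  refine ⟨∫ z in ball (0 : ℂ) ρ, dens (lam k) V (v k) z, hb0, hb, fun z hz => ?_⟩
  have hz2 : ‖z‖ = 1 / 2 := by simpa using hz
  obtain ⟨B, hB⟩ := hs.exists_dens_le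
  have hl := hs.lam_pos
  have h1 := hs.isSol.norm_du_add_le hs.continuousOn hs.zero hs.dens_nonneg' hB (x := z) (ρ := ρ)
    (σ := 1) (η := ε / (5 * π)) (norm_pos_iff.1 (by rw [hz2]; norm_num)) hz2.le hρ
    (by rw [hz2]; linarith) (by rw [hz2]; norm_num) le_rfl (fun y hy1 hy2 => by
      refine (hs.dens_le hV (by simpa using hy2.le)).trans ?_
      have h1 := hk y hy1 hy2.le
      rw [le_div_iff₀ hVM] at h1
      have h2 : ‖y‖ ^ 2 ≤ 1 := pow_le_one₀ (norm_nonneg _) hy2.le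
      calc lam k * VM * (‖y‖ ^ 2 * Real.exp (v k y)) =
            ‖y‖ ^ 2 * (lam k * Real.exp (v k y) * VM) := by ring
        _ ≤ 1 * (lam k * Real.exp (v k y) * VM) := by gcongr
        _ ≤ _ := by rwa [one_mul]) (by positivity)
  rw [sdiff_self, setIntegral_empty, hz2] at h1
  refine h1.trans ?_
  have e : 5 * π * (ε / (5 * π)) * 1 * (1 / 2) = ε / 2 := by field_simp
  rw [e]
  have : 4 * (ρ / (1 / 2)) * (∫ y in ball (0:ℂ) ρ, dens (lam k) V (v k) y) ≤ 8 * ρ * (VM * C₀) := by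
    calc _ = 8 * ρ * (∫ y in ball (0:ℂ) ρ, dens (lam k) V (v k) y) := by ring
      _ ≤ _ := by gcongr
  linarith

lemma tendsto_circle_integral_sq (h : IsBubbling lam V v C₀) {w : ℂ → ℂ}
    (hw : ContinuousOn w (sphere 0 (1 / 2))) (hw0 : ∫ θ in (-π)..π, w (circleMap 0 (1 / 2) θ) = 0) :
    Tendsto (fun k => ∫ θ in (-π)..π, w (circleMap 0 (1 / 2) θ) *
      (circleMap 0 (1 / 2) θ * du (v k) (circleMap 0 (1 / 2) θ)) ^ 2) atTop (𝓝 0) := by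
  obtain ⟨Vm, VM, CV, hV⟩ := exists_weightBounds (h.sol 0).smooth_weight (h.sol 0).weight_pos
  obtain ⟨W, hW⟩ := (isCompact_sphere (0 : ℂ) (1 / 2)).exists_bound_of_continuousOn hw
  have hVM := hV.upper_pos
  have hC₀ := h.mass_bound_nonneg
  rw [Metric.tendsto_nhds]
  intro ε hε
  have hsm : ∀ᶠ e : ℝ in 𝓝[>] 0, |W| * (2 * (VM * C₀) * e + e ^ 2) / (8 * π) < ε := by
    have : Tendsto (fun e : ℝ => |W| * (2 * (VM * C₀) * e + e ^ 2) / (8 * π)) (𝓝[>] 0)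
        (𝓝 (|W| * (2 * (VM * C₀) * 0 + 0 ^ 2) / (8 * π))) :=
      (Continuous.tendsto (by fun_prop) 0).mono_left nhdsWithin_le_nhds
    exact this.eventually_lt_const (by simpa using hε)
  obtain ⟨e, he, he0⟩ := (hsm.and self_mem_nhdsWithin).exists
  replace he0 : 0 < e := he0
  filter_upwards [h.eventually_norm_du_add_le hV he0] with k ⟨b, hb0, hb, hE⟩
  have hsub : sphere (0 : ℂ) (1 / 2) ⊆ ball 0 1 := sphere_subset_closedBall.trans
    (closedBall_subset_ball (by norm_num))
  have h1 := norm_circle_integral_sq_sub_le (ψ := fun z => z * du (v k) z) (by norm_num) hw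
    (continuousOn_id.mul ((h.sol k).isSol.contDiffOn_du.continuousOn.mono hsub))
    (fun z hz => (hW z hz).trans (le_abs_self W)) hE hb0
  rw [hw0, mul_zero, sub_zero] at h1
  rw [dist_zero_right]
  refine (h1.trans ?_).trans_lt he
  gcongr

lemma tendsto_circle_integral_exp (h : IsBubbling lam V v C₀) {w : ℂ → ℂ}
    (hw : ContinuousOn w (sphere 0 (1 / 2))) :
    Tendsto (fun k => ∫ θ in (-π)..π, w (circleMap 0 (1 / 2) θ) *
      ((lam k * Real.exp (v k (circleMap 0 (1 / 2) θ)) : ℝ) : ℂ)) atTop (𝓝 0) := by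
  obtain ⟨W, hW⟩ := (isCompact_sphere (0 : ℂ) (1 / 2)).exists_bound_of_continuousOn hw
  rw [Metric.tendsto_nhds]
  intro ε hε
  filter_upwards [h.eventually_exp_le (ρ := 1 / 2) (η := ε / (4 * π * (|W| + 1))) (by norm_num)
    (by positivity)] with k hk
  have hl := (h.sol k).lam_pos
  have h1 := intervalIntegral.norm_integral_le_of_norm_le_const (a := -π) (b := π)
    (f := fun θ => w (circleMap 0 (1 / 2) θ) *
      ((lam k * Real.exp (v k (circleMap 0 (1 / 2) θ)) : ℝ) : ℂ))
    (C := (|W| + 1) * (ε / (4 * π * (|W| + 1)))) fun θ _ => by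
      have hz := circleMap_mem_sphere (0 : ℂ) (by norm_num : (0:ℝ) ≤ 1 / 2) θ
      have hn : ‖circleMap 0 (1 / 2) θ‖ = 1 / 2 := by simp
      have h2 := hk _ hn.ge (by rw [hn]; norm_num)
      rw [norm_mul, Complex.norm_real, Real.norm_of_nonneg (by positivity)]
      have h3 : ‖w (circleMap 0 (1 / 2) θ)‖ ≤ |W| + 1 := by
        linarith [hW _ hz, le_abs_self W]
      gcongr
  rw [dist_zero_right]
  refine h1.trans_lt ?_
  rw [show π - -π = 2 * π by ring, abs_of_pos Real.two_pi_pos]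
  have : (|W| + 1) * (ε / (4 * π * (|W| + 1))) * (2 * π) = ε / 2 := by field_simp; norm_num
  linarith

lemma tendsto_integral_sub (h : IsBubbling lam V v C₀) {w : ℂ → ℂ} {K : ℝ}
    (hK : ∀ z ∈ ball (0 : ℂ) 1, ‖w z‖ ≤ K) (hw : ContinuousOn w (ball 0 1)) :
    Tendsto (fun k => (∫ z in ball (0 : ℂ) 1, ((lam k * Real.exp (v k z) : ℝ) : ℂ) * w z) -
      ∫ z in ball (0 : ℂ) (1 / 2), ((lam k * Real.exp (v k z) : ℝ) : ℂ) * w z) atTop (𝓝 0) := by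
  have hsub : ball (0 : ℂ) (1 / 2) ⊆ ball 0 1 := ball_subset_ball (by norm_num)
  have hm := hw.aestronglyMeasurable (μ := volume) measurableSet_ball
  have h1 := h.tendsto_integral (R := 1) (w := (ball (0 : ℂ) (1 / 2))ᶜ.indicator w) (K := K) le_rfl
    (fun z hz => (norm_indicator_le_norm_self _ _).trans (hK z hz))
    (hm.indicator measurableSet_ball.compl)
    (fun ε hε => ⟨1 / 2, by norm_num, fun z _ hz => by
      rw [indicator_of_notMem (by simpa using hz), norm_zero]; positivity⟩)
  refine h1.congr fun k => ?_
  have hint : IntegrableOn (fun z => ((lam k * Real.exp (v k z) : ℝ) : ℂ) * w z) (ball 0 1) := by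
    have hc : ContinuousOn (fun z => lam k * Real.exp (v k z)) (closedBall 0 1) := by
      have := (h.sol k).continuousOn
      fun_prop
    obtain ⟨B, hB⟩ := (isCompact_closedBall (0 : ℂ) 1).exists_bound_of_continuousOn hc
    have hc' : ContinuousOn (fun z => ((lam k * Real.exp (v k z) : ℝ) : ℂ)) (ball 0 1) :=
      Complex.continuous_ofReal.comp_continuousOn (hc.mono ball_subset_closedBall)
    refine IntegrableOn.of_bound measure_ball_lt_top
      ((hc'.aestronglyMeasurable measurableSet_ball).mul hm)
      (B * K) ((ae_restrict_mem measurableSet_ball).mono fun z hz => ?_)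
    have h1 := hB z (ball_subset_closedBall hz)
    rw [norm_mul, Complex.norm_real]
    have h2 := hK z hz
    have := (norm_nonneg _).trans h1
    gcongr
  rw [← setIntegral_sdiff measurableSet_ball hint hsub, sdiff_eq, ← setIntegral_indicator
    measurableSet_ball.compl]
  refine setIntegral_congr_fun measurableSet_ball fun z _ => ?_
  by_cases hz : z ∈ (ball (0 : ℂ) (1 / 2))ᶜ
  · simp only [indicator_of_mem hz]
  · simp only [indicator_of_notMem hz, mul_zero]

end IsBubbling

namespace IsBubbling

variable {lam : ℕ → ℝ} {V : ℂ → ℝ} {v : ℕ → ℂ → ℝ} {C₀ : ℝ}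

lemma integrableOn_half (h : IsBubbling lam V v C₀) {w : ℂ → ℂ} (hw : ContinuousOn w (ball 0 1)) (k : ℕ) :
    IntegrableOn (fun z => ((lam k * Real.exp (v k z) : ℝ) : ℂ) * w z) (ball 0 (1 / 2)) := by
  have hsub : closedBall (0 : ℂ) (1 / 2) ⊆ ball 0 1 := closedBall_subset_ball (by norm_num)
  have h1 := (h.sol k).continuousOn.mono (hsub.trans ball_subset_closedBall)
  have h2 := hw.mono hsub
  have hc : ContinuousOn (fun z => ((lam k * Real.exp (v k z) : ℝ) : ℂ) * w z)
      (closedBall 0 (1 / 2)) := by fun_prop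
  exact (hc.integrableOn_compact (isCompact_closedBall _ _)).mono_set ball_subset_closedBall

lemma tendsto_integral_conj (h : IsBubbling lam V v C₀) (hV0 : du V 0 = 0) :
    Tendsto (fun k => ∫ z in ball (0 : ℂ) (1 / 2),
      ((lam k * Real.exp (v k z) : ℝ) : ℂ) * (conj z * V z)) atTop (𝓝 0) := by
  obtain ⟨Vm, VM, CV, hV⟩ := exists_weightBounds (h.sol 0).smooth_weight (h.sol 0).weight_pos
  have hcV := (h.sol 0).smooth_weight.continuousOn
  have hcd := (h.sol 0).continuousOn_du_weight
  have hss : sphere (0 : ℂ) (1 / 2) ⊆ closedBall 0 1 := sphere_subset_closedBall.trans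
    (closedBall_subset_closedBall (by norm_num))
  have hsub : ball (0 : ℂ) (1 / 2) ⊆ ball 0 1 := ball_subset_ball (by norm_num)
  have hCd : ContinuousOn (fun z => z * conj z * du V z) (ball 0 1) := by
    have : Continuous fun z : ℂ => z * conj z := by fun_prop
    exact this.continuousOn.mul hcd
  have hCv : ContinuousOn (fun z : ℂ => conj z * V z) (ball 0 1) := by
    have := hcV.mono ball_subset_closedBall
    have h2 : Continuous fun z : ℂ => conj z := by fun_prop
    exact h2.continuousOn.mul (Complex.continuous_ofReal.comp_continuousOn this)
  have t1 := h.tendsto_circle_integral_sq (w := fun z => z⁻¹ ^ 1)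
    (ContinuousOn.pow (continuousOn_id.inv₀ fun z hz h0 => by
      rw [show z = 0 from h0] at hz; norm_num at hz) _) (circle_integral_inv_pow one_ne_zero _)
  have t2 := h.tendsto_circle_integral_exp (w := fun z => conj z * (z * conj z * V z)) (by
    have := hcV.mono hss
    have h2 : Continuous fun z : ℂ => conj z := by fun_prop
    exact h2.continuousOn.mul ((continuousOn_id.mul h2.continuousOn).mul
      (Complex.continuous_ofReal.comp_continuousOn this)))
  have t3 := h.tendsto_integral (R := 1 / 2) (w := fun z => z * conj z * du V z) (K := CV)
    (by norm_num) (fun z hz => by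
      have h1 := hV.deriv z (hsub hz)
      have h2 : ‖z‖ < 1 := by simpa using hsub hz
      rw [norm_mul, norm_mul, Complex.norm_conj]
      have h3 : ‖z‖ * ‖z‖ ≤ 1 := by nlinarith [norm_nonneg z]
      calc _ ≤ 1 * CV := mul_le_mul h3 h1 (norm_nonneg _) zero_le_one
        _ = CV := one_mul _)
    ((hCd.mono hsub).aestronglyMeasurable measurableSet_ball) (fun ε hε => by
      have h1 := (hcd.continuousAt (isOpen_ball.mem_nhds (mem_ball_self one_pos))).tendsto
      rw [hV0, Metric.tendsto_nhds_nhds] at h1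
      obtain ⟨ρ, hρ, h2⟩ := h1 ε hε
      refine ⟨ρ, hρ, fun z _ hz => ?_⟩
      have h3 := h2 (by simpa using hz)
      rw [dist_zero_right] at h3
      rw [norm_mul, norm_mul, Complex.norm_conj, ← sq, mul_comm]
      gcongr)
  have hsum := (t1.add (t2.div_const 2)).sub t3
  simp only [zero_div, add_zero, sub_zero] at hsum
  refine hsum.congr fun k => ?_
  have hp := (h.sol k).pohozaev (g := fun z => z) (by fun_prop) (R := 1 / 2) (by norm_num) (by norm_num)
  have e1 : ∫ θ in (-π)..π, circleMap 0 (1 / 2) θ * du (v k) (circleMap 0 (1 / 2) θ) ^ 2 =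
      ∫ θ in (-π)..π, (circleMap 0 (1 / 2) θ)⁻¹ ^ 1 *
        (circleMap 0 (1 / 2) θ * du (v k) (circleMap 0 (1 / 2) θ)) ^ 2 := by
    refine intervalIntegral.integral_congr fun θ _ => ?_
    have := circleMap_ne_center (c := 0) (R := 1 / 2) (θ := θ) (by norm_num)
    field_simp
  have e2 : ∫ θ in (-π)..π, conj (circleMap 0 (1 / 2) θ) * (circleMap 0 (1 / 2) θ *
        conj (circleMap 0 (1 / 2) θ) * (lam k * V (circleMap 0 (1 / 2) θ) *
          Real.exp (v k (circleMap 0 (1 / 2) θ)))) =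
      ∫ θ in (-π)..π, conj (circleMap 0 (1 / 2) θ) * (circleMap 0 (1 / 2) θ *
        conj (circleMap 0 (1 / 2) θ) * V (circleMap 0 (1 / 2) θ)) *
        ((lam k * Real.exp (v k (circleMap 0 (1 / 2) θ)) : ℝ) : ℂ) := by
    refine intervalIntegral.integral_congr fun θ _ => ?_
    push_cast; ring
  have e3 : ∫ z in ball (0 : ℂ) (1 / 2), (deriv (fun z : ℂ => z) z * conj z *
        (lam k * V z * Real.exp (v k z)) + z * conj z * (lam k * Real.exp (v k z) * du V z)) =
      (∫ z in ball (0 : ℂ) (1 / 2), ((lam k * Real.exp (v k z) : ℝ) : ℂ) * (conj z * V z)) +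
      ∫ z in ball (0 : ℂ) (1 / 2), ((lam k * Real.exp (v k z) : ℝ) : ℂ) * (z * conj z * du V z) := by
    rw [← integral_add (h.integrableOn_half hCv k) (h.integrableOn_half hCd k)]
    refine integral_congr_ae (Eventually.of_forall fun z => ?_)
    simp only [deriv_id'']
    push_cast; ring
  rw [e1, e2, e3] at hp
  linear_combination 2 * hp

lemma tendsto_integral_conj_ball (h : IsBubbling lam V v C₀) (hV0 : du V 0 = 0) :
    Tendsto (fun k => ∫ z in ball (0 : ℂ) 1,
      ((lam k * Real.exp (v k z) : ℝ) : ℂ) * (conj z * V z)) atTop (𝓝 0) := by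
  have hcV := (h.sol 0).smooth_weight.continuousOn
  have hCv : ContinuousOn (fun z : ℂ => conj z * V z) (closedBall 0 1) := by
    have h2 : Continuous fun z : ℂ => conj z := by fun_prop
    exact h2.continuousOn.mul (Complex.continuous_ofReal.comp_continuousOn hcV)
  obtain ⟨K, hK⟩ := (isCompact_closedBall (0 : ℂ) 1).exists_bound_of_continuousOn hCv
  have h1 := h.tendsto_integral_sub (fun z hz => hK z (ball_subset_closedBall hz))
    (hCv.mono ball_subset_closedBall)
  simpa using h1.add (h.tendsto_integral_conj hV0)

lemma tendsto_du_zero (h : IsBubbling lam V v C₀) (hV0 : du V 0 = 0) :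
    Tendsto (fun k => du (v k) 0) atTop (𝓝 0) := by
  obtain ⟨Vm, VM, CV, hV⟩ := exists_weightBounds (h.sol 0).smooth_weight (h.sol 0).weight_pos
  have hVM := hV.upper_pos
  have hcV := (h.sol 0).smooth_weight.continuousOn
  have hconj : Continuous fun z : ℂ => conj z := by fun_prop
  have hCv : ContinuousOn (fun z : ℂ => conj z * V z) (closedBall 0 1) :=
    hconj.continuousOn.mul (Complex.continuous_ofReal.comp_continuousOn hcV)
  have hCw : ContinuousOn (fun z : ℂ => (‖z‖ ^ 2 : ℝ) * (conj z * V z)) (closedBall 0 1) := by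
    have : Continuous fun z : ℂ => ((‖z‖ ^ 2 : ℝ) : ℂ) := by fun_prop
    exact this.continuousOn.mul hCv
  have hb : ∀ z ∈ ball (0 : ℂ) 1, ‖((‖z‖ ^ 2 : ℝ) : ℂ) * (conj z * V z)‖ ≤ ‖z‖ ^ 2 * (‖z‖ * VM) := by
    intro z hz
    have h1 := hV.upper z (ball_subset_closedBall hz)
    have h2 := (h.sol 0).weight_pos z (ball_subset_closedBall hz)
    rw [norm_mul, norm_mul, Complex.norm_real, Complex.norm_real, Complex.norm_conj,
      Real.norm_of_nonneg h2.le, Real.norm_of_nonneg (by positivity)]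
    gcongr
  have t := h.tendsto_integral (R := 1) (w := fun z => ((‖z‖ ^ 2 : ℝ) : ℂ) * (conj z * V z)) (K := VM)
    le_rfl (fun z hz => (hb z hz).trans (by
      have h1 : ‖z‖ ≤ 1 := by simpa using ball_subset_closedBall hz
      calc _ ≤ 1 ^ 2 * (1 * VM) := by gcongr
        _ = VM := by ring))
    ((hCw.mono ball_subset_closedBall).aestronglyMeasurable measurableSet_ball) (fun ε hε =>
      ⟨ε / VM, by positivity, fun z hz hzε => (hb z hz).trans (by
        rw [lt_div_iff₀ hVM] at hzε
        rw [mul_comm]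
        gcongr)⟩)
  have hsum := ((h.tendsto_integral_conj_ball hV0).sub t).div_const (4 * π)
  simp only [sub_zero, zero_div] at hsum
  refine hsum.congr fun k => ?_
  have hs := h.sol k
  obtain ⟨B, hB⟩ := hs.exists_dens_le
  have hd := hs.isSol.du_eq hs.continuousOn hs.zero hB (x := 0) (by simp)
  have hi : ∀ w : ℂ → ℂ, ContinuousOn w (closedBall 0 1) → IntegrableOn
      (fun z => ((lam k * Real.exp (v k z) : ℝ) : ℂ) * w z) (ball 0 1) := fun w hw => by
    have := hs.continuousOn
    have hc : ContinuousOn (fun z => ((lam k * Real.exp (v k z) : ℝ) : ℂ) * w z)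
      (closedBall 0 1) := by fun_prop
    exact (hc.integrableOn_compact (isCompact_closedBall _ _)).mono_set ball_subset_closedBall
  rw [← integral_sub (hi _ hCv) (hi _ hCw), div_eq_iff (by simp [Real.pi_ne_zero]),
    mul_comm (du (v k) 0), hd]
  refine integral_congr_ae (Eventually.of_forall fun z => ?_)
  rcases eq_or_ne z 0 with rfl | hz
  · simp [dens]
  · simp only [dens, sub_zero, zero_mul, div_one, mul_sub]
    have h1 : ((‖z‖ : ℝ) : ℂ) ^ 2 = z * conj z := by rw [Complex.mul_conj']
    push_cast
    rw [h1]
    field_simp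

lemma tendsto_fderiv_zero (h : IsBubbling lam V v C₀) (hV0 : du V 0 = 0) (w : ℂ) :
    Tendsto (fun k => fderiv ℝ (v k) 0 w) atTop (𝓝 0) := by
  have h1 := ((Complex.continuous_re.tendsto _).comp
    ((h.tendsto_du_zero hV0).const_mul w)).const_mul 2
  simp only [mul_zero, Complex.zero_re] at h1
  exact h1.congr fun k => re_mul_du _ _ _

lemma tendsto_integral_conj_du (h : IsBubbling lam V v C₀) (hV0 : du V 0 = 0) :
    Tendsto (fun k => ∫ z in ball (0 : ℂ) 1,
      ((lam k * Real.exp (v k z) : ℝ) : ℂ) * (conj z * du V z)) atTop (𝓝 0) := by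
  obtain ⟨Vm, VM, CV, hV⟩ := exists_weightBounds (h.sol 0).smooth_weight (h.sol 0).weight_pos
  have hcV := (h.sol 0).smooth_weight.continuousOn
  have hconj : Continuous fun z : ℂ => conj z := by fun_prop
  have hss : sphere (0 : ℂ) (1 / 2) ⊆ closedBall 0 1 := sphere_subset_closedBall.trans
    (closedBall_subset_closedBall (by norm_num))
  have hCd : ContinuousOn (fun z => conj z * du V z) (ball 0 1) :=
    hconj.continuousOn.mul (h.sol 0).continuousOn_du_weight
  have t1 := h.tendsto_circle_integral_sq (w := fun z => z⁻¹ ^ 2)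
    (ContinuousOn.pow (continuousOn_id.inv₀ fun z hz h0 => by
      rw [show z = 0 from h0] at hz; norm_num at hz) _) (circle_integral_inv_pow two_ne_zero _)
  have t2 := h.tendsto_circle_integral_exp (w := fun z => conj z * (conj z * V z))
    (hconj.continuousOn.mul (hconj.continuousOn.mul
      (Complex.continuous_ofReal.comp_continuousOn (hcV.mono hss))))
  have t3 := ((h.tendsto_du_zero hV0).pow 2).const_mul (2 * π : ℂ)
  have t4 := h.tendsto_integral_sub (K := CV) (fun z hz => by
      have h1 := hV.deriv z hz
      have h2 : ‖z‖ ≤ 1 := by simpa using ball_subset_closedBall hz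
      rw [norm_mul, Complex.norm_conj]
      calc _ ≤ 1 * CV := mul_le_mul h2 h1 (norm_nonneg _) zero_le_one
        _ = CV := one_mul _) hCd
  have hsum := ((t1.add (t2.div_const 2)).sub t3).add t4
  simp only [zero_div, add_zero, sub_zero, ne_eq, two_ne_zero, not_false_eq_true, zero_pow,
    mul_zero] at hsum
  refine hsum.congr fun k => ?_
  have hp := (h.sol k).pohozaev (g := fun _ => 1) (by fun_prop) (R := 1 / 2) (by norm_num) (by norm_num)
  have e1 : ∫ θ in (-π)..π, 1 * du (v k) (circleMap 0 (1 / 2) θ) ^ 2 =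
      ∫ θ in (-π)..π, (circleMap 0 (1 / 2) θ)⁻¹ ^ 2 *
        (circleMap 0 (1 / 2) θ * du (v k) (circleMap 0 (1 / 2) θ)) ^ 2 := by
    refine intervalIntegral.integral_congr fun θ _ => ?_
    have := circleMap_ne_center (c := 0) (R := 1 / 2) (θ := θ) (by norm_num)
    field_simp
  have e2 : ∫ θ in (-π)..π, conj (circleMap 0 (1 / 2) θ) * (1 *
        conj (circleMap 0 (1 / 2) θ) * (lam k * V (circleMap 0 (1 / 2) θ) *
          Real.exp (v k (circleMap 0 (1 / 2) θ)))) =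
      ∫ θ in (-π)..π, conj (circleMap 0 (1 / 2) θ) * (
        conj (circleMap 0 (1 / 2) θ) * V (circleMap 0 (1 / 2) θ)) *
        ((lam k * Real.exp (v k (circleMap 0 (1 / 2) θ)) : ℝ) : ℂ) := by
    refine intervalIntegral.integral_congr fun θ _ => ?_
    push_cast; ring
  have e3 : ∫ z in ball (0 : ℂ) (1 / 2), (deriv (fun _ : ℂ => (1 : ℂ)) z * conj z *
        (lam k * V z * Real.exp (v k z)) + 1 * conj z * (lam k * Real.exp (v k z) * du V z)) =
      ∫ z in ball (0 : ℂ) (1 / 2), ((lam k * Real.exp (v k z) : ℝ) : ℂ) * (conj z * du V z) := by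
    refine integral_congr_ae (Eventually.of_forall fun z => ?_)
    simp only [deriv_const]
    push_cast; ring
  rw [e1, e2, e3] at hp
  linear_combination 2 * hp

end IsBubbling

/-- **Proposition 7.4**: necessary integral conditions for bubbling at the origin. -/
theorem necessary_conditions_bubbling
    (lam : ℕ → ℝ) (hlam : ∀ k, 0 < lam k)
    (v : ℕ → ℂ → ℝ) (V : ℂ → ℝ)
    (hvc : ∀ k, ContinuousOn (v k) (closedBall (0 : ℂ) 1))
    (hv2 : ∀ k, ContDiffOn ℝ 2 (v k) (ball (0 : ℂ) 1))
    (hPDE : ∀ k, ∀ x ∈ ball (0 : ℂ) 1,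
      -lap (v k) x = lam k * ‖x‖ ^ 2 * V x * Real.exp (v k x))
    (hbd : ∀ k, ∀ x ∈ sphere (0 : ℂ) 1, v k x = 0)
    (C₀ : ℝ)
    (hmass : ∀ k, lam k * ∫ x in ball (0 : ℂ) 1, ‖x‖ ^ 2 * Real.exp (v k x) ≤ C₀)
    (hblow : ∀ M₀ : ℝ, ∀ᶠ k in atTop, ∃ x ∈ ball (0 : ℂ) 1, M₀ < v k x)
    (hout : ∀ εr : ℝ, 0 < εr → εr < 1 →
      ∃ Cε : ℝ, ∀ k, ∀ x : ℂ, εr ≤ ‖x‖ → ‖x‖ ≤ 1 → v k x ≤ Cε)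
    (hV1 : ContDiffOn ℝ 1 V (closedBall (0 : ℂ) 1))
    (hV2 : ∃ r : ℝ, 0 < r ∧ ContDiffOn ℝ 2 V (ball (0 : ℂ) r))
    (hVpos : ∀ x ∈ closedBall (0 : ℂ) 1, 0 < V x)
    (hV0 : grad V 0 = 0)
 :
    Tendsto (fun k => pd 1 0 (v k) 0) atTop (nhds 0) ∧
    Tendsto (fun k => pd 0 1 (v k) 0) atTop (nhds 0) ∧
    Tendsto (fun k => lam k * ∫ x in ball (0 : ℂ) 1,
        Real.exp (v k x) * (pd 1 0 V x * x.re - pd 0 1 V x * x.im))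
      atTop (nhds 0) := by
  have h : IsBubbling lam V v C₀ :=
    ⟨fun k => ⟨hlam k, hvc k, hv2 k, hPDE k, hbd k, hV1, hVpos⟩, hmass, hblow, hout⟩
  have hd := du_eq_zero_of_grad hV0
  refine ⟨h.tendsto_fderiv_zero hd 1, h.tendsto_fderiv_zero hd Complex.I, ?_⟩
  have ht := ((Complex.continuous_re.tendsto _).comp (h.tendsto_integral_conj_du hd)).const_mul 2
  simp only [Complex.zero_re, mul_zero] at ht
  refine ht.congr fun k => ?_
  obtain ⟨Vm, VM, CV, hV⟩ := exists_weightBounds hV1 hVpos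
  have hi : IntegrableOn (fun z => ((lam k * Real.exp (v k z) : ℝ) : ℂ) * (conj z * du V z))
      (ball 0 1) := by
    have hc : ContinuousOn (fun z => ((lam k * Real.exp (v k z) : ℝ) : ℂ) * conj z)
        (closedBall 0 1) := by
      have := hvc k
      have h2 : Continuous fun z : ℂ => conj z := by fun_prop
      fun_prop
    obtain ⟨B, hB⟩ := (isCompact_closedBall (0 : ℂ) 1).exists_bound_of_continuousOn hc
    simp_rw [← mul_assoc]
    refine IntegrableOn.of_bound measure_ball_lt_top
      (((hc.mono ball_subset_closedBall).mul (h.sol 0).continuousOn_du_weight).aestronglyMeasurable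
        measurableSet_ball) (B * CV) ((ae_restrict_mem measurableSet_ball).mono fun z hz => ?_)
    rw [norm_mul]
    have h1 := hB z (ball_subset_closedBall hz)
    exact mul_le_mul h1 (hV.deriv z hz) (norm_nonneg _) ((norm_nonneg _).trans h1)
  have hre := Complex.reCLM.integral_comp_comm hi
  rw [Function.comp_apply, ← Complex.reCLM_apply, ← hre, ← integral_const_mul, ← integral_const_mul]
  refine integral_congr_ae (Eventually.of_forall fun z => ?_)
  simp only [Complex.reCLM_apply, Complex.re_ofReal_mul]
  simp [du, pd, dderiv]
  ring
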